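/- Assume (B0)–(B3), fix ȳ ∈ cl V, and let ũ : cl U_ȳ → ℝ be the modified potential of a c-convex function. There exist ε_c′ > 0 (depending only on the dimension and the cost) and a constant C(n) (depending only on the dimension) such that the following holds. Let Q := {ũ ≤ 0} ⊂ U_ȳ, assume |∂^{c̃}ũ| ≤ 1/λ in Q and ũ = 0 on ∂Q, assume Q ⊂ B ⊂ 4·B ⊂ U_ȳ for some ball B and diam(Q) ≤ ε_c′. For 1/(2n) < t ≤ 1, let q_t ∈ Q be a point with q_t ∈ t·∂Q, where t·∂Q denotes the dilation of ∂Q with factor t about the center of the John ellipsoid E of Q. Then |ũ(q_t)|ⁿ ≤ C(n) (γ⁺_{c̃}/λ) (1−t)^{1/2^{n−1}} Lebⁿ(Q)², where γ⁺_{c̃} = γ⁺_{c̃}(Q × V). Moreover |inf_Q ũ|ⁿ / Lebⁿ(Q)² ≤ C(n) γ⁺_{c̃}/λ. -/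

import Mathlib

open Set MeasureTheory Metric Bornology
open scoped ENNReal NNReal Pointwise

noncomputable section

abbrev Euc (n : ℕ) := EuclideanSpace ℝ (Fin n)

/-- Partial gradient of the cost in the first variable: `D_x c(x,y)`. -/
noncomputable def gradX (n : ℕ) (c : Euc n → Euc n → ℝ) (x y : Euc n) : Euc n :=
  gradient (fun x' => c x' y) x

/-- Partial gradient of the cost in the second variable: `D_y c(x,y)`. -/
noncomputable def gradY (n : ℕ) (c : Euc n → Euc n → ℝ) (x y : Euc n) : Euc n :=
  gradient (fun y' => c x y') y

/-- Mixed second derivative `D²_{xy} c` as a continuous linear map. -/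
noncomputable def DxyC (n : ℕ) (c : Euc n → Euc n → ℝ) (x y : Euc n) : Euc n →L[ℝ] Euc n :=
  fderiv ℝ (fun x' => gradY n c x' y) x

/-- Second derivative `D²_{xx} c`. -/
noncomputable def DxxC (n : ℕ) (c : Euc n → Euc n → ℝ) (x y : Euc n) : Euc n →L[ℝ] Euc n :=
  fderiv ℝ (fun x' => gradX n c x' y) x

/-- Third derivative `D²_{xx} D_y c`. -/
noncomputable def DxxyC (n : ℕ) (c : Euc n → Euc n → ℝ) (x y : Euc n) :
    Euc n →L[ℝ] Euc n →L[ℝ] Euc n :=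
  fderiv ℝ (fun x' => DxyC n c x' y) x

/-- `β⁺_c = ‖D²_{xy} c‖_{L∞(U×V)}`. -/
noncomputable def betaPlus (n : ℕ) (c : Euc n → Euc n → ℝ) (U V : Set (Euc n)) : ℝ :=
  sSup ((fun p : Euc n × Euc n => ‖DxyC n c p.1 p.2‖) '' (U ×ˢ V))

/-- `β⁻_c = ‖(D²_{xy} c)⁻¹‖_{L∞(U×V)}`. -/
noncomputable def betaMinus (n : ℕ) (c : Euc n → Euc n → ℝ) (U V : Set (Euc n)) : ℝ :=
  sSup ((fun p : Euc n × Euc n => ‖(DxyC n c p.1 p.2).inverse‖) '' (U ×ˢ V))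

/-- `γ⁺_c = ‖det D²_{xy} c‖_{L∞(U×V)}`. -/
noncomputable def gammaPlus (n : ℕ) (c : Euc n → Euc n → ℝ) (U V : Set (Euc n)) : ℝ :=
  sSup ((fun p : Euc n × Euc n =>
    |LinearMap.det ((DxyC n c p.1 p.2 : Euc n →L[ℝ] Euc n) : Euc n →ₗ[ℝ] Euc n)|) '' (U ×ˢ V))

/-- `γ⁻_c = ‖(det D²_{xy} c)⁻¹‖_{L∞(U×V)}`. -/
noncomputable def gammaMinus (n : ℕ) (c : Euc n → Euc n → ℝ) (U V : Set (Euc n)) : ℝ :=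
  sSup ((fun p : Euc n × Euc n =>
    |LinearMap.det ((DxyC n c p.1 p.2 : Euc n →L[ℝ] Euc n) : Euc n →ₗ[ℝ] Euc n)|⁻¹) '' (U ×ˢ V))

noncomputable def supDxx (n : ℕ) (c : Euc n → Euc n → ℝ) (U V : Set (Euc n)) : ℝ :=
  sSup ((fun p : Euc n × Euc n => ‖DxxC n c p.1 p.2‖) '' (U ×ˢ V))

noncomputable def supDx (n : ℕ) (c : Euc n → Euc n → ℝ) (U V : Set (Euc n)) : ℝ :=
  sSup ((fun p : Euc n × Euc n => ‖gradX n c p.1 p.2‖) '' (U ×ˢ V))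

noncomputable def supDxxy (n : ℕ) (c : Euc n → Euc n → ℝ) (U V : Set (Euc n)) : ℝ :=
  sSup ((fun p : Euc n × Euc n => ‖DxxyC n c p.1 p.2‖) '' (U ×ˢ V))

/-- The constant `M_c` from Theorem 4.3. -/
noncomputable def Mconst (n : ℕ) (c : Euc n → Euc n → ℝ) (U V : Set (Euc n)) : ℝ :=
  (betaMinus n c U V) ^ 2 * supDxx n c U V +
    (betaMinus n c U V) ^ 3 * supDx n c U V * supDxxy n c U V

/-- The constant `ε_c` of Lemma 6.1: `1/ε_c = 2 (β⁺)⁴ (β⁻)⁶ ‖D³_{xxy} c‖_∞`. -/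
noncomputable def epsC (n : ℕ) (c : Euc n → Euc n → ℝ) (U V : Set (Euc n)) : ℝ :=
  (2 * (betaPlus n c U V) ^ 4 * (betaMinus n c U V) ^ 6 * supDxxy n c U V)⁻¹

/-- Condition (B0). -/
def B0cond (n : ℕ) (c : Euc n → Euc n → ℝ) (U V : Set (Euc n)) : Prop :=
  IsOpen U ∧ IsBounded U ∧ IsOpen V ∧ IsBounded V ∧
    ContDiffOn ℝ 4 (Function.uncurry c) (closure U ×ˢ closure V)

/-- `f` is a (C¹-) diffeomorphism from `S` onto its range. -/
def DiffeoOnto (n : ℕ) (f : Euc n → Euc n) (S : Set (Euc n)) : Prop :=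
  Set.InjOn f S ∧ ContDiffOn ℝ 1 f S ∧ ContDiffOn ℝ 1 (Function.invFunOn f S) (f '' S)

/-- Condition (B1) (bi-twist). -/
def B1cond (n : ℕ) (c : Euc n → Euc n → ℝ) (U V : Set (Euc n)) : Prop :=
  (∀ y ∈ closure V, DiffeoOnto n (fun x => -gradY n c x y) (closure U)) ∧
  (∀ x ∈ closure U, DiffeoOnto n (fun y => -gradX n c x y) (closure V))

/-- `U_ȳ := -D_y c(U, ȳ)`. -/
def Uyset (n : ℕ) (c : Euc n → Euc n → ℝ) (U : Set (Euc n)) (ybar : Euc n) : Set (Euc n) :=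
  (fun x => -gradY n c x ybar) '' U

/-- `V_x̄ := -D_x c(x̄, V)`. -/
def Vxset (n : ℕ) (c : Euc n → Euc n → ℝ) (V : Set (Euc n)) (xbar : Euc n) : Set (Euc n) :=
  (fun y => -gradX n c xbar y) '' V

/-- Condition (B2) (bi-convexity). -/
def B2cond (n : ℕ) (c : Euc n → Euc n → ℝ) (U V : Set (Euc n)) : Prop :=
  (∀ y ∈ closure V, Convex ℝ (Uyset n c U y)) ∧ (∀ x ∈ closure U, Convex ℝ (Vxset n c V x))

/-- A strongly convex set: each boundary point is touched from outside by a sphere of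
radius `R` enclosing the set. -/
def StronglyConvexSet (n : ℕ) (Q : Set (Euc n)) : Prop :=
  Convex ℝ Q ∧ ∃ R : ℝ, 0 < R ∧ ∀ x ∈ frontier Q, ∃ z : Euc n, dist x z = R ∧ Q ⊆ closedBall z R

/-- Condition (B2s). -/
def B2scond (n : ℕ) (c : Euc n → Euc n → ℝ) (U V : Set (Euc n)) : Prop :=
  (∀ y ∈ closure V, StronglyConvexSet n (Uyset n c U y)) ∧
  (∀ x ∈ closure U, StronglyConvexSet n (Vxset n c V x))

/-- An affinely parameterized line segment on `[-1,1]`. -/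
def IsAffineSeg (n : ℕ) (F : ℝ → Euc n × Euc n) : Prop :=
  ∃ a b : Euc n × Euc n, ∀ t ∈ Icc (-1 : ℝ) 1, F t = a + t • b

/-- `∂²/∂s∂t c(x(s), y(t))` at `(0,0)`. -/
noncomputable def crossDiff2 (n : ℕ) (c : Euc n → Euc n → ℝ) (x y : ℝ → Euc n) : ℝ :=
  deriv (fun s => deriv (fun t => c (x s) (y t)) 0) 0

/-- `∂⁴/∂s²∂t² c(x(s), y(t))` at `(0,0)`. -/
noncomputable def crossDiff4 (n : ℕ) (c : Euc n → Euc n → ℝ) (x y : ℝ → Euc n) : ℝ :=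
  deriv (deriv (fun s => deriv (deriv (fun t => c (x s) (y t))) 0)) 0

/-- Condition (B3) (= A3w). -/
def B3cond (n : ℕ) (c : Euc n → Euc n → ℝ) (U V : Set (Euc n)) : Prop :=
  ∀ x y : ℝ → Euc n, (∀ t ∈ Icc (-1 : ℝ) 1, x t ∈ closure U) →
    (∀ t ∈ Icc (-1 : ℝ) 1, y t ∈ closure V) →
    IsAffineSeg n (fun t => (gradY n c (x t) (y 0), gradX n c (x 0) (y t))) →
    crossDiff2 n c x y = 0 → crossDiff4 n c x y ≤ 0

/-- Condition (B4) (non-negative cross-curvature). -/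
def B4cond (n : ℕ) (c : Euc n → Euc n → ℝ) (U V : Set (Euc n)) : Prop :=
  ∀ x y : ℝ → Euc n, (∀ t ∈ Icc (-1 : ℝ) 1, x t ∈ closure U) →
    (∀ t ∈ Icc (-1 : ℝ) 1, y t ∈ closure V) →
    IsAffineSeg n (fun t => (gradY n c (x t) (y 0), gradX n c (x 0) (y t))) →
    crossDiff4 n c x y ≤ 0

/-- The `c*`-transform `u^{c*}(y) = sup_{x ∈ A} (-c(x,y) - u(x))`. -/
noncomputable def cStarT (n : ℕ) (c : Euc n → Euc n → ℝ) (A : Set (Euc n)) (u : Euc n → ℝ)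
    (y : Euc n) : ℝ :=
  sSup ((fun x => -c x y - u x) '' A)

/-- `u` is `c`-convex on `A` (relative to the target set `B`): `u = (u^{c*})^c`. -/
def CConvexOn (n : ℕ) (c : Euc n → Euc n → ℝ) (A B : Set (Euc n)) (u : Euc n → ℝ) : Prop :=
  ∀ x ∈ A, u x = sSup ((fun y => -c x y - cStarT n c A u y) '' B)

/-- The `c`-subdifferential `∂ᶜu ⊂ A × B`. -/
def cSubdiff (n : ℕ) (c : Euc n → Euc n → ℝ) (A B : Set (Euc n)) (u : Euc n → ℝ) :
    Set (Euc n × Euc n) :=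
  {p | p.1 ∈ A ∧ p.2 ∈ B ∧ u p.1 + cStarT n c A u p.2 + c p.1 p.2 = 0}

def cSubdiffAt (n : ℕ) (c : Euc n → Euc n → ℝ) (A B : Set (Euc n)) (u : Euc n → ℝ)
    (x : Euc n) : Set (Euc n) :=
  {y | (x, y) ∈ cSubdiff n c A B u}

def cSubdiffImg (n : ℕ) (c : Euc n → Euc n → ℝ) (A B : Set (Euc n)) (u : Euc n → ℝ)
    (X : Set (Euc n)) : Set (Euc n) :=
  ⋃ x ∈ X, cSubdiffAt n c A B u x

/-- `∂^{c*}u^{c*}(Y) = {x : ∃ y ∈ Y, (x,y) ∈ ∂ᶜu}`. -/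
def cSubdiffPre (n : ℕ) (c : Euc n → Euc n → ℝ) (A B : Set (Euc n)) (u : Euc n → ℝ)
    (Y : Set (Euc n)) : Set (Euc n) :=
  {x | ∃ y ∈ Y, (x, y) ∈ cSubdiff n c A B u}

/-- `|∂ᶜu| ≥ lam` on `S`. -/
def MAge (n : ℕ) (c : Euc n → Euc n → ℝ) (A B : Set (Euc n)) (u : Euc n → ℝ) (lam : ℝ)
    (S : Set (Euc n)) : Prop :=
  ∀ X : Set (Euc n), X ⊆ S → MeasurableSet X →
    ENNReal.ofReal lam * volume X ≤ volume (cSubdiffImg n c A B u X)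

/-- `|∂ᶜu| ≤ lam` on `S`. -/
def MAle (n : ℕ) (c : Euc n → Euc n → ℝ) (A B : Set (Euc n)) (u : Euc n → ℝ) (lam : ℝ)
    (S : Set (Euc n)) : Prop :=
  ∀ X : Set (Euc n), X ⊆ S → MeasurableSet X →
    volume (cSubdiffImg n c A B u X) ≤ ENNReal.ofReal lam * volume X

/-- The inverse of the cost-exponential coordinate change `q(x) = -D_y c(x, ȳ)`. -/
noncomputable def xOf (n : ℕ) (c : Euc n → Euc n → ℝ) (U : Set (Euc n)) (ybar : Euc n) :
    Euc n → Euc n :=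
  Function.invFunOn (fun x => -gradY n c x ybar) (closure U)

/-- `cl U_ȳ := -D_y c(cl U, ȳ)`. -/
def clUy (n : ℕ) (c : Euc n → Euc n → ℝ) (U : Set (Euc n)) (ybar : Euc n) : Set (Euc n) :=
  (fun x => -gradY n c x ybar) '' closure U

/-- The modified cost `c̃(q,y) = c(x(q), y) - c(x(q), ȳ)`. -/
noncomputable def modCost (n : ℕ) (c : Euc n → Euc n → ℝ) (U : Set (Euc n)) (ybar : Euc n)
    (q y : Euc n) : ℝ :=
  c (xOf n c U ybar q) y - c (xOf n c U ybar q) ybar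

/-- The modified potential `ũ(q) = u(x(q)) + c(x(q), ȳ)`. -/
noncomputable def modPot (n : ℕ) (c : Euc n → Euc n → ℝ) (U : Set (Euc n)) (ybar : Euc n)
    (u : Euc n → ℝ) (q : Euc n) : ℝ :=
  u (xOf n c U ybar q) + c (xOf n c U ybar q) ybar

/-- The `c̃`-cone generated by `qt` and `Q` with height `-h0 > 0`. -/
noncomputable def cConeFun (n : ℕ) (ct : Euc n → Euc n → ℝ) (B Q : Set (Euc n)) (qt : Euc n)
    (h0 : ℝ) (q : Euc n) : ℝ :=
  sSup {r : ℝ | ∃ y ∈ B, r = -ct q y + ct qt y + h0 ∧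
    ∀ p ∈ frontier Q, -ct p y + ct qt y + h0 ≤ 0}

/-- The ordinary subdifferential `∂u(x)` relative to a domain `A`. -/
def subdiffAt (n : ℕ) (A : Set (Euc n)) (u : Euc n → ℝ) (x : Euc n) : Set (Euc n) :=
  {p | ∀ ε > 0, ∃ δ > 0, ∀ x' ∈ A, ‖x' - x‖ < δ →
    u x + @inner ℝ _ _ p (x' - x) - ε * ‖x' - x‖ ≤ u x'}

/-- The dual norm `‖v‖*_K = sup_{w ∈ K} ⟨w, v⟩`. -/
noncomputable def dualNorm (n : ℕ) (K : Set (Euc n)) (v : Euc n) : ℝ :=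
  sSup ((fun w => (@inner ℝ _ _ w v : ℝ)) '' K)

/-- The section `S(x̄, ȳ, τ)`. -/
def sectS (n : ℕ) (c : Euc n → Euc n → ℝ) (U : Set (Euc n)) (u : Euc n → ℝ)
    (xbar ybar : Euc n) (τ : ℝ) : Set (Euc n) :=
  {x ∈ U | u x ≤ u xbar - c x ybar + c xbar ybar + τ}

/-- The measure with density `f` restricted to `A`. -/
noncomputable def densMeasure (n : ℕ) (A : Set (Euc n)) (f : Euc n → ℝ) : Measure (Euc n) :=
  (volume.restrict A).withDensity fun x => ENNReal.ofReal (f x)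

end


lemma clm_comp_comm {n : ℕ} {F G : Euc n →L[ℝ] Euc n}
    (h : G.comp F = ContinuousLinearMap.id ℝ _) : F.comp G = ContinuousLinearMap.id ℝ _ := by
  have h1 : (G : Euc n →ₗ[ℝ] Euc n) * (F : Euc n →ₗ[ℝ] Euc n) = 1 := by
    refine LinearMap.ext fun x => ?_
    simpa using congrArg (fun T : Euc n →L[ℝ] Euc n => (T x)) h
  have h2 := mul_eq_one_comm.1 h1
  refine ContinuousLinearMap.ext fun x => ?_
  simpa using congrArg (fun T : Euc n →ₗ[ℝ] Euc n => (T x)) h2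

lemma inv_deriv {n : ℕ} {f : Euc n → Euc n} {S : Set (Euc n)} {F G : Euc n →L[ℝ] Euc n}
    {x : Euc n} (hinj : InjOn f S) (hu : UniqueDiffWithinAt ℝ S x) (hx : x ∈ S)
    (hf : HasFDerivWithinAt f F S x)
    (hg : HasFDerivWithinAt (Function.invFunOn f S) G (f '' S) (f x)) :
    G.comp F = ContinuousLinearMap.id ℝ _ := by
  have h1 : HasFDerivWithinAt (Function.invFunOn f S ∘ f) (G.comp F) S x :=
    hg.comp x hf (mapsTo_image f S)
  have h2 : HasFDerivWithinAt (Function.invFunOn f S ∘ f) (ContinuousLinearMap.id ℝ _) S x := by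
    refine (hasFDerivWithinAt_id x S).congr (fun y hy => ?_) ?_
    · exact hinj.leftInvOn_invFunOn hy
    · exact hinj.leftInvOn_invFunOn hx
  exact hu.eq h1 h2

lemma inv_deriv' {n : ℕ} {f : Euc n → Euc n} {S : Set (Euc n)} {F G : Euc n →L[ℝ] Euc n}
    {x : Euc n} (hinj : InjOn f S) (hu : UniqueDiffWithinAt ℝ (f '' S) (f x)) (hx : x ∈ S)
    (hf : HasFDerivWithinAt f F S x)
    (hg : HasFDerivWithinAt (Function.invFunOn f S) G (f '' S) (f x)) :
    F.comp G = ContinuousLinearMap.id ℝ _ := by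
  have e : Function.invFunOn f S (f x) = x := hinj.leftInvOn_invFunOn hx
  have hmaps : MapsTo (Function.invFunOn f S) (f '' S) S := by
    rintro _ ⟨y, hy, rfl⟩
    rw [hinj.leftInvOn_invFunOn hy]; exact hy
  have hf' : HasFDerivWithinAt f F S (Function.invFunOn f S (f x)) := by rw [e]; exact hf
  have h1 : HasFDerivWithinAt (f ∘ Function.invFunOn f S) (F.comp G) (f '' S) (f x) :=
    hf'.comp (f x) hg hmaps
  have h2 : HasFDerivWithinAt (f ∘ Function.invFunOn f S) (ContinuousLinearMap.id ℝ _)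
      (f '' S) (f x) := by
    refine (hasFDerivWithinAt_id (f x) _).congr (fun y hy => ?_) ?_
    · exact Function.invFunOn_eq hy
    · exact Function.invFunOn_eq (mem_image_of_mem f hx)
  exact hu.eq h1 h2

lemma diffeo_open {n : ℕ} {f : Euc n → Euc n} {V : Set (Euc n)} (hV : IsOpen V)
    (hf : DiffeoOnto n f (closure V)) {y : Euc n} (hy : y ∈ V) : f '' V ∈ nhds (f y) := by
  obtain ⟨hinj, hf1, hg1⟩ := hf
  have hyc : y ∈ closure V := subset_closure hy
  have hnb : closure V ∈ nhds y := Filter.mem_of_superset (hV.mem_nhds hy) subset_closure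
  have hC : ContDiffAt ℝ 1 f y := hf1.contDiffAt hnb
  have hs := hC.hasStrictFDerivAt one_ne_zero
  have hg := (hg1.differentiableOn one_ne_zero (f y) (mem_image_of_mem f hyc)).hasFDerivWithinAt
  have hGF := inv_deriv hinj (uniqueDiffWithinAt_of_mem_nhds hnb) hyc
    hs.hasFDerivAt.hasFDerivWithinAt hg
  have hFG := clm_comp_comm hGF
  set e := ContinuousLinearEquiv.equivOfInverse (fderiv ℝ f y) _
    (fun x => by simpa using congrArg (fun T : Euc n →L[ℝ] Euc n => T x) hGF)
    (fun x => by simpa using congrArg (fun T : Euc n →L[ℝ] Euc n => T x) hFG) with he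
  have hs' : HasStrictFDerivAt f (e : Euc n →L[ℝ] Euc n) y := hs
  rw [← hs'.map_nhds_eq_of_equiv]
  exact Filter.image_mem_map (hV.mem_nhds hy)

lemma diffeo_image_closure {n : ℕ} {f : Euc n → Euc n} {V : Set (Euc n)} (hb : IsBounded V)
    (hf : DiffeoOnto n f (closure V)) : f '' closure V = closure (f '' V) :=
  image_closure_of_isCompact hb.isCompact_closure hf.2.1.continuousOn

lemma diffeo_uniqueDiff_image {n : ℕ} {f : Euc n → Euc n} {V : Set (Euc n)} (hV : IsOpen V)
    (hb : IsBounded V) (hne : V.Nonempty)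
    (hf : DiffeoOnto n f (closure V)) (hc : Convex ℝ (f '' V)) :
    UniqueDiffOn ℝ (f '' closure V) := by
  rw [diffeo_image_closure hb hf]
  refine uniqueDiffOn_convex hc.closure ?_
  obtain ⟨y, hy⟩ := hne
  exact ⟨f y, mem_interior_iff_mem_nhds.2
    (Filter.mem_of_superset (diffeo_open hV hf hy) subset_closure)⟩

lemma diffeo_uniqueDiff {n : ℕ} {f : Euc n → Euc n} {V : Set (Euc n)} (hV : IsOpen V)
    (hb : IsBounded V) (hne : V.Nonempty)
    (hf : DiffeoOnto n f (closure V)) (hc : Convex ℝ (f '' V)) :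
    UniqueDiffOn ℝ (closure V) := by
  have hu := diffeo_uniqueDiff_image hV hb hne hf hc
  obtain ⟨hinj, hf1, hg1⟩ := hf
  intro y hy
  have hfy := mem_image_of_mem f hy
  have hF := (hf1.differentiableOn one_ne_zero y hy).hasFDerivWithinAt
  have hG := (hg1.differentiableOn one_ne_zero (f y) hfy).hasFDerivWithinAt
  have hFG := inv_deriv' hinj (hu _ hfy) hy hF hG
  have hGF := clm_comp_comm hFG
  have := hG.uniqueDiffWithinAt (hu _ hfy) (by
    refine Function.Surjective.denseRange (fun x => ⟨fderivWithin ℝ f (closure V) y x, ?_⟩)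
    simpa using congrArg (fun T : Euc n →L[ℝ] Euc n => T x) hGF)
  rw [hinj.leftInvOn_invFunOn hy] at this
  have him : Function.invFunOn f (closure V) '' (f '' closure V) = closure V := by
    rw [← image_comp]
    conv_rhs => rw [← image_id (closure V)]
    exact image_congr (fun y hy => hinj.leftInvOn_invFunOn hy)
  rwa [him] at this

/-- smoothness of the inverse at interior points -/
lemma diffeo_inv_smooth {n : ℕ} {f : Euc n → Euc n} {V : Set (Euc n)} (hV : IsOpen V)
    (hf : DiffeoOnto n f (closure V)) {y : Euc n} (hy : y ∈ V) {k : WithTop ℕ∞}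
    (hk : k ≠ 0) (hC : ContDiffAt ℝ k f y) :
    ContDiffAt ℝ k (Function.invFunOn f (closure V)) (f y) := by
  obtain ⟨hinj, hf1, hg1⟩ := hf
  have hyc : y ∈ closure V := subset_closure hy
  have hnb : closure V ∈ nhds y := Filter.mem_of_superset (hV.mem_nhds hy) subset_closure
  have hs := hC.hasStrictFDerivAt hk
  have hg := (hg1.differentiableOn one_ne_zero (f y) (mem_image_of_mem f hyc)).hasFDerivWithinAt
  have hGF := inv_deriv hinj (uniqueDiffWithinAt_of_mem_nhds hnb) hyc
    hs.hasFDerivAt.hasFDerivWithinAt hg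
  have hFG := clm_comp_comm hGF
  set e := ContinuousLinearEquiv.equivOfInverse (fderiv ℝ f y) _
    (fun x => by simpa using congrArg (fun T : Euc n →L[ℝ] Euc n => T x) hGF)
    (fun x => by simpa using congrArg (fun T : Euc n →L[ℝ] Euc n => T x) hFG) with he
  have hs' : HasFDerivAt f (e : Euc n →L[ℝ] Euc n) y := hs.hasFDerivAt
  have hloc := hC.to_localInverse hs' hk
  refine hloc.congr_of_eventuallyEq ?_
  have hs2 := (hC.hasStrictFDerivAt' hs' hk)
  have hcont : Filter.Tendsto (hC.localInverse hs' hk) (nhds (f y)) (nhds y) :=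
    by simpa [ContDiffAt.localInverse, HasStrictFDerivAt.localInverse_apply_image] using
        (hs2.localInverse_tendsto)
  have hr : ∀ᶠ p in nhds (f y), f (hC.localInverse hs' hk p) = p := hs2.eventually_right_inverse
  filter_upwards [hr, hcont.eventually (hV.mem_nhds hy)] with p hp hpV
  have : Function.invFunOn f (closure V) (f (hC.localInverse hs' hk p)) = _ :=
    hinj.leftInvOn_invFunOn (subset_closure hpV)
  rw [hp] at this
  exact this



/-- Linear Riesz map. -/
noncomputable def Jmap (n : ℕ) : (Euc n →L[ℝ] ℝ) →L[ℝ] Euc n :=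
  ∑ i, (ContinuousLinearMap.apply ℝ ℝ (EuclideanSpace.basisFun (Fin n) ℝ i)).smulRight
    (EuclideanSpace.basisFun (Fin n) ℝ i)

lemma Jmap_inner {n : ℕ} (l : Euc n →L[ℝ] ℝ) (v : Euc n) : inner ℝ (Jmap n l) v = l v := by
  have := (EuclideanSpace.basisFun (Fin n) ℝ).sum_repr v
  conv_rhs => rw [← this]
  simp only [Jmap, sum_apply, ContinuousLinearMap.smulRight_apply,
    ContinuousLinearMap.apply_apply, sum_inner, inner_smul_left, map_sum, map_smul]
  refine Finset.sum_congr rfl fun i _ => ?_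
  simp [OrthonormalBasis.repr_apply_apply, mul_comm]

lemma Jmap_eq {n : ℕ} (l : Euc n →L[ℝ] ℝ) :
    Jmap n l = (InnerProductSpace.toDual ℝ (Euc n)).symm l := by
  refine ext_inner_right ℝ fun v => ?_
  rw [Jmap_inner, InnerProductSpace.toDual_symm_apply]

lemma innerSL_Jmap {n : ℕ} (l : Euc n →L[ℝ] ℝ) : innerSL ℝ (Jmap n l) = l := by
  ext v; simp [Jmap_inner]

lemma gradY_eq_aux {n : ℕ} (hn : 0 < n) {c : Euc n → Euc n → ℝ} {U V : Set (Euc n)}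
    (hC : ContDiffOn ℝ 4 (Function.uncurry c) (closure U ×ˢ closure V))
    (uU : UniqueDiffOn ℝ (closure U)) (uV : UniqueDiffOn ℝ (closure V))
    (b1 : ∀ y ∈ closure V, DiffeoOnto n (fun x => -gradY n c x y) (closure U))
    {x y : Euc n} (hx : x ∈ closure U) (hy : y ∈ closure V) :
    gradY n c x y = Jmap n ((fderivWithin ℝ (Function.uncurry c)
      (closure U ×ˢ closure V) (x, y)).comp (ContinuousLinearMap.inr ℝ _ _)) := by
  have : Nonempty (Fin n) := ⟨⟨0, hn⟩⟩
  have : Nontrivial (Euc n) := inferInstance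
  set K := closure U ×ˢ closure V
  have key : ∀ x ∈ closure U, DifferentiableAt ℝ (fun y' => c x y') y →
      gradY n c x y = Jmap n ((fderivWithin ℝ (Function.uncurry c)
      K (x, y)).comp (ContinuousLinearMap.inr ℝ _ _)) := by
    intro x hx hd
    have h0 : HasFDerivWithinAt (Function.uncurry c)
        (fderivWithin ℝ (Function.uncurry c) K (x, y)) K (x, y) :=
      (hC.differentiableOn (by norm_num) (x, y) ⟨hx, hy⟩).hasFDerivWithinAt
    have h1 : HasFDerivWithinAt (fun y' : Euc n => (x, y'))
      (ContinuousLinearMap.inr ℝ (Euc n) (Euc n)) (closure V) y :=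
      (hasFDerivAt_prodMk_right x y).hasFDerivWithinAt
    have h2 := h0.comp y h1 (fun y' hy' => ⟨hx, hy'⟩)
    have h3 : HasFDerivWithinAt (fun y' => c x y') (fderiv ℝ (fun y' => c x y') y) (closure V) y :=
      hd.hasFDerivAt.hasFDerivWithinAt
    have h4 := (uV y hy).eq h2 h3
    rw [h4, gradY, gradient, Jmap_eq]
  by_cases hd : DifferentiableAt ℝ (fun y' => c x y') y
  · exact key x hx hd
  have h0 : gradY n c x y = 0 := gradient_eq_zero_of_not_differentiableAt hd
  have hacc := (uU x hx).accPt
  have hne : (nhdsWithin x (closure U \ {x})).NeBot := by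
    have := accPt_principal_iff_nhdsWithin.1 hacc
    exact this
  have hcont1 : ContinuousWithinAt (fun x' => gradY n c x' y) (closure U \ {x}) x := by
    have := ((b1 y hy).2.1.continuousOn x hx).neg
    simp only [neg_neg, Pi.neg_def] at this
    exact this.mono sdiff_subset
  have hcont2 : ContinuousWithinAt (fun x' => Jmap n ((fderivWithin ℝ (Function.uncurry c)
      K (x', y)).comp (ContinuousLinearMap.inr ℝ _ _))) (closure U \ {x}) x := by
    have hk : ContinuousOn (fderivWithin ℝ (Function.uncurry c) K) K :=
      hC.continuousOn_fderivWithin (uU.prod uV) (by norm_num)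
    have h1 : ContinuousOn (fun x' : Euc n => (x', y)) (closure U) := by fun_prop
    have h2 := hk.comp h1 (fun x' hx' => ⟨hx', hy⟩)
    have h3 : Continuous (fun l : (Euc n × Euc n) →L[ℝ] ℝ =>
      Jmap n (l.comp (ContinuousLinearMap.inr ℝ _ _))) := by fun_prop
    exact ((h3.comp_continuousOn h2) x hx).mono sdiff_subset
  refine tendsto_nhds_unique hcont1 (hcont2.congr' ?_)
  filter_upwards [self_mem_nhdsWithin] with x' hx'
  refine (key x' hx'.1 ?_).symm
  by_contra hd'
  have h0' : gradY n c x' y = 0 := gradient_eq_zero_of_not_differentiableAt hd'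
  exact hx'.2 ((b1 y hy).1 hx'.1 hx (by simp [h0, h0']))

lemma hfd_left {E F G : Type*} [NormedAddCommGroup E] [NormedSpace ℝ E] [NormedAddCommGroup F]
    [NormedSpace ℝ F] [NormedAddCommGroup G] [NormedSpace ℝ G] {f : E × F → G} {D : E × F →L[ℝ] G}
    {S : Set E} {T : Set F} {x : E} {y : F} (h : HasFDerivWithinAt f D (S ×ˢ T) (x, y))
    (hy : y ∈ T) :
    HasFDerivWithinAt (fun x' => f (x', y)) (D.comp (ContinuousLinearMap.inl ℝ E F)) S x := by
  have h1 : HasFDerivWithinAt (fun x' : E => (x', y)) (ContinuousLinearMap.inl ℝ E F) S x :=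
    (hasFDerivAt_prodMk_left x y).hasFDerivWithinAt
  exact HasFDerivWithinAt.comp x h h1 (fun x' hx' => ⟨hx', hy⟩)

lemma hfd_right {E F G : Type*} [NormedAddCommGroup E] [NormedSpace ℝ E] [NormedAddCommGroup F]
    [NormedSpace ℝ F] [NormedAddCommGroup G] [NormedSpace ℝ G] {f : E × F → G} {D : E × F →L[ℝ] G}
    {S : Set E} {T : Set F} {x : E} {y : F} (h : HasFDerivWithinAt f D (S ×ˢ T) (x, y))
    (hx : x ∈ S) :
    HasFDerivWithinAt (fun y' => f (x, y')) (D.comp (ContinuousLinearMap.inr ℝ E F)) T y := by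
  have h1 : HasFDerivWithinAt (fun y' : F => (x, y')) (ContinuousLinearMap.inr ℝ E F) T y :=
    (hasFDerivAt_prodMk_right x y).hasFDerivWithinAt
  exact HasFDerivWithinAt.comp y h h1 (fun x' hx' => ⟨hx, hx'⟩)

/-- projections of the full derivative on partial gradients -/
noncomputable def PYm (n : ℕ) : ((Euc n × Euc n) →L[ℝ] ℝ) →L[ℝ] Euc n :=
  (Jmap n).comp ((ContinuousLinearMap.compL ℝ _ _ ℝ).flip
      (ContinuousLinearMap.inr ℝ (Euc n) (Euc n)))

noncomputable def PXm (n : ℕ) : ((Euc n × Euc n) →L[ℝ] ℝ) →L[ℝ] Euc n :=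
  (Jmap n).comp ((ContinuousLinearMap.compL ℝ _ _ ℝ).flip
      (ContinuousLinearMap.inl ℝ (Euc n) (Euc n)))

lemma PYm_apply {n : ℕ} (l : (Euc n × Euc n) →L[ℝ] ℝ) :
    PYm n l = Jmap n (l.comp (ContinuousLinearMap.inr ℝ _ _)) := rfl

lemma PXm_apply {n : ℕ} (l : (Euc n × Euc n) →L[ℝ] ℝ) :
    PXm n l = Jmap n (l.comp (ContinuousLinearMap.inl ℝ _ _)) := rfl

lemma PYm_inner {n : ℕ} (l : (Euc n × Euc n) →L[ℝ] ℝ) (v : Euc n) :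
    inner ℝ (PYm n l) v = l (0, v) := by rw [PYm_apply, Jmap_inner]; simp

lemma PXm_inner {n : ℕ} (l : (Euc n × Euc n) →L[ℝ] ℝ) (v : Euc n) :
    inner ℝ (PXm n l) v = l (v, 0) := by rw [PXm_apply, Jmap_inner]; simp

/-- The mixed derivative on the closed product. -/
noncomputable def AA (n : ℕ) (c : Euc n → Euc n → ℝ) (U V : Set (Euc n)) (x y : Euc n) :
    Euc n →L[ℝ] Euc n :=
  (fderivWithin ℝ (fun z : Euc n × Euc n => gradY n c z.1 z.2) (closure U ×ˢ closure V) (x, y)).comp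
    (ContinuousLinearMap.inl ℝ _ _)

structure Reg (n : ℕ) (c : Euc n → Euc n → ℝ) (U V : Set (Euc n)) : Prop where
  npos : 0 < n
  Uo : IsOpen U
  Ub : IsBounded U
  Une : U.Nonempty
  Vo : IsOpen V
  Vb : IsBounded V
  Vne : V.Nonempty
  uU : UniqueDiffOn ℝ (closure U)
  uV : UniqueDiffOn ℝ (closure V)
  C4 : ContDiffOn ℝ 4 (Function.uncurry c) (closure U ×ˢ closure V)
  b1 : B1cond n c U V
  b2 : B2cond n c U V
  b3 : B3cond n c U V
  dX : ∀ x ∈ closure U, ∀ y ∈ closure V,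
    HasFDerivWithinAt (fun x' => c x' y) (innerSL ℝ (gradX n c x y)) (closure U) x
  dY : ∀ x ∈ closure U, ∀ y ∈ closure V,
    HasFDerivWithinAt (fun y' => c x y') (innerSL ℝ (gradY n c x y)) (closure V) y
  gX3 : ContDiffOn ℝ 3 (fun z : Euc n × Euc n => gradX n c z.1 z.2) (closure U ×ˢ closure V)
  gY3 : ContDiffOn ℝ 3 (fun z : Euc n × Euc n => gradY n c z.1 z.2) (closure U ×ˢ closure V)
  dYX : ∀ x ∈ closure U, ∀ y ∈ closure V,
    HasFDerivWithinAt (fun x' => gradY n c x' y) (AA n c U V x y) (closure U) x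
  dXY : ∀ x ∈ closure U, ∀ y ∈ closure V,
    HasFDerivWithinAt (fun y' => gradX n c x y') (ContinuousLinearMap.adjoint (AA n c U V x y))
      (closure V) y
  Ac : ContinuousOn (fun z : Euc n × Euc n => AA n c U V z.1 z.2) (closure U ×ˢ closure V)
  Nc : ContinuousOn (fun z : Euc n × Euc n => (AA n c U V z.1 z.2).inverse)
    (closure U ×ˢ closure V)
  NA : ∀ x ∈ closure U, ∀ y ∈ closure V, ∀ v, (AA n c U V x y).inverse (AA n c U V x y v) = v
  AN : ∀ x ∈ closure U, ∀ y ∈ closure V, ∀ v, (AA n c U V x y) ((AA n c U V x y).inverse v) = v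

set_option maxHeartbeats 800000 in
lemma mk_Reg {n : ℕ} (hn : 0 < n) {c : Euc n → Euc n → ℝ} {U V : Set (Euc n)}
    (hU : U.Nonempty) (hV : V.Nonempty)
    (b0 : B0cond n c U V) (b1 : B1cond n c U V) (b2 : B2cond n c U V) (b3 : B3cond n c U V) :
    Reg n c U V := by
  obtain ⟨Uo, Ub, Vo, Vb, C4⟩ := b0
  have uU : UniqueDiffOn ℝ (closure U) := by
    obtain ⟨y, hy⟩ := hV
    exact diffeo_uniqueDiff Uo Ub hU (b1.1 y (subset_closure hy)) (b2.1 y (subset_closure hy))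
  have uV : UniqueDiffOn ℝ (closure V) := by
    obtain ⟨y, hy⟩ := hU
    exact diffeo_uniqueDiff Vo Vb hV (b1.2 y (subset_closure hy)) (b2.2 y (subset_closure hy))
  set K := closure U ×ˢ closure V with hK
  have uK : UniqueDiffOn ℝ K := uU.prod uV
  have gY : ∀ x ∈ closure U, ∀ y ∈ closure V, gradY n c x y =
      Jmap n ((fderivWithin ℝ (Function.uncurry c) K (x, y)).comp
        (ContinuousLinearMap.inr ℝ _ _)) :=
    fun x hx y hy => gradY_eq_aux hn C4 uU uV b1.1 hx hy
  -- swapped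
  have swapmap : MapsTo (Prod.swap : Euc n × Euc n → Euc n × Euc n) (closure V ×ˢ closure U) K :=
    fun z hz => ⟨hz.2, hz.1⟩
  have C4' : ContDiffOn ℝ 4 (Function.uncurry (fun a b => c b a)) (closure V ×ˢ closure U) := by
    have : ContDiff ℝ 4 (Prod.swap : Euc n × Euc n → Euc n × Euc n) := by
      exact contDiff_snd.prodMk contDiff_fst
    exact C4.comp this.contDiffOn swapmap
  have hD : ∀ z ∈ K, HasFDerivWithinAt (Function.uncurry c)
      (fderivWithin ℝ (Function.uncurry c) K z) K z := fun z hz =>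
    (C4.differentiableOn (by norm_num) z hz).hasFDerivWithinAt
  have hDx : ∀ x ∈ closure U, ∀ y ∈ closure V, HasFDerivWithinAt (fun x' => c x' y)
      ((fderivWithin ℝ (Function.uncurry c) K (x, y)).comp (ContinuousLinearMap.inl ℝ _ _))
      (closure U) x := fun x hx y hy =>
    hfd_left (hD (x, y) ⟨hx, hy⟩) hy
  have hDy : ∀ x ∈ closure U, ∀ y ∈ closure V, HasFDerivWithinAt (fun y' => c x y')
      ((fderivWithin ℝ (Function.uncurry c) K (x, y)).comp (ContinuousLinearMap.inr ℝ _ _))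
      (closure V) y := fun x hx y hy =>
    hfd_right (hD (x, y) ⟨hx, hy⟩) hx
  have gX : ∀ x ∈ closure U, ∀ y ∈ closure V, gradX n c x y =
      Jmap n ((fderivWithin ℝ (Function.uncurry c) K (x, y)).comp
        (ContinuousLinearMap.inl ℝ _ _)) := by
    intro x hx y hy
    have h1 := gradY_eq_aux (c := fun a b => c b a) hn C4' uV uU b1.2 hy hx
    have h2 : gradX n c x y = gradY n (fun a b => c b a) y x := rfl
    rw [h2, h1]
    congr 1
    have h3 : HasFDerivWithinAt (fun x' => c x' y)
      ((fderivWithin ℝ (Function.uncurry (fun a b => c b a)) (closure V ×ˢ closure U) (y, x)).comp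
        (ContinuousLinearMap.inr ℝ _ _)) (closure U) x :=
      hfd_right (C4'.differentiableOn (by norm_num) (y, x) ⟨hy, hx⟩).hasFDerivWithinAt hy
    exact (uU x hx).eq h3 (hDx x hx y hy)
  have D3 : ContDiffOn ℝ 3 (fderivWithin ℝ (Function.uncurry c) K) K :=
    C4.fderivWithin uK (by norm_num)
  have PYlin : ContDiff ℝ 3 (PYm n) := (PYm n).contDiff
  have PXlin : ContDiff ℝ 3 (PXm n) := (PXm n).contDiff
  have gY3 : ContDiffOn ℝ 3 (fun z : Euc n × Euc n => gradY n c z.1 z.2) K :=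
    (PYlin.comp_contDiffOn D3).congr (fun z hz => gY z.1 hz.1 z.2 hz.2)
  have gX3 : ContDiffOn ℝ 3 (fun z : Euc n × Euc n => gradX n c z.1 z.2) K :=
    (PXlin.comp_contDiffOn D3).congr (fun z hz => gX z.1 hz.1 z.2 hz.2)
  have hdYX : ∀ x ∈ closure U, ∀ y ∈ closure V,
    HasFDerivWithinAt (fun x' => gradY n c x' y) (AA n c U V x y) (closure U) x := by
    intro x hx y hy
    exact hfd_left (gY3.differentiableOn (by norm_num) (x, y) ⟨hx, hy⟩).hasFDerivWithinAt hy
  have hinv : ∀ x ∈ closure U, ∀ y ∈ closure V, (AA n c U V x y).IsInvertible := by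
    intro x hx y hy
    have hb := b1.1 y hy
    have hG := (hb.2.2.differentiableOn one_ne_zero _ (mem_image_of_mem _ hx)).hasFDerivWithinAt
    have h1 := inv_deriv hb.1 (uU x hx) hx (hdYX x hx y hy).neg hG
    set G := fderivWithin ℝ (Function.invFunOn (fun x => -gradY n c x y) (closure U))
      ((fun x => -gradY n c x y) '' closure U) (-gradY n c x y)
    have h2 : (-G).comp (AA n c U V x y) = ContinuousLinearMap.id ℝ _ := by
      rw [← h1]; ext1 v; simp
    have h3 := clm_comp_comm h2
    exact ⟨ContinuousLinearEquiv.equivOfInverse (AA n c U V x y) (-G)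
      (fun v => by simpa using congrArg (fun T : Euc n →L[ℝ] Euc n => T v) h2)
      (fun v => by simpa using congrArg (fun T : Euc n →L[ℝ] Euc n => T v) h3), rfl⟩
  have Ac : ContinuousOn (fun z : Euc n × Euc n => AA n c U V z.1 z.2) K := by
    have h1 := gY3.continuousOn_fderivWithin uK (by norm_num)
    have h2 : Continuous (fun l : (Euc n × Euc n) →L[ℝ] Euc n =>
      l.comp (ContinuousLinearMap.inl ℝ _ _)) := by fun_prop
    exact h2.comp_continuousOn h1
  refine ⟨hn, Uo, Ub, hU, Vo, Vb, hV, uU, uV, C4, b1, b2, b3, ?_, ?_, gX3, gY3, hdYX, ?_, Ac,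
    ?_, ?_, ?_⟩
  · intro x hx y hy
    rw [gX x hx y hy, innerSL_Jmap]; exact hDx x hx y hy
  · intro x hx y hy
    rw [gY x hx y hy, innerSL_Jmap]; exact hDy x hx y hy
  · intro x hx y hy
    set D2 := fderivWithin ℝ (fderivWithin ℝ (Function.uncurry c) K) K (x, y) with hD2
    have hz : ((x, y) : Euc n × Euc n) ∈ K := ⟨hx, hy⟩
    have hDD : HasFDerivWithinAt (fderivWithin ℝ (Function.uncurry c) K) D2 K (x, y) :=
      (D3.differentiableOn (by norm_num) (x, y) hz).hasFDerivWithinAt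
    have hsymm : IsSymmSndFDerivWithinAt ℝ (Function.uncurry c) K (x, y) := by
      refine (C4 (x, y) hz).isSymmSndFDerivWithinAt ?_ uK ?_ hz
      · simp only [minSmoothness_of_isRCLikeNormedField]; norm_num
      · have h1 : K ⊆ closure (interior K) := by
          rw [hK, interior_prod_eq, closure_prod_eq]
          exact prod_mono (closure_mono (Uo.subset_interior_iff.2 subset_closure))
            (closure_mono (Vo.subset_interior_iff.2 subset_closure))
        exact h1 hz
    have hgY' : HasFDerivWithinAt (fun z : Euc n × Euc n => gradY n c z.1 z.2)
        ((PYm n).comp D2) K (x, y) := by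
      have h1 := (PYm n).hasFDerivAt.comp_hasFDerivWithinAt (x, y) hDD
      refine h1.congr (fun z hz => ?_) ?_
      · exact gY z.1 hz.1 z.2 hz.2
      · exact gY x hx y hy
    have hgX' : HasFDerivWithinAt (fun z : Euc n × Euc n => gradX n c z.1 z.2)
        ((PXm n).comp D2) K (x, y) := by
      have h1 := (PXm n).hasFDerivAt.comp_hasFDerivWithinAt (x, y) hDD
      refine h1.congr (fun z hz => ?_) ?_
      · exact gX z.1 hz.1 z.2 hz.2
      · exact gX x hx y hy
    have hA : AA n c U V x y = ((PYm n).comp D2).comp (ContinuousLinearMap.inl ℝ _ _) := by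
      rw [AA, hgY'.fderivWithin (uK _ hz)]
    have hB : ContinuousLinearMap.adjoint (AA n c U V x y) =
        ((PXm n).comp D2).comp (ContinuousLinearMap.inr ℝ _ _) := by
      refine ContinuousLinearMap.ext fun v => ext_inner_right ℝ fun w => ?_
      rw [ContinuousLinearMap.adjoint_inner_left, hA, real_inner_comm]
      simp only [ContinuousLinearMap.comp_apply, PXm_inner, PYm_inner,
        ContinuousLinearMap.inl_apply, ContinuousLinearMap.inr_apply]
      exact hsymm.eq _ _
    rw [hB]
    exact hfd_right hgX' hx
  · intro z hz
    exact ((hinv z.1 hz.1 z.2 hz.2).contDiffAt_map_inverse (n := 0)).continuousAt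
      |>.comp_continuousWithinAt (f := fun z : Euc n × Euc n => AA n c U V z.1 z.2) (Ac z hz)
  · intro x hx y hy v
    exact (hinv x hx y hy).inverse_apply_self v
  · intro x hx y hy v
    exact (hinv x hx y hy).self_apply_inverse v



section D3
variable {n : ℕ} {c : Euc n → Euc n → ℝ} {U V : Set (Euc n)}

lemma Reg.C4at (R : Reg n c U V) {x y : Euc n} (hx : x ∈ U) (hy : y ∈ V) :
    ContDiffAt ℝ 4 (Function.uncurry c) (x, y) :=
  R.C4.contDiffAt (prod_mem_nhds (Filter.mem_of_superset (R.Uo.mem_nhds hx) subset_closure)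
    (Filter.mem_of_superset (R.Vo.mem_nhds hy) subset_closure))

lemma Reg.nU (R : Reg n c U V) {x : Euc n} (hx : x ∈ U) : closure U ∈ nhds x :=
  Filter.mem_of_superset (R.Uo.mem_nhds hx) subset_closure

lemma Reg.nV (R : Reg n c U V) {x : Euc n} (hx : x ∈ V) : closure V ∈ nhds x :=
  Filter.mem_of_superset (R.Vo.mem_nhds hx) subset_closure

lemma Reg.gY_eq (R : Reg n c U V) {x y : Euc n} (hx : x ∈ U) (hy : y ∈ V) :
    gradY n c x y = PYm n (fderiv ℝ (Function.uncurry c) (x, y)) := by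
  have h1 := (R.dY x (subset_closure hx) y (subset_closure hy)).hasFDerivAt (R.nV hy)
  have h2 : HasFDerivWithinAt (Function.uncurry c) (fderiv ℝ (Function.uncurry c) (x, y))
      (univ ×ˢ univ) (x, y) :=
    ((R.C4at hx hy).differentiableAt (by norm_num)).hasFDerivAt.hasFDerivWithinAt
  have h3 := hfd_right h2 (mem_univ x)
  rw [hasFDerivWithinAt_univ] at h3
  have h4 := h1.unique h3
  refine ext_inner_right ℝ fun v => ?_
  rw [PYm_inner]
  simpa using congrArg (fun T : Euc n →L[ℝ] ℝ => T v) h4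

lemma Reg.gX_eq (R : Reg n c U V) {x y : Euc n} (hx : x ∈ U) (hy : y ∈ V) :
    gradX n c x y = PXm n (fderiv ℝ (Function.uncurry c) (x, y)) := by
  have h1 := (R.dX x (subset_closure hx) y (subset_closure hy)).hasFDerivAt (R.nU hx)
  have h2 : HasFDerivWithinAt (Function.uncurry c) (fderiv ℝ (Function.uncurry c) (x, y))
      (univ ×ˢ univ) (x, y) :=
    ((R.C4at hx hy).differentiableAt (by norm_num)).hasFDerivAt.hasFDerivWithinAt
  have h3 := hfd_left h2 (mem_univ y)
  rw [hasFDerivWithinAt_univ] at h3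
  have h4 := h1.unique h3
  refine ext_inner_right ℝ fun v => ?_
  rw [PXm_inner]
  simpa using congrArg (fun T : Euc n →L[ℝ] ℝ => T v) h4

lemma Reg.D1at (R : Reg n c U V) {x y : Euc n} (hx : x ∈ U) (hy : y ∈ V) :
    ContDiffAt ℝ 3 (fderiv ℝ (Function.uncurry c)) (x, y) :=
  (R.C4at hx hy).fderiv_right (by norm_num)

lemma Reg.D2at (R : Reg n c U V) {x y : Euc n} (hx : x ∈ U) (hy : y ∈ V) :
    ContDiffAt ℝ 2 (fderiv ℝ (fderiv ℝ (Function.uncurry c))) (x, y) :=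
  (R.D1at hx hy).fderiv_right (by norm_num)

lemma Reg.D2symm (R : Reg n c U V) {x y : Euc n} (hx : x ∈ U) (hy : y ∈ V) (a b : Euc n × Euc n) :
    fderiv ℝ (fderiv ℝ (Function.uncurry c)) (x, y) a b =
    fderiv ℝ (fderiv ℝ (Function.uncurry c)) (x, y) b a :=
  ((R.C4at hx hy).isSymmSndFDerivAt (by
    simp only [minSmoothness_of_isRCLikeNormedField]; norm_num)).eq a b

lemma Reg.D3symm (R : Reg n c U V) {x y : Euc n} (hx : x ∈ U) (hy : y ∈ V)
    (a b d : Euc n × Euc n) :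
    fderiv ℝ (fderiv ℝ (fderiv ℝ (Function.uncurry c))) (x, y) a b d =
    fderiv ℝ (fderiv ℝ (fderiv ℝ (Function.uncurry c))) (x, y) b a d := by
  have := ((R.D1at hx hy).isSymmSndFDerivAt (by
    simp only [minSmoothness_of_isRCLikeNormedField]; norm_num)).eq a b
  rw [this]

lemma hfd_apply2 {E G : Type*} [NormedAddCommGroup E] [NormedSpace ℝ E] [NormedAddCommGroup G]
    [NormedSpace ℝ G] {F : G → (E →L[ℝ] E →L[ℝ] ℝ)} {D : G →L[ℝ] (E →L[ℝ] E →L[ℝ] ℝ)} {z : G}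
    (h : HasFDerivAt F D z) (b d : E) :
    HasFDerivAt (fun z => F z b d) ((D.flip b).flip d) z := by
  have h1 := (h.clm_apply (hasFDerivAt_const b z)).clm_apply (hasFDerivAt_const d z)
  refine h1.congr_fderiv ?_
  ext a
  simp

lemma Reg.D3symm' (R : Reg n c U V) {x y : Euc n} (hx : x ∈ U) (hy : y ∈ V)
    (a b d : Euc n × Euc n) :
    fderiv ℝ (fderiv ℝ (fderiv ℝ (Function.uncurry c))) (x, y) a b d =
    fderiv ℝ (fderiv ℝ (fderiv ℝ (Function.uncurry c))) (x, y) a d b := by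
  have hd : HasFDerivAt (fderiv ℝ (fderiv ℝ (Function.uncurry c)))
    (fderiv ℝ (fderiv ℝ (fderiv ℝ (Function.uncurry c))) (x, y)) (x, y) :=
    ((R.D2at hx hy).differentiableAt (by norm_num)).hasFDerivAt
  have h1 := hfd_apply2 hd b d
  have h2 := hfd_apply2 hd d b
  have h3 : (fun z => fderiv ℝ (fderiv ℝ (Function.uncurry c)) z b d) =ᶠ[nhds (x, y)]
      (fun z => fderiv ℝ (fderiv ℝ (Function.uncurry c)) z d b) := by
    filter_upwards [prod_mem_nhds (R.Uo.mem_nhds hx) (R.Vo.mem_nhds hy)] with z hz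
    exact R.D2symm hz.1 hz.2 b d
  have h4 := (h1.congr_of_eventuallyEq h3.symm).unique h2
  simpa using congrArg (fun T : (Euc n × Euc n) →L[ℝ] ℝ => T a) h4

lemma Reg.A_inner (R : Reg n c U V) {x y : Euc n} (hx : x ∈ U) (hy : y ∈ V) (w v : Euc n) :
    inner ℝ (AA n c U V x y w) v =
      fderiv ℝ (fderiv ℝ (Function.uncurry c)) (x, y) (w, 0) (0, v) := by
  have h1 := (R.dYX x (subset_closure hx) y (subset_closure hy)).hasFDerivAt (R.nU hx)
  have hd : HasFDerivAt (fderiv ℝ (Function.uncurry c))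
    (fderiv ℝ (fderiv ℝ (Function.uncurry c)) (x, y)) (x, y) :=
    ((R.D1at hx hy).differentiableAt (by norm_num)).hasFDerivAt
  have h2 : HasFDerivAt (fun z => PYm n (fderiv ℝ (Function.uncurry c) z))
    ((PYm n).comp (fderiv ℝ (fderiv ℝ (Function.uncurry c)) (x, y))) (x, y) :=
    (PYm n).hasFDerivAt.comp (x, y) hd
  have h3 : HasFDerivWithinAt (fun z => PYm n (fderiv ℝ (Function.uncurry c) z))
    ((PYm n).comp (fderiv ℝ (fderiv ℝ (Function.uncurry c)) (x, y))) (univ ×ˢ univ) (x, y) :=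
    h2.hasFDerivWithinAt
  have h4 := hfd_left h3 (mem_univ y)
  rw [hasFDerivWithinAt_univ] at h4
  have h5 : (fun x' => gradY n c x' y) =ᶠ[nhds x]
      (fun x' => PYm n (fderiv ℝ (Function.uncurry c) (x', y))) := by
    filter_upwards [R.Uo.mem_nhds hx] with x' hx'
    exact R.gY_eq hx' hy
  have h6 := (h1.congr_of_eventuallyEq h5.symm).unique h4
  rw [h6]
  simp only [ContinuousLinearMap.comp_apply, PYm_inner, ContinuousLinearMap.inl_apply]

/-- second derivative of a composition with a curve -/
lemma chain2 {E : Type*} [NormedAddCommGroup E] [NormedSpace ℝ E] {F : E → ℝ} {g : ℝ → E} {t : ℝ}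
    (hF : ContDiffAt ℝ 2 F (g t)) (hg : ContDiffAt ℝ 2 g t) :
    HasDerivAt (deriv (fun s => F (g s)))
      (fderiv ℝ (fderiv ℝ F) (g t) (deriv g t) (deriv g t) + fderiv ℝ F (g t) (deriv (deriv g) t))
      t := by
  have h1 : ∀ᶠ s in nhds t, deriv (fun s => F (g s)) s = fderiv ℝ F (g s) (deriv g s) := by
    have e1 : ∀ᶠ s in nhds t, ContDiffAt ℝ 2 g s := hg.eventually (by norm_num)
    have e2 : ∀ᶠ z in nhds (g t), ContDiffAt ℝ 2 F z := hF.eventually (by norm_num)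
    filter_upwards [e1, hg.continuousAt.eventually e2] with s hs1 hs2
    exact ((hs2.differentiableAt (by norm_num)).hasFDerivAt.comp_hasDerivAt s
      (hs1.differentiableAt (by norm_num)).hasDerivAt).deriv
  have hF' : HasFDerivAt (fderiv ℝ F) (fderiv ℝ (fderiv ℝ F) (g t)) (g t) :=
    ((hF.fderiv_right (m := 1) (by norm_num)).differentiableAt (by norm_num)).hasFDerivAt
  have hg' : HasDerivAt g (deriv g t) t := (hg.differentiableAt (by norm_num)).hasDerivAt
  have hg'' : HasDerivAt (deriv g) (deriv (deriv g) t) t := by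
    have : ContDiffAt ℝ 1 (deriv g) t := by
      have h := hg.fderiv_right (m := 1) (by norm_num)
      have h' := h.clm_apply (contDiffAt_const (c := (1:ℝ)))
      exact h'
    exact (this.differentiableAt (by norm_num)).hasDerivAt
  have h2 := (hF'.comp_hasDerivAt t hg').clm_apply hg''
  exact h2.congr_of_eventuallyEq h1

lemma contDiffAt_deriv1 {E : Type*} [NormedAddCommGroup E] [NormedSpace ℝ E] {g : ℝ → E} {t : ℝ}
    {k m : WithTop ℕ∞} (hg : ContDiffAt ℝ k g t) (h : m + 1 ≤ k) : ContDiffAt ℝ m (deriv g) t := by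
  have h := hg.fderiv_right (m := m) h
  exact h.clm_apply (contDiffAt_const (c := (1:ℝ)))

lemma pair_derivs {E F : Type*} [NormedAddCommGroup E] [NormedSpace ℝ E]
    [NormedAddCommGroup F] [NormedSpace ℝ F] {x : F} {g : ℝ → E} {t : ℝ}
    (hg : ContDiffAt ℝ 2 g t) :
    ContDiffAt ℝ 2 (fun s => (x, g s)) t ∧ deriv (fun s => (x, g s)) t = (0, deriv g t) ∧
      deriv (deriv (fun s => (x, g s))) t = (0, deriv (deriv g) t) := by
  have e1 : ∀ᶠ s in nhds t, ContDiffAt ℝ 2 g s := hg.eventually (by norm_num)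
  have e2 : ∀ᶠ s in nhds t, deriv (fun s => (x, g s)) s = (0, deriv g s) := by
    filter_upwards [e1] with s hs
    exact ((hasDerivAt_const s x).prodMk (hs.differentiableAt (by norm_num)).hasDerivAt).deriv
  refine ⟨contDiffAt_const.prodMk hg, e2.self_of_nhds, ?_⟩
  have e2' : deriv (fun s => (x, g s)) =ᶠ[nhds t] fun s => ((0:F), deriv g s) := e2
  rw [e2'.deriv_eq]
  have := (contDiffAt_deriv1 (m := 1) hg (by norm_num)).differentiableAt (by norm_num)
  exact ((hasDerivAt_const t (0:F)).prodMk this.hasDerivAt).deriv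

lemma Reg.chainY (R : Reg n c U V) {x : Euc n} {g : ℝ → Euc n} {t : ℝ} (hx : x ∈ U)
    (hy : g t ∈ V) (hg : ContDiffAt ℝ 2 g t) :
    HasDerivAt (deriv (fun s => c x (g s)))
      (fderiv ℝ (fderiv ℝ (Function.uncurry c)) (x, g t) (0, deriv g t) (0, deriv g t) +
        inner ℝ (gradY n c x (g t)) (deriv (deriv g) t)) t := by
  obtain ⟨h1, h2, h3⟩ := pair_derivs (x := x) hg
  have := chain2 (F := Function.uncurry c) (g := fun s => (x, g s))
    ((R.C4at hx hy).of_le (by norm_num)) h1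
  rw [h2, h3] at this
  rw [R.gY_eq hx hy, PYm_inner]
  exact this

lemma Reg.chainY1 (R : Reg n c U V) {x : Euc n} {g : ℝ → Euc n} {t : ℝ} (hx : x ∈ U)
    (hy : g t ∈ V) (hg : DifferentiableAt ℝ g t) :
    HasDerivAt (fun s => c x (g s)) (inner ℝ (gradY n c x (g t)) (deriv g t)) t := by
  have h1 := (R.dY x (subset_closure hx) (g t) (subset_closure hy)).hasFDerivAt (R.nV hy)
  exact h1.comp_hasDerivAt t hg.hasDerivAt

end D3



section D3b
variable {n : ℕ} {c : Euc n → Euc n → ℝ} {U V : Set (Euc n)}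

lemma Reg.gXat (R : Reg n c U V) {x y : Euc n} (hx : x ∈ closure U) (hy : y ∈ V) :
    ContDiffAt ℝ 3 (fun y => -gradX n c x y) y := by
  have h1 : ContDiffOn ℝ 3 (fun y' : Euc n => (x, y')) (closure V) := by fun_prop
  have h2 := R.gX3.comp h1 (fun y' hy' => ⟨hx, hy'⟩)
  exact (h2.contDiffAt (R.nV hy)).neg

lemma Reg.gYat (R : Reg n c U V) {x y : Euc n} (hx : x ∈ U) (hy : y ∈ closure V) :
    ContDiffAt ℝ 3 (fun x => -gradY n c x y) x := by
  have h1 : ContDiffOn ℝ 3 (fun x' : Euc n => (x', y)) (closure U) := by fun_prop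
  have h2 := R.gY3.comp h1 (fun y' hy' => ⟨hy', hy⟩)
  exact (h2.contDiffAt (R.nU hx)).neg

lemma cseg_facts {f : Euc n → Euc n} (hV : IsOpen V) (hf : DiffeoOnto n f (closure V))
    (hC : ∀ y ∈ V, ContDiffAt ℝ 3 f y) {p d : Euc n} {τ : ℝ} (h : p + τ • d ∈ f '' V) :
    Function.invFunOn f (closure V) (p + τ • d) ∈ V ∧
    f (Function.invFunOn f (closure V) (p + τ • d)) = p + τ • d ∧
    ContDiffAt ℝ 3 (fun t : ℝ => Function.invFunOn f (closure V) (p + t • d)) τ := by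
  obtain ⟨y, hy, hyp⟩ := h
  have e : Function.invFunOn f (closure V) (p + τ • d) = y := by
    rw [← hyp]; exact hf.1.leftInvOn_invFunOn (subset_closure hy)
  refine ⟨by rw [e]; exact hy, by rw [e, hyp], ?_⟩
  have h1 := diffeo_inv_smooth hV hf hy (k := 3) (by norm_num) (hC y hy)
  rw [hyp] at h1
  have h2 : ContDiffAt ℝ 3 (fun t : ℝ => p + t • d) τ := by fun_prop
  exact ContDiffAt.comp τ h1 h2

lemma diffeo_isOpen {f : Euc n → Euc n} (hV : IsOpen V) (hf : DiffeoOnto n f (closure V)) :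
    IsOpen (f '' V) := by
  rw [isOpen_iff_mem_nhds]
  rintro _ ⟨y, hy, rfl⟩
  exact diffeo_open hV hf hy

lemma cseg_open {f : Euc n → Euc n} (hV : IsOpen V) (hf : DiffeoOnto n f (closure V))
    (p d : Euc n) : IsOpen {τ : ℝ | p + τ • d ∈ f '' V} :=
  (diffeo_isOpen hV hf).preimage (by fun_prop)

lemma Reg.segY_deriv (R : Reg n c U V) {x p d : Euc n} {Y : ℝ → Euc n} {τ : ℝ} (hx : x ∈ closure U)
    (hY : Y τ ∈ V) (hd : DifferentiableAt ℝ Y τ)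
    (he : ∀ᶠ t in nhds τ, -gradX n c x (Y t) = p + t • d) :
    ContinuousLinearMap.adjoint (AA n c U V x (Y τ)) (deriv Y τ) = -d := by
  have h1 := ((R.dXY x hx (Y τ) (subset_closure hY)).hasFDerivAt (R.nV hY)).comp_hasDerivAt τ
    hd.hasDerivAt
  have h2 : HasDerivAt (fun t : ℝ => -(p + t • d)) (-d) τ := by
    have := (((hasDerivAt_id τ).smul_const d).const_add p).neg
    rw [one_smul] at this
    exact this
  refine h1.unique (h2.congr_of_eventuallyEq ?_)
  filter_upwards [he] with t ht
  rw [← ht]; simp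

lemma Reg.segX_deriv (R : Reg n c U V) {y p d : Euc n} {X : ℝ → Euc n} {τ : ℝ} (hy : y ∈ closure V)
    (hX : X τ ∈ U) (hd : DifferentiableAt ℝ X τ)
    (he : ∀ᶠ t in nhds τ, -gradY n c (X t) y = p + t • d) :
    AA n c U V (X τ) y (deriv X τ) = -d := by
  have h1 := ((R.dYX (X τ) (subset_closure hX) y hy).hasFDerivAt (R.nU hX)).comp_hasDerivAt τ
    hd.hasDerivAt
  have h2 : HasDerivAt (fun t : ℝ => -(p + t • d)) (-d) τ := by
    have := (((hasDerivAt_id τ).smul_const d).const_add p).neg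
    rw [one_smul] at this
    exact this
  refine h1.unique (h2.congr_of_eventuallyEq ?_)
  filter_upwards [he] with t ht
  rw [← ht]; simp

lemma Reg.Aadj_inj (R : Reg n c U V) {x y v w : Euc n} (hx : x ∈ closure U) (hy : y ∈ closure V)
    (h : ContinuousLinearMap.adjoint (AA n c U V x y) v =
      ContinuousLinearMap.adjoint (AA n c U V x y) w) : v = w := by
  refine ext_inner_right ℝ fun z => ?_
  have h1 := congrArg (fun u => inner ℝ u ((AA n c U V x y).inverse z)) h
  simpa only [ContinuousLinearMap.adjoint_inner_left, R.AN x hx y hy] using h1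

lemma small_seg {I : Set ℝ} {σ : ℝ} (hI : I ∈ nhds σ) :
    ∃ r : ℝ, 0 < r ∧ ∀ s ∈ Icc (-1:ℝ) 1, σ + s * r ∈ I := by
  obtain ⟨ε, hε, h⟩ := Metric.mem_nhds_iff.1 hI
  refine ⟨ε / 2, by positivity, fun s hs => h ?_⟩
  rw [Metric.mem_ball, Real.dist_eq]
  have : |s| ≤ 1 := abs_le.2 hs
  rw [add_sub_cancel_left, abs_mul, abs_of_pos (by positivity : 0 < ε / 2)]
  nlinarith

lemma Reg.phi2 (R : Reg n c U V) {y q d v : Euc n} {σ : ℝ} (hy : y ∈ V)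
    (hσ : q + σ • d ∈ (fun x => -gradY n c x y) '' U) (hv : inner ℝ d v = 0) :
    deriv (deriv (fun s : ℝ => fderiv ℝ (fderiv ℝ (Function.uncurry c))
      (Function.invFunOn (fun x => -gradY n c x y) (closure U) (q + s • d), y)
        (0, v) (0, v))) σ ≤ 0 := by
  have hyc := subset_closure hy
  set f := fun x => -gradY n c x y with hf
  have hdf : DiffeoOnto n f (closure U) := R.b1.1 y hyc
  set X := fun t : ℝ => Function.invFunOn f (closure U) (q + t • d) with hX
  have facts : ∀ t : ℝ, q + t • d ∈ f '' U → X t ∈ U ∧ f (X t) = q + t • d ∧ ContDiffAt ℝ 3 X t :=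
    fun t ht => cseg_facts R.Uo hdf (fun x hx => R.gYat hx hyc) ht
  set φ := fun s : ℝ => fderiv ℝ (fderiv ℝ (Function.uncurry c)) (X s, y) (0, v) (0, v) with hφ
  have hφ2 : ContDiffAt ℝ 2 φ σ := by
    obtain ⟨h1, -, h3⟩ := facts σ hσ
    have h4 : ContDiffAt ℝ 2 (fun s => (X s, y)) σ :=
      (h3.of_le (by norm_num)).prodMk contDiffAt_const
    have h5 := ContDiffAt.comp σ (R.D2at h1 hy) h4
    exact (h5.clm_apply contDiffAt_const).clm_apply contDiffAt_const
  obtain ⟨r, hr, hrI⟩ := small_seg ((cseg_open R.Uo hdf q d).mem_nhds hσ)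
  -- y curve
  obtain ⟨hx0, hfx0, -⟩ := facts σ hσ
  set x0 := X σ with hx0d
  have hx0c := subset_closure hx0
  set g := fun y' => -gradX n c x0 y' with hg
  have hdg : DiffeoOnto n g (closure V) := R.b1.2 x0 hx0c
  set η := -(ContinuousLinearMap.adjoint (AA n c U V x0 y) v) with hη
  have hJ : {t : ℝ | g y + t • η ∈ g '' V} ∈ nhds (0:ℝ) :=
    (cseg_open R.Vo hdg (g y) η).mem_nhds (by simpa using mem_image_of_mem g hy)
  obtain ⟨κ, hκ, hκJ⟩ := small_seg hJ
  set Y := fun t : ℝ => Function.invFunOn g (closure V) (g y + t • (κ • η)) with hY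
  have factsY : ∀ t : ℝ, g y + t • (κ • η) ∈ g '' V →
      Y t ∈ V ∧ g (Y t) = g y + t • (κ • η) ∧ ContDiffAt ℝ 3 Y t :=
    fun t ht => cseg_facts R.Vo hdg (fun x hx => R.gXat hx0c hx) ht
  have hYmem : ∀ t ∈ Icc (-1:ℝ) 1, g y + t • (κ • η) ∈ g '' V := by
    intro t ht
    have := hκJ t ht
    simpa [smul_smul] using this
  have hYo : ∀ᶠ t in nhds (0:ℝ), g y + t • (κ • η) ∈ g '' V :=
    (cseg_open R.Vo hdg (g y) (κ • η)).mem_nhds (hYmem 0 (by norm_num))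
  have hY0 : Y 0 = y := by
    simp only [hY, zero_smul, add_zero]
    exact hdg.1.leftInvOn_invFunOn hyc
  obtain ⟨hY0V, hgY0, hY3⟩ := factsY 0 (hYmem 0 (by norm_num))
  have hY' : deriv Y 0 = κ • v := by
    have h1 := R.segY_deriv (Y := Y) (p := g y) (d := κ • η) hx0c hY0V
      (hY3.differentiableAt (by norm_num)) (by
        filter_upwards [hYo] with t ht using (factsY t ht).2.1)
    rw [hY0] at h1
    refine R.Aadj_inj hx0c hyc ?_
    rw [h1, map_smul, hη]; simp
  -- x curve
  set Xt := fun s : ℝ => X (σ + s * r) with hXt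
  have hXt0 : Xt 0 = x0 := by simp [hXt, hx0d]
  have hXmem : ∀ s ∈ Icc (-1:ℝ) 1, Xt s ∈ U := fun s hs => (facts _ (hrI s hs)).1
  have hXo : ∀ᶠ s in nhds (0:ℝ), s ∈ Icc (-1:ℝ) 1 := Icc_mem_nhds (by norm_num) (by norm_num)
  have hgYX : ∀ s ∈ Icc (-1:ℝ) 1, gradY n c (Xt s) y = -(q + σ • d) + s • (-(r • d)) := by
    intro s hs
    have := (facts _ (hrI s hs)).2.1
    have h2 : gradY n c (Xt s) y = - f (Xt s) := by simp [hf]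
    rw [h2, this, add_smul, mul_smul]
    simp only [smul_neg]; abel
  have hb := R.b3 Xt Y (fun t ht => subset_closure (hXmem t ht))
    (fun t ht => subset_closure (factsY t (hYmem t ht)).1) (by
      refine ⟨(-(q + σ • d), -g y), (-(r • d), -(κ • η)), fun t ht => ?_⟩
      simp only [hY0, hXt0]
      refine Prod.ext ?_ ?_
      · simpa using hgYX t ht
      · have := (factsY t (hYmem t ht)).2.1
        have h2 : gradX n c x0 (Y t) = - g (Y t) := by simp [hg]
        rw [h2, this]
        simp only [Prod.snd_add, Prod.smul_snd, smul_neg]; abel)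
    (by
      unfold crossDiff2
      have h1 : (fun s => deriv (fun t => c (Xt s) (Y t)) 0) =ᶠ[nhds 0]
          fun s => inner ℝ (-(q + σ • d)) (κ • v) := by
        filter_upwards [hXo] with s hs
        rw [(R.chainY1 (hXmem s hs) hY0V (hY3.differentiableAt (by norm_num))).deriv, hY', hY0,
          hgYX s hs]
        rw [inner_add_left, inner_smul_left, inner_neg_left, inner_neg_left, inner_smul_left,
          inner_smul_right d, hv]
        simp
      rw [h1.deriv_eq]; simp)
  unfold crossDiff4 at hb
  set α := inner ℝ (-(q + σ • d)) (deriv (deriv Y) 0) with hα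
  set β := inner ℝ (-(r • d)) (deriv (deriv Y) 0) with hβ
  have h1 : (fun s => deriv (deriv (fun t => c (Xt s) (Y t))) 0) =ᶠ[nhds 0]
      fun s => κ ^ 2 * φ (σ + s * r) + (α + s * β) := by
    filter_upwards [hXo] with s hs
    rw [(R.chainY (hXmem s hs) hY0V (hY3.of_le (by norm_num))).deriv, hY', hY0, hgYX s hs]
    have e : ((0 : Euc n), κ • v) = κ • ((0 : Euc n), v) := by simp
    rw [e, map_smul, map_smul, inner_add_left, inner_smul_left (-(r • d))]
    simp only [hφ, hα, hβ, hXt, smul_apply, smul_eq_mul]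
    simp only [conj_trivial]
    ring
  have hev : ∀ᶠ s in nhds (0:ℝ), ContDiffAt ℝ 2 φ (σ + s * r) := by
    have hc : ContinuousAt (fun s : ℝ => σ + s * r) 0 := by fun_prop
    refine hc.eventually (p := fun t => ContDiffAt ℝ 2 φ t) ?_
    simpa using hφ2.eventually (by norm_num)
  have hlin : ∀ s : ℝ, HasDerivAt (fun s : ℝ => σ + s * r) r s := by
    intro s
    simpa using ((hasDerivAt_id s).mul_const r).const_add σ
  have h2 : deriv (fun s => κ ^ 2 * φ (σ + s * r) + (α + s * β)) =ᶠ[nhds 0]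
      fun s => κ ^ 2 * (deriv φ (σ + s * r) * r) + β := by
    filter_upwards [hev] with s hs
    have e1 := ((hs.differentiableAt (by norm_num)).hasDerivAt.comp s (hlin s)).const_mul (κ ^ 2)
    have e2 := ((hasDerivAt_id s).mul_const β).const_add α
    have e3 := (e1.add e2).deriv
    simpa [Function.comp_def, Pi.add_def] using e3
  have h3 : HasDerivAt (fun s => κ ^ 2 * (deriv φ (σ + s * r) * r) + β)
      (κ ^ 2 * (deriv (deriv φ) σ * r * r)) 0 := by
    have e0 := ((contDiffAt_deriv1 (m := 1) hφ2 (by norm_num)).differentiableAt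
      (by norm_num)).hasDerivAt
    have e0' : HasDerivAt (deriv φ) (deriv (deriv φ) σ) (σ + 0 * r) := by simpa using e0
    have e1 := (((e0'.comp 0 (hlin 0)).mul_const r).const_mul (κ ^ 2)).add_const β
    simpa [Function.comp_def] using e1
  rw [(h1.deriv).deriv_eq, h2.deriv_eq, h3.deriv] at hb
  have : 0 < κ ^ 2 * r * r := by positivity
  nlinarith

lemma Reg.L1 (R : Reg n c U V) {x0 x1 y v : Euc n} (hx0 : x0 ∈ U) (hx1 : x1 ∈ U) (hy : y ∈ V)
    (hv : inner ℝ (gradY n c x1 y - gradY n c x0 y) v = 0) :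
    fderiv ℝ (fderiv ℝ (Function.uncurry c)) (x1, y) (0, v) (0, v) ≤
    fderiv ℝ (fderiv ℝ (Function.uncurry c)) (x0, y) (0, v) (0, v) +
    fderiv ℝ (fderiv ℝ (fderiv ℝ (Function.uncurry c))) (x0, y)
      ((AA n c U V x0 y).inverse (gradY n c x1 y - gradY n c x0 y), 0) (0, v) (0, v) := by
  have hyc := subset_closure hy
  set f := fun x => -gradY n c x y with hf
  have hdf : DiffeoOnto n f (closure U) := R.b1.1 y hyc
  set q := f x0 with hq
  set d := f x1 - f x0 with hd
  have hdd : gradY n c x1 y - gradY n c x0 y = -d := by simp only [hd, hf]; abel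
  set X := fun t : ℝ => Function.invFunOn f (closure U) (q + t • d) with hX
  have facts : ∀ t : ℝ, q + t • d ∈ f '' U → X t ∈ U ∧ f (X t) = q + t • d ∧ ContDiffAt ℝ 3 X t :=
    fun t ht => cseg_facts R.Uo hdf (fun x hx => R.gYat hx hyc) ht
  set φ := fun s : ℝ => fderiv ℝ (fderiv ℝ (Function.uncurry c)) (X s, y) (0, v) (0, v) with hφ
  have hI : ∀ t ∈ Icc (0:ℝ) 1, q + t • d ∈ f '' U := fun t ht =>
    (R.b2.1 y hyc).add_smul_sub_mem (mem_image_of_mem f hx0) (mem_image_of_mem f hx1) ht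
  have hφ2 : ∀ σ ∈ Icc (0:ℝ) 1, ContDiffAt ℝ 2 φ σ := by
    intro σ hσ
    obtain ⟨h1, -, h3⟩ := facts σ (hI σ hσ)
    have h4 : ContDiffAt ℝ 2 (fun s => (X s, y)) σ :=
      (h3.of_le (by norm_num)).prodMk contDiffAt_const
    have h5 := ContDiffAt.comp σ (R.D2at h1 hy) h4
    exact (h5.clm_apply contDiffAt_const).clm_apply contDiffAt_const
  have hneg : ∀ σ ∈ Icc (0:ℝ) 1, deriv (deriv φ) σ ≤ 0 := fun σ hσ =>
    R.phi2 hy (hI σ hσ) (by rw [hdd, inner_neg_left, neg_eq_zero] at hv; exact hv)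
  have hX0 : X 0 = x0 := by
    simp only [hX, zero_smul, add_zero]
    exact hdf.1.leftInvOn_invFunOn (subset_closure hx0)
  have hX1 : X 1 = x1 := by
    simp only [hX, one_smul, hd, hq, add_sub_cancel]
    exact hdf.1.leftInvOn_invFunOn (subset_closure hx1)
  obtain ⟨hX0U, -, hX03⟩ := facts 0 (hI 0 (by simp))
  have hX' : deriv X 0 = (AA n c U V x0 y).inverse (-d) := by
    have h1 := R.segX_deriv (X := X) (p := q) (d := d) hyc hX0U
      (hX03.differentiableAt (by norm_num)) (by
        filter_upwards [(cseg_open R.Uo hdf q d).mem_nhds (hI 0 (by simp))] with t ht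
          using (facts t ht).2.1)
    rw [hX0] at h1
    rw [← h1, R.NA x0 (subset_closure hx0) y hyc]
  have hφ' : deriv φ 0 = fderiv ℝ (fderiv ℝ (fderiv ℝ (Function.uncurry c))) (x0, y)
      ((AA n c U V x0 y).inverse (-d), 0) (0, v) (0, v) := by
    have h1 : HasFDerivAt (fderiv ℝ (fderiv ℝ (Function.uncurry c)))
      (fderiv ℝ (fderiv ℝ (fderiv ℝ (Function.uncurry c))) (X 0, y)) (X 0, y) :=
      ((R.D2at hX0U hy).differentiableAt (by norm_num)).hasFDerivAt
    have h2 := hfd_apply2 h1 (0, v) (0, v)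
    have h3 : HasDerivAt (fun s => (X s, y)) (deriv X 0, 0) 0 :=
      (hX03.differentiableAt (by norm_num)).hasDerivAt.prodMk (hasDerivAt_const _ _)
    have h4 := (h2.comp_hasDerivAt (0:ℝ) h3).deriv
    rw [hX', hX0] at h4
    exact h4
  obtain ⟨ξ, hξ, h1⟩ := exists_deriv_eq_slope φ (zero_lt_one (α := ℝ))
    (fun s hs => (hφ2 s hs).continuousAt.continuousWithinAt)
    (fun s hs => ((hφ2 s (Ioo_subset_Icc_self hs)).differentiableAt
      (by norm_num)).differentiableWithinAt)
  have hφd : ∀ s ∈ Icc (0:ℝ) 1, DifferentiableAt ℝ (deriv φ) s := fun s hs =>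
    (contDiffAt_deriv1 (m := 1) (hφ2 s hs) (by norm_num)).differentiableAt (by norm_num)
  have hsub : Icc 0 ξ ⊆ Icc (0:ℝ) 1 := Icc_subset_Icc_right hξ.2.le
  obtain ⟨ζ, hζ, h2⟩ := exists_deriv_eq_slope (deriv φ) hξ.1
    (fun s hs => (hφd s (hsub hs)).continuousAt.continuousWithinAt)
    (fun s hs => (hφd s (hsub (Ioo_subset_Icc_self hs))).differentiableWithinAt)
  have h3 := hneg ζ (hsub (Ioo_subset_Icc_self hζ))
  rw [h2, sub_zero, div_nonpos_iff] at h3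
  have h5 : deriv φ ξ ≤ deriv φ 0 := by
    rcases h3 with h | h
    · linarith [hξ.1, h.2]
    · linarith [h.1]
  rw [h1] at h5
  have e1 : φ 1 = fderiv ℝ (fderiv ℝ (Function.uncurry c)) (x1, y) (0, v) (0, v) := by
    simp only [hφ, hX1]
  have e0 : φ 0 = fderiv ℝ (fderiv ℝ (Function.uncurry c)) (x0, y) (0, v) (0, v) := by
    simp only [hφ, hX0]
  rw [hdd, ← hφ', ← e1, ← e0]
  linarith [h5]

end D3b



section D3c
variable {n : ℕ} {c : Euc n → Euc n → ℝ} {U V : Set (Euc n)}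

/-- maximum principle for a second order differential inequality -/
lemma ode_max {f : ℝ → ℝ} {K : ℝ} (hK : 0 ≤ K)
    (hf : ∀ t ∈ Icc (0:ℝ) 1, ContDiffAt ℝ 2 f t)
    (h : ∀ t ∈ Icc (0:ℝ) 1, -K * |deriv f t| ≤ deriv (deriv f) t) {τ : ℝ}
    (hτ : τ ∈ Icc (0:ℝ) 1) : f τ ≤ max (f 0) (f 1) := by
  by_contra hcon
  push Not at hcon
  set L := K + 1 with hL
  have hLp : 0 < L := by linarith
  obtain ⟨ε, hε, hε2⟩ : ∃ ε > 0, max (f 0) (f 1) + ε * Real.exp L < f τ := by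
    refine ⟨(f τ - max (f 0) (f 1)) / 2 / Real.exp L, by
      have := Real.exp_pos L
      have : 0 < f τ - max (f 0) (f 1) := by linarith
      positivity, ?_⟩
    rw [div_mul_cancel₀ _ (Real.exp_pos L).ne']
    linarith
  set g : ℝ → ℝ := fun t => f t + ε * Real.exp (L * t) with hg
  have hexp : ContDiff ℝ 2 (fun t => ε * Real.exp (L * t)) := by fun_prop
  have hg2 : ∀ t ∈ Icc (0:ℝ) 1, ContDiffAt ℝ 2 g t := fun t ht => (hf t ht).add hexp.contDiffAt
  have hgc : ContinuousOn g (Icc 0 1) := fun t ht => (hg2 t ht).continuousAt.continuousWithinAt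
  obtain ⟨s, hs, hmax⟩ := isCompact_Icc.exists_isMaxOn ⟨τ, hτ⟩ hgc
  have hgτ : g τ ≤ g s := hmax hτ
  have e1 : f τ < g τ := by simp only [hg]; have := Real.exp_pos (L * τ); nlinarith
  have hs0 : s ≠ 0 := by
    rintro rfl
    have : Real.exp (L * 0) ≤ Real.exp L := Real.exp_le_exp.2 (by linarith)
    simp only [hg] at hgτ e1
    nlinarith [le_max_left (f 0) (f 1)]
  have hs1 : s ≠ 1 := by
    rintro rfl
    simp only [hg, mul_one] at hgτ e1
    nlinarith [le_max_right (f 0) (f 1)]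
  have hsI : s ∈ Ioo (0:ℝ) 1 := ⟨lt_of_le_of_ne hs.1 hs0.symm, lt_of_le_of_ne hs.2 hs1⟩
  have hloc : IsLocalMax g s := by
    filter_upwards [Icc_mem_nhds hsI.1 hsI.2] with t ht using hmax ht
  have hd1 : ∀ t ∈ Icc (0:ℝ) 1, deriv g t = deriv f t + ε * (L * Real.exp (L * t)) := by
    intro t ht
    have h2 : HasDerivAt (fun t => ε * Real.exp (L * t)) (ε * (L * Real.exp (L * t))) t := by
      have := (((hasDerivAt_id t).const_mul L).exp).const_mul ε
      exact this.congr_deriv (by simp only [id, mul_one]; ring)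
    exact (((hf t ht).differentiableAt (by norm_num)).hasDerivAt.add h2).deriv
  have hd2 : deriv (deriv g) s = deriv (deriv f) s + ε * (L * (L * Real.exp (L * s))) := by
    have e : deriv g =ᶠ[nhds s] fun t => deriv f t + ε * (L * Real.exp (L * t)) := by
      filter_upwards [Icc_mem_nhds hsI.1 hsI.2] with t ht using hd1 t ht
    rw [e.deriv_eq]
    have h2 : HasDerivAt (fun t => ε * (L * Real.exp (L * t))) (ε * (L * (L * Real.exp (L * s)))) s := by
      have := ((((hasDerivAt_id s).const_mul L).exp).const_mul L).const_mul ε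
      exact this.congr_deriv (by simp only [id, mul_one]; ring)
    exact (((contDiffAt_deriv1 (m := 1) (hf s hs) (by norm_num)).differentiableAt
      (by norm_num)).hasDerivAt.add h2).deriv
  have hz : deriv g s = 0 := hloc.deriv_eq_zero
  rw [hd1 s hs] at hz
  have hpos : 0 < deriv (deriv g) s := by
    have hh := h s hs
    have e : deriv f s = -(ε * (L * Real.exp (L * s))) := by linarith
    have e3 : 0 < ε * (L * Real.exp (L * s)) := by have := Real.exp_pos (L * s); positivity
    rw [e, abs_neg, abs_of_pos e3] at hh
    rw [hd2]
    have : ε * (L * (L * Real.exp (L * s))) = L * (ε * (L * Real.exp (L * s))) := by ring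
    rw [this, hL] at *
    nlinarith
  have hmin : IsLocalMin g s := isLocalMin_of_deriv_deriv_pos hpos hloc.deriv_eq_zero
    (hg2 s hs).continuousAt
  have hconst : g =ᶠ[nhds s] fun _ => g s := by
    filter_upwards [hloc, hmin] with t h1 h2 using le_antisymm h1 h2
  have : deriv (deriv g) s = 0 := by
    rw [hconst.deriv.deriv_eq]; simp
  linarith

lemma bilin_bound
    (B : Euc n × Euc n →L[ℝ] Euc n × Euc n →L[ℝ] ℝ) {δ v : Euc n} (hδ : δ ≠ 0) {M : ℝ} (hM : ‖B‖ ≤ M)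
    (h : ∀ w : Euc n, inner ℝ δ w = 0 → 0 ≤ B (0, w) (0, w)) :
    -(3 * M * ‖v‖ / ‖δ‖) * |inner ℝ δ v| ≤ B (0, v) (0, v) := by
  have hδn : 0 < ‖δ‖ := norm_pos_iff.2 hδ
  set μ := inner ℝ δ v / ‖δ‖ ^ 2 with hμ
  set w := v - μ • δ with hw
  have hw0 : inner ℝ δ w = 0 := by
    rw [hw, inner_sub_right, inner_smul_right, real_inner_self_eq_norm_sq, hμ]; field_simp; ring
  have hwn : ‖w‖ ≤ ‖v‖ := by
    have e : v = w + μ • δ := by simp [hw]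
    have : ‖v‖ ^ 2 = ‖w‖ ^ 2 + ‖μ • δ‖ ^ 2 := by
      have h1 : inner ℝ w (μ • δ) = 0 := by
        rw [inner_smul_right, real_inner_comm, hw0, mul_zero]
      conv_lhs => rw [e]
      rw [norm_add_sq_real, h1]; ring
    nlinarith [norm_nonneg w, norm_nonneg v, sq_nonneg ‖μ • δ‖]
  have hμn : |μ| * ‖δ‖ = |inner ℝ δ v| / ‖δ‖ := by
    rw [hμ, abs_div, abs_of_pos (by positivity : 0 < ‖δ‖ ^ 2)]; field_simp
  have hcs : |inner ℝ δ v| / ‖δ‖ ≤ ‖v‖ := by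
    rw [div_le_iff₀ hδn]; rw [mul_comm]; exact abs_real_inner_le_norm δ v
  have hb : ∀ a b : Euc n, |B (0, a) (0, b)| ≤ M * ‖a‖ * ‖b‖ := by
    intro a b
    have h1 := B.le_opNorm₂ (0, a) (0, b)
    have e : ∀ a : Euc n, ‖((0 : Euc n), a)‖ = ‖a‖ := fun a => by simp [Prod.norm_def]
    rw [e, e, Real.norm_eq_abs] at h1
    refine h1.trans ?_
    gcongr
  have hM0 : 0 ≤ M := (norm_nonneg B).trans hM
  have e : ((0:Euc n), v) = (0, w) + μ • (0, δ) := by simp [hw]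
  have h1 : B (0, v) (0, v) = B (0, w) (0, w) + μ * B (0, w) (0, δ) + μ * B (0, δ) (0, w)
      + μ * (μ * B (0, δ) (0, δ)) := by
    rw [e]
    simp only [map_add, map_smul, add_apply, smul_apply, smul_eq_mul]
    ring
  have b1 : |μ * B (0, w) (0, δ)| ≤ M * ‖v‖ * (|inner ℝ δ v| / ‖δ‖) := by
    rw [abs_mul, ← hμn]
    calc |μ| * |B (0, w) (0, δ)| ≤ |μ| * (M * ‖v‖ * ‖δ‖) := by
          gcongr; exact (hb _ _).trans (by gcongr)
      _ = _ := by ring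
  have b2 : |μ * B (0, δ) (0, w)| ≤ M * ‖v‖ * (|inner ℝ δ v| / ‖δ‖) := by
    rw [abs_mul, ← hμn]
    calc |μ| * |B (0, δ) (0, w)| ≤ |μ| * (M * ‖δ‖ * ‖v‖) := by
          gcongr; exact (hb _ _).trans (by gcongr)
      _ = _ := by ring
  have b3 : |μ * (μ * B (0, δ) (0, δ))| ≤ M * ‖v‖ * (|inner ℝ δ v| / ‖δ‖) := by
    rw [abs_mul, abs_mul]
    calc |μ| * (|μ| * |B (0, δ) (0, δ)|) ≤ |μ| * (|μ| * (M * ‖δ‖ * ‖δ‖)) := by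
          gcongr; exact hb _ _
      _ = M * (|μ| * ‖δ‖) * (|μ| * ‖δ‖) := by ring
      _ ≤ _ := by rw [hμn]; gcongr
  have h0 := h w hw0
  have e4 : -(3 * M * ‖v‖ / ‖δ‖) * |inner ℝ δ v| = -(3 * (M * ‖v‖ * (|inner ℝ δ v| / ‖δ‖))) := by
    ring
  rw [e4, h1]
  linarith [abs_le.1 b1, abs_le.1 b2, abs_le.1 b3]

lemma Bop_cont {W G : Type*} [NormedAddCommGroup W] [NormedSpace ℝ W] [NormedAddCommGroup G]
    [NormedSpace ℝ G] {F : W → G} {γ0 γ1 w : ℝ → W} {s : Set ℝ}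
    (h0 : ∀ t ∈ s, ContDiffAt ℝ 1 F (γ0 t)) (h1 : ∀ t ∈ s, ContinuousAt F (γ1 t))
    (hγ0 : ContinuousOn γ0 s) (hγ1 : ContinuousOn γ1 s) (hw : ContinuousOn w s) :
    ContinuousOn (fun t => ‖F (γ0 t) - F (γ1 t) + fderiv ℝ F (γ0 t) (w t)‖) s := by
  have a0 : ContinuousOn (fun t => F (γ0 t)) s := fun t ht =>
    ContinuousAt.comp_continuousWithinAt (h0 t ht).continuousAt (hγ0 t ht)
  have a1 : ContinuousOn (fun t => F (γ1 t)) s := fun t ht =>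
    ContinuousAt.comp_continuousWithinAt (h1 t ht) (hγ1 t ht)
  have a2 : ContinuousOn (fun t => fderiv ℝ F (γ0 t)) s := fun t ht =>
    ContinuousAt.comp_continuousWithinAt
      ((h0 t ht).fderiv_right (m := 0) (by norm_num)).continuousAt (hγ0 t ht)
  exact ((a0.sub a1).add (a2.clm_apply hw)).norm

set_option maxHeartbeats 2000000 in
lemma Reg.DASM_int (R : Reg n c U V) {x0 x1 y0 y1 : Euc n} (hx0 : x0 ∈ U) (hx1 : x1 ∈ U)
    (hy0 : y0 ∈ V) (hy1 : y1 ∈ V) {τ : ℝ} (hτ : τ ∈ Icc (0:ℝ) 1) :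
    let y := Function.invFunOn (fun y => -gradX n c x0 y) (closure V)
      (-gradX n c x0 y0 + τ • (-gradX n c x0 y1 - -gradX n c x0 y0))
    c x0 y - c x1 y ≤ max (c x0 y0 - c x1 y0) (c x0 y1 - c x1 y1) := by
  by_cases hne : x0 = x1
  · subst hne; simp
  intro y
  have hx0c := subset_closure hx0
  set g := fun y' => -gradX n c x0 y' with hg
  have hdg : DiffeoOnto n g (closure V) := R.b1.2 x0 hx0c
  set d := g y1 - g y0 with hd
  set Y := fun t : ℝ => Function.invFunOn g (closure V) (g y0 + t • d) with hY
  have facts : ∀ t : ℝ, g y0 + t • d ∈ g '' V → Y t ∈ V ∧ g (Y t) = g y0 + t • d ∧ ContDiffAt ℝ 3 Y t :=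
    fun t ht => cseg_facts R.Vo hdg (fun x hx => R.gXat hx0c hx) ht
  have hI : ∀ t ∈ Icc (0:ℝ) 1, g y0 + t • d ∈ g '' V := fun t ht =>
    (R.b2.2 x0 hx0c).add_smul_sub_mem (mem_image_of_mem g hy0) (mem_image_of_mem g hy1) ht
  have hIo := cseg_open R.Vo hdg (g y0) d
  have hY0 : Y 0 = y0 := by
    simp only [hY, zero_smul, add_zero]
    exact hdg.1.leftInvOn_invFunOn (subset_closure hy0)
  have hY1 : Y 1 = y1 := by
    simp only [hY, one_smul, hd, add_sub_cancel]
    exact hdg.1.leftInvOn_invFunOn (subset_closure hy1)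
  set f := fun t => c x0 (Y t) - c x1 (Y t) with hf
  have hYc : ContinuousOn Y (Icc 0 1) := fun t ht =>
    (facts t (hI t ht)).2.2.continuousAt.continuousWithinAt
  set δ := fun t => gradY n c x1 (Y t) - gradY n c x0 (Y t) with hδ
  have hYcl : MapsTo Y (Icc 0 1) (closure V) := fun t ht => subset_closure (facts t (hI t ht)).1
  have hgYc : ∀ x ∈ U, ContinuousOn (fun t => gradY n c x (Y t)) (Icc 0 1) := fun x hx =>
    R.gY3.continuousOn.comp (continuousOn_const.prodMk hYc)
      (fun t ht => ⟨subset_closure hx, hYcl ht⟩)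
  have hδc : ContinuousOn δ (Icc 0 1) := (hgYc x1 hx1).sub (hgYc x0 hx0)
  have hδ0 : ∀ t ∈ Icc (0:ℝ) 1, δ t ≠ 0 := by
    intro t ht h0
    refine hne ((R.b1.1 (Y t) (hYcl ht)).1 hx0c (subset_closure hx1) ?_)
    simp only [hδ] at h0
    rw [sub_eq_zero] at h0
    simp [h0]
  have hvc : ContinuousOn (deriv Y) (Icc 0 1) := fun t ht =>
    (contDiffAt_deriv1 (m := 2) (facts t (hI t ht)).2.2 (by norm_num)).continuousAt.continuousWithinAt
  set Bop := fun t => fderiv ℝ (fderiv ℝ (Function.uncurry c)) (x0, Y t)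
    - fderiv ℝ (fderiv ℝ (Function.uncurry c)) (x1, Y t)
    + fderiv ℝ (fderiv ℝ (fderiv ℝ (Function.uncurry c))) (x0, Y t)
      ((AA n c U V x0 (Y t)).inverse (δ t), 0) with hB
  have hBc : ContinuousOn (fun t => ‖Bop t‖) (Icc 0 1) := by
    have h4 : ContinuousOn (fun t => (AA n c U V x0 (Y t)).inverse) (Icc 0 1) :=
      R.Nc.comp (continuousOn_const.prodMk hYc) (fun t ht => ⟨hx0c, hYcl ht⟩)
    exact Bop_cont (fun t ht => (R.D2at hx0 (facts t (hI t ht)).1).of_le (by norm_num))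
      (fun t ht => (R.D2at hx1 (facts t (hI t ht)).1).continuousAt)
      (continuousOn_const.prodMk hYc) (continuousOn_const.prodMk hYc)
      ((h4.clm_apply hδc).prodMk continuousOn_const)
  have hKc : ContinuousOn (fun t => 3 * ‖Bop t‖ * ‖deriv Y t‖ / ‖δ t‖) (Icc 0 1) := by
    have e1 : ContinuousOn (fun t => ‖Bop t‖) (Icc 0 1) := hBc
    have e2 : ContinuousOn (fun t => 3 * ‖Bop t‖) (Icc 0 1) := continuousOn_const.mul e1
    exact ContinuousOn.div (e2.mul hvc.norm) hδc.norm
      (fun t ht => norm_ne_zero_iff.2 (hδ0 t ht))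
  obtain ⟨s, hs, hKmax⟩ := isCompact_Icc.exists_isMaxOn ⟨0, by simp⟩ hKc
  have hfd : ∀ t ∈ Icc (0:ℝ) 1, deriv f t = - inner ℝ (δ t) (deriv Y t) := by
    intro t ht
    obtain ⟨h1, h2, h3⟩ := facts t (hI t ht)
    have h3' := h3.differentiableAt (by norm_num : (3 : WithTop ℕ∞) ≠ 0)
    refine ((R.chainY1 hx0 h1 h3').sub (R.chainY1 hx1 h1 h3')).deriv.trans ?_
    simp only [hδ, inner_sub_left]; ring
  have hfC : ∀ t ∈ Icc (0:ℝ) 1, ContDiffAt ℝ 2 f t := by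
    intro t ht
    obtain ⟨h1, h2, h3⟩ := facts t (hI t ht)
    have h4 : ∀ x ∈ U, ContDiffAt ℝ 2 (fun t => c x (Y t)) t := fun x hx => by
      have h5 : ContDiffAt ℝ 3 (fun t => (x, Y t)) t := contDiffAt_const.prodMk h3
      exact (ContDiffAt.comp t (g := Function.uncurry c) ((R.C4at hx h1).of_le (by norm_num)) h5).of_le (by norm_num : (2 : WithTop ℕ∞) ≤ 3)
    exact (h4 x0 hx0).sub (h4 x1 hx1)
  have hf2 : ∀ t ∈ Icc (0:ℝ) 1, deriv (deriv f) t = Bop t (0, deriv Y t) (0, deriv Y t) := by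
    intro t ht
    obtain ⟨h1, h2, h3⟩ := facts t (hI t ht)
    have h3' := h3.of_le (by norm_num : (2 : WithTop ℕ∞) ≤ 3)
    have e : deriv f =ᶠ[nhds t] fun t => deriv (fun s => c x0 (Y s)) t - deriv (fun s => c x1 (Y s)) t := by
      filter_upwards [hIo.mem_nhds (hI t ht)] with s hs
      obtain ⟨k1, k2, k3⟩ := facts s hs
      have k3' := k3.differentiableAt (by norm_num : (3 : WithTop ℕ∞) ≠ 0)
      exact deriv_sub (R.chainY1 hx0 k1 k3').differentiableAt (R.chainY1 hx1 k1 k3').differentiableAt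
    rw [e.deriv_eq]
    refine ((R.chainY hx0 h1 h3').sub (R.chainY hx1 h1 h3')).deriv.trans ?_
    -- the third derivative identity
    set w := (AA n c U V x0 (Y t)).inverse (δ t) with hw
    have hk : fderiv ℝ (fderiv ℝ (fderiv ℝ (Function.uncurry c))) (x0, Y t) (w, 0)
        (0, deriv Y t) (0, deriv Y t) + inner ℝ (δ t) (deriv (deriv Y) t) = 0 := by
      obtain ⟨p1, p2, p3⟩ := pair_derivs (x := x0) h3'
      have hF : ContDiffAt ℝ 2 (fun z => fderiv ℝ (Function.uncurry c) z (w, 0)) (x0, Y t) :=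
        ((R.D1at hx0 h1).clm_apply contDiffAt_const).of_le (by norm_num)
      have hc := chain2 (g := fun s => (x0, Y s)) hF p1
      rw [p2, p3] at hc
      have hdF : ∀ z ∈ U ×ˢ V, fderiv ℝ (fun z => fderiv ℝ (Function.uncurry c) z (w, 0)) z =
          fderiv ℝ (fderiv ℝ (Function.uncurry c)) z (w, 0) := by
        rintro ⟨a, b⟩ hz
        have := ((((R.D1at hz.1 hz.2).differentiableAt (by norm_num)).hasFDerivAt).clm_apply
          (hasFDerivAt_const ((w, 0) : Euc n × Euc n) (a, b))).fderiv
        rw [this]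
        refine ContinuousLinearMap.ext fun v => ?_
        simp only [add_apply, ContinuousLinearMap.comp_apply, zero_apply, map_zero, zero_add,
          ContinuousLinearMap.flip_apply]
        exact R.D2symm hz.1 hz.2 _ _
      have hd2F : fderiv ℝ (fderiv ℝ (fun z => fderiv ℝ (Function.uncurry c) z (w, 0))) (x0, Y t)
          (0, deriv Y t) (0, deriv Y t) =
          fderiv ℝ (fderiv ℝ (fderiv ℝ (Function.uncurry c))) (x0, Y t)
            (0, deriv Y t) (w, 0) (0, deriv Y t) := by
        have e1 : fderiv ℝ (fun z => fderiv ℝ (Function.uncurry c) z (w, 0)) =ᶠ[nhds (x0, Y t)]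
            fun z => fderiv ℝ (fderiv ℝ (Function.uncurry c)) z (w, 0) := by
          filter_upwards [prod_mem_nhds (R.Uo.mem_nhds hx0) (R.Vo.mem_nhds h1)] with z hz
          exact hdF z hz
        rw [e1.fderiv_eq]
        have hD : DifferentiableAt ℝ (fun z => fderiv ℝ (fderiv ℝ (Function.uncurry c)) z (w, 0))
            (x0, Y t) := by
          exact ((R.D2at hx0 h1).differentiableAt (by norm_num)).clm_apply (differentiableAt_const _)
        have h8 := hD.hasFDerivAt.clm_apply (hasFDerivAt_const ((0, deriv Y t) : Euc n × Euc n) (x0, Y t))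
        have h9 := hfd_apply2 ((R.D2at hx0 h1).differentiableAt (by norm_num)).hasFDerivAt (w, 0) (0, deriv Y t)
        have h10 := h8.unique h9
        have h11 := congrArg (fun T : Euc n × Euc n →L[ℝ] ℝ => T (0, deriv Y t)) h10
        simpa using h11
      rw [hd2F, hdF _ ⟨hx0, h1⟩] at hc
      have hz : HasDerivAt (deriv (fun s => fderiv ℝ (Function.uncurry c) (x0, Y s) (w, 0))) 0 t := by
        have e1 : (fun s => fderiv ℝ (Function.uncurry c) (x0, Y s) (w, 0)) =ᶠ[nhds t]
            fun s => -inner ℝ (g y0) w + s * (-inner ℝ d w) := by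
          filter_upwards [hIo.mem_nhds (hI t ht)] with s hs
          obtain ⟨k1, k2, k3⟩ := facts s hs
          rw [← PXm_inner, ← R.gX_eq hx0 k1]
          have : gradX n c x0 (Y s) = - g (Y s) := by simp [hg]
          rw [this, k2, inner_neg_left, inner_add_left, inner_smul_left]
          simp only [conj_trivial]; ring
        have e2 : deriv (fun s => -inner ℝ (g y0) w + s * (-inner ℝ d w)) = fun _ => -inner ℝ d w := by
          funext s
          have := ((hasDerivAt_id s).mul_const (-inner ℝ d w)).const_add (-inner ℝ (g y0) w)
          simpa using this.deriv
        have e3 := e1.deriv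
        rw [e2] at e3
        exact (hasDerivAt_const t (-inner ℝ d w)).congr_of_eventuallyEq e3
      have h12 := hc.unique hz
      rw [← h12, R.D3symm hx0 h1 (w, 0)]
      congr 1
      rw [← R.A_inner hx0 h1, hw,
        R.AN x0 hx0c (Y t) (hYcl ht)]
    simp only [hB, add_apply, sub_apply]
    simp only [hδ, inner_sub_left] at hk ⊢
    linarith
  have := ode_max (f := f) (K := 3 * ‖Bop s‖ * ‖deriv Y s‖ / ‖δ s‖) (by positivity) hfC ?_ hτ
  · simpa only [hf, hY0, hY1] using this
  intro t ht
  obtain ⟨h1, h2, h3⟩ := facts t (hI t ht)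
  rw [hfd t ht, hf2 t ht, abs_neg]
  refine le_trans ?_ (bilin_bound (Bop t) (hδ0 t ht) le_rfl ?_)
  · have := hKmax ht
    simp only [mem_ofPred_eq] at this
    have h0 := abs_nonneg (inner ℝ (δ t) (deriv Y t))
    nlinarith
  · intro w hw
    have := R.L1 hx0 hx1 h1 hw
    simp only [hB, add_apply, sub_apply]
    simp only [hδ]
    linarith

/-- Loeper's maximum principle -/
lemma Reg.DASM (R : Reg n c U V) {x0 x1 y0 y1 y : Euc n} (hx0 : x0 ∈ U) (hx1 : x1 ∈ U)
    (hy0 : y0 ∈ closure V) (hy1 : y1 ∈ closure V) (hy : y ∈ closure V) {τ : ℝ}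
    (hτ : τ ∈ Icc (0:ℝ) 1)
    (h : gradX n c x0 y = (1 - τ) • gradX n c x0 y0 + τ • gradX n c x0 y1) :
    c x0 y - c x1 y ≤ max (c x0 y0 - c x1 y0) (c x0 y1 - c x1 y1) := by
  have hx0c := subset_closure hx0
  set g := fun y' => -gradX n c x0 y' with hg
  have hdg : DiffeoOnto n g (closure V) := R.b1.2 x0 hx0c
  have hgc : ContinuousOn g (closure V) := hdg.2.1.continuousOn
  set F := fun z : Euc n × Euc n => Function.invFunOn g (closure V) (g z.1 + τ • (g z.2 - g z.1))
    with hF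
  have hconv : Convex ℝ (g '' closure V) := by
    rw [diffeo_image_closure R.Vb hdg]; exact (R.b2.2 x0 hx0c).closure
  have hmem : ∀ z ∈ closure V ×ˢ closure V, g z.1 + τ • (g z.2 - g z.1) ∈ g '' closure V :=
    fun z hz => hconv.add_smul_sub_mem (mem_image_of_mem g hz.1) (mem_image_of_mem g hz.2) hτ
  have hFm : MapsTo F (closure V ×ˢ closure V) (closure V) := fun z hz =>
    Function.invFunOn_mem (hmem z hz)
  have hg1 : ContinuousOn (fun z : Euc n × Euc n => g z.1) (closure V ×ˢ closure V) :=
    hgc.comp continuousOn_fst (fun z hz => hz.1)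
  have hg2 : ContinuousOn (fun z : Euc n × Euc n => g z.2) (closure V ×ˢ closure V) :=
    hgc.comp continuousOn_snd (fun z hz => hz.2)
  have hFc : ContinuousOn F (closure V ×ˢ closure V) :=
    by
    have h1 : ContinuousOn (fun z : Euc n × Euc n => g z.1 + τ • (g z.2 - g z.1))
        (closure V ×ˢ closure V) := hg1.add ((hg2.sub hg1).const_smul τ)
    exact hdg.2.2.continuousOn.comp h1 hmem
  have hcc : ∀ x ∈ U, ContinuousOn (fun y => c x y) (closure V) := fun x hx =>
    R.C4.continuousOn.comp (continuousOn_const.prodMk continuousOn_id)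
      (fun y hy => ⟨subset_closure hx, hy⟩)
  have hfc : ContinuousOn (fun y => c x0 y - c x1 y) (closure V) := (hcc x0 hx0).sub (hcc x1 hx1)
  have hyF : y = F (y0, y1) := by
    have e : g y = g y0 + τ • (g y1 - g y0) := by
      simp only [hg, h]; rw [sub_smul, one_smul]; simp only [smul_sub, smul_neg]; abel
    simp only [hF, ← e]
    exact (hdg.1.leftInvOn_invFunOn hy).symm
  have hsub : V ×ˢ V ⊆ closure V ×ˢ closure V := prod_mono subset_closure subset_closure
  have hf1 : ContinuousOn (fun z : Euc n × Euc n => c x0 z.1 - c x1 z.1) (closure V ×ˢ closure V) :=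
    hfc.comp continuousOn_fst (fun (z : Euc n × Euc n) hz => hz.1)
  have hf2 : ContinuousOn (fun z : Euc n × Euc n => c x0 z.2 - c x1 z.2) (closure V ×ˢ closure V) :=
    hfc.comp continuousOn_snd (fun (z : Euc n × Euc n) hz => hz.2)
  have hmx : ContinuousOn (fun z : Euc n × Euc n => max (c x0 z.1 - c x1 z.1)
      (c x0 z.2 - c x1 z.2)) (closure V ×ˢ closure V) := hf1.sup hf2
  have key := ContinuousWithinAt.closure_le (s := V ×ˢ V) (x := (y0, y1))
    (f := fun z => c x0 (F z) - c x1 (F z))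
    (g := fun z => max (c x0 z.1 - c x1 z.1) (c x0 z.2 - c x1 z.2))
    (by rw [closure_prod_eq]; exact ⟨hy0, hy1⟩)
    (((hfc.comp hFc hFm) (y0, y1) ⟨hy0, hy1⟩).mono hsub)
    ((hmx (y0, y1) ⟨hy0, hy1⟩).mono hsub)
    (fun z hz => R.DASM_int hx0 hx1 hz.1 hz.2 hτ)
  rw [hyF]
  exact key

end D3c



section D4a
variable {n : ℕ} {c : Euc n → Euc n → ℝ} {U V : Set (Euc n)}

/-- the inverse of the mixed derivative -/
noncomputable def NN (n : ℕ) (c : Euc n → Euc n → ℝ) (U V : Set (Euc n)) (x y : Euc n) :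
    Euc n →L[ℝ] Euc n := (AA n c U V x y).inverse

/-- adjoint of the mixed derivative -/
noncomputable def AT (n : ℕ) (c : Euc n → Euc n → ℝ) (U V : Set (Euc n)) (x y : Euc n) :
    Euc n →L[ℝ] Euc n := ContinuousLinearMap.adjoint (AA n c U V x y)

/-- adjoint of the inverse of the mixed derivative -/
noncomputable def NT (n : ℕ) (c : Euc n → Euc n → ℝ) (U V : Set (Euc n)) (x y : Euc n) :
    Euc n →L[ℝ] Euc n := ContinuousLinearMap.adjoint (AA n c U V x y).inverse

lemma Reg.AT_NT (R : Reg n c U V) {x y : Euc n} (hx : x ∈ closure U) (hy : y ∈ closure V)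
    (v : Euc n) : AT n c U V x y (NT n c U V x y v) = v := by
  refine ext_inner_right ℝ fun w => ?_
  rw [AT, NT, ContinuousLinearMap.adjoint_inner_left, ContinuousLinearMap.adjoint_inner_left,
    R.NA x hx y hy]

lemma Reg.NT_AT (R : Reg n c U V) {x y : Euc n} (hx : x ∈ closure U) (hy : y ∈ closure V)
    (v : Euc n) : NT n c U V x y (AT n c U V x y v) = v := by
  refine ext_inner_right ℝ fun w => ?_
  rw [AT, NT, ContinuousLinearMap.adjoint_inner_left, ContinuousLinearMap.adjoint_inner_left,
    R.AN x hx y hy]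

lemma Reg.ATc (R : Reg n c U V) :
    ContinuousOn (fun z : Euc n × Euc n => AT n c U V z.1 z.2) (closure U ×ˢ closure V) :=
  (ContinuousLinearMap.adjoint (𝕜 := ℝ) (E := Euc n) (F := Euc n)).continuous.comp_continuousOn R.Ac

lemma Reg.NTc (R : Reg n c U V) :
    ContinuousOn (fun z : Euc n × Euc n => NT n c U V z.1 z.2) (closure U ×ˢ closure V) :=
  (ContinuousLinearMap.adjoint (𝕜 := ℝ) (E := Euc n) (F := Euc n)).continuous.comp_continuousOn R.Nc

/-- the `c`-segment from `y0` to `y1` with respect to `x` -/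
lemma Reg.cseg (R : Reg n c U V) {x y0 y1 : Euc n} (hx : x ∈ closure U) (hy0 : y0 ∈ closure V)
    (hy1 : y1 ∈ closure V) :
    ∃ Y : ℝ → Euc n, Y 0 = y0 ∧ Y 1 = y1 ∧ ∀ τ ∈ Icc (0:ℝ) 1, Y τ ∈ closure V ∧
      gradX n c x (Y τ) = gradX n c x y0 + τ • (gradX n c x y1 - gradX n c x y0) ∧
      HasDerivWithinAt Y (NT n c U V x (Y τ) (gradX n c x y1 - gradX n c x y0)) (Icc 0 1) τ := by
  set g := fun y' => -gradX n c x y' with hg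
  have hdg : DiffeoOnto n g (closure V) := R.b1.2 x hx
  have hconv : Convex ℝ (g '' closure V) := by
    rw [diffeo_image_closure R.Vb hdg]; exact (R.b2.2 x hx).closure
  have hmem : ∀ τ ∈ Icc (0:ℝ) 1, g y0 + τ • (g y1 - g y0) ∈ g '' closure V :=
    fun z hz => hconv.add_smul_sub_mem (mem_image_of_mem g hy0) (mem_image_of_mem g hy1) hz
  refine ⟨fun τ => Function.invFunOn g (closure V) (g y0 + τ • (g y1 - g y0)), ?_, ?_, ?_⟩
  · simp only [zero_smul, add_zero]
    exact hdg.1.leftInvOn_invFunOn hy0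
  · simp only [one_smul, add_sub_cancel]
    exact hdg.1.leftInvOn_invFunOn hy1
  intro τ hτ
  obtain ⟨z, hz, hz2⟩ := hmem τ hτ
  have e : Function.invFunOn g (closure V) (g y0 + τ • (g y1 - g y0)) = z := by
    rw [← hz2]; exact hdg.1.leftInvOn_invFunOn hz
  simp only [e]
  refine ⟨hz, ?_, ?_⟩
  · simp only [hg] at hz2
    have : gradX n c x z = -(-gradX n c x z) := by simp
    rw [this, hz2]
    simp only [smul_sub, smul_neg]; abel
  · have hF : HasFDerivWithinAt g (-AT n c U V x z) (closure V) z := (R.dXY x hx z hz).neg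
    have hG := ((hdg.2.2.differentiableOn one_ne_zero) (g z)
      (mem_image_of_mem g hz)).hasFDerivWithinAt
    have hid := inv_deriv hdg.1 (R.uV z hz) hz hF hG
    set G := fderivWithin ℝ (Function.invFunOn g (closure V)) (g '' closure V) (g z)
    have hGw : ∀ w, G w = - NT n c U V x z w := by
      intro w
      have := congrArg (fun T : Euc n →L[ℝ] Euc n => T (-NT n c U V x z w)) hid
      simpa [R.AT_NT hx hz] using this
    rw [hz2] at hG
    have haff : HasDerivWithinAt (fun τ : ℝ => g y0 + τ • (g y1 - g y0)) (g y1 - g y0) (Icc 0 1) τ := by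
      have := (((hasDerivAt_id τ).smul_const (g y1 - g y0)).const_add (g y0)).hasDerivWithinAt
        (s := Icc 0 1)
      simpa using this
    have := hG.comp_hasDerivWithinAt τ haff hmem
    refine this.congr_deriv ?_
    rw [hGw, ← map_neg]; congr 1; simp [hg]; abel

/-- gradient of the modified function `-c̃(·,y)` in cost-exponential coordinates from `ȳ` -/
noncomputable def GG (n : ℕ) (c : Euc n → Euc n → ℝ) (U V : Set (Euc n)) (yb x y : Euc n) : Euc n :=
  NT n c U V x yb (gradX n c x y - gradX n c x yb)

lemma GG_self (yb x : Euc n) : GG n c U V yb x yb = 0 := by simp [GG]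

lemma Reg.GG_inv (R : Reg n c U V) {x yb : Euc n} (hx : x ∈ closure U) (hyb : yb ∈ closure V)
    (y : Euc n) : AT n c U V x yb (GG n c U V yb x y) = gradX n c x y - gradX n c x yb := by
  rw [GG, R.AT_NT hx hyb]

lemma Reg.cX (R : Reg n c U V) {y : Euc n} (hy : y ∈ closure V) :
    ContinuousOn (fun x => c x y) (closure U) :=
  R.C4.continuousOn.comp (continuousOn_id.prodMk continuousOn_const) (fun _ hx => ⟨hx, hy⟩)

lemma Reg.cY (R : Reg n c U V) {x : Euc n} (hx : x ∈ closure U) :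
    ContinuousOn (fun y => c x y) (closure V) :=
  R.C4.continuousOn.comp (continuousOn_const.prodMk continuousOn_id) (fun _ hy => ⟨hx, hy⟩)

/-- pseudo-convexity -/
lemma Reg.lemX (R : Reg n c U V) {x0 x1 yb y : Euc n} (hx0 : x0 ∈ U) (hx1 : x1 ∈ U)
    (hyb : yb ∈ closure V) (hy : y ∈ closure V)
    (h : 0 < inner ℝ (GG n c U V yb x0 y) (gradY n c x0 yb - gradY n c x1 yb)) :
    c x0 yb - c x1 yb < c x0 y - c x1 y := by
  have hx0c := subset_closure hx0
  have hx1c := subset_closure hx1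
  obtain ⟨Y, Y0, Y1, hY⟩ := R.cseg hx0c hyb hy
  by_contra hcon
  push Not at hcon
  have h0 : (0:ℝ) ∈ Icc (0:ℝ) 1 := by simp
  have hd : ∀ x ∈ closure U, HasDerivWithinAt (fun τ => c x (Y τ))
      (inner ℝ (gradY n c x yb) (GG n c U V yb x0 y)) (Icc 0 1) 0 := by
    intro x hx
    have h1 := R.dY x hx (Y 0) (hY 0 h0).1
    have := h1.comp_hasDerivWithinAt 0 (hY 0 h0).2.2 (fun τ hτ => (hY τ hτ).1)
    rw [Y0] at this
    exact this
  have hf := (hd x0 hx0c).sub (hd x1 hx1c)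
  rw [← inner_sub_left, real_inner_comm] at hf
  have hmax : ∀ τ ∈ Icc (0:ℝ) 1, c x0 (Y τ) - c x1 (Y τ) ≤ c x0 yb - c x1 yb := by
    intro τ hτ
    have := R.DASM hx0 hx1 hyb hy (hY τ hτ).1 hτ (by
      rw [(hY τ hτ).2.1, sub_smul, one_smul, smul_sub]; abel)
    rwa [max_eq_left hcon] at this
  have hlm : IsLocalMaxOn ((fun τ => c x0 (Y τ)) - fun τ => c x1 (Y τ)) (Icc 0 1) 0 := by
    filter_upwards [self_mem_nhdsWithin] with τ hτ
    simp only [Pi.sub_apply, Y0]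
    exact hmax τ hτ
  have := hlm.hasFDerivWithinAt_nonpos hf.hasFDerivWithinAt (y := 1)
    (mem_posTangentConeAt_of_segment_subset (by
      rw [segment_eq_Icc (by norm_num)]; simp))
  simp at this
  linarith

/-- one-dimensional quasi-convexity -/
lemma quasi1d {φ φ' : ℝ → ℝ} (hc : ContinuousOn φ (Icc 0 1))
    (hd : ∀ s ∈ Ioo (0:ℝ) 1, HasDerivAt φ (φ' s) s)
    (h : ∀ s ∈ Ioo (0:ℝ) 1, 0 < φ' s → φ s < φ 1) {t : ℝ} (ht : t ∈ Icc (0:ℝ) 1) :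
    φ t ≤ max (φ 0) (φ 1) := by
  by_contra hcon
  push Not at hcon
  set M := max (φ 0) (φ 1)
  have hct : ContinuousOn φ (Icc 0 t) := hc.mono (Icc_subset_Icc_right ht.2)
  have hS : IsCompact (Icc 0 t ∩ φ ⁻¹' Iic M) :=
    isCompact_Icc.of_isClosed_subset (hct.preimage_isClosed_of_isClosed isClosed_Icc isClosed_Iic)
      inter_subset_left
  obtain ⟨a, ⟨⟨ha0, hat⟩, haM⟩, hag⟩ := hS.exists_isGreatest ⟨0, ⟨by simp [ht.1], (le_max_left _ _ : φ 0 ≤ M)⟩⟩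
  have haM' : φ a ≤ M := haM
  have hat' : a < t := lt_of_le_of_ne hat (by rintro rfl; linarith)
  obtain ⟨s, hs, hs2⟩ := exists_hasDerivAt_eq_slope φ φ' hat'
    (hct.mono (Icc_subset_Icc_left ha0))
    (fun s hs => hd s ⟨ha0.trans_lt hs.1, hs.2.trans_le ht.2⟩)
  have hpos : 0 < φ' s := by rw [hs2]; apply div_pos <;> linarith
  have h1 := h s ⟨ha0.trans_lt hs.1, hs.2.trans_le ht.2⟩ hpos
  have : s ≤ a := hag ⟨⟨ha0.trans hs.1.le, hs.2.le⟩, (h1.le.trans (le_max_right _ _) : φ s ≤ M)⟩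
  linarith [hs.1]

end D4a



section D4b
variable {n : ℕ} {c : Euc n → Euc n → ℝ} {U V : Set (Euc n)}

lemma Reg.x_mem (R : Reg n c U V) {yb q : Euc n} (hyb : yb ∈ closure V)
    (hq : q ∈ Uyset n c U yb) : xOf n c U yb q ∈ U ∧ -gradY n c (xOf n c U yb q) yb = q := by
  obtain ⟨x, hx, rfl⟩ := hq
  have : xOf n c U yb (-gradY n c x yb) = x :=
    (R.b1.1 yb hyb).1.leftInvOn_invFunOn (subset_closure hx)
  simp only [this]
  exact ⟨hx, trivial⟩

lemma Reg.x_memc (R : Reg n c U V) {yb q : Euc n} (hyb : yb ∈ closure V)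
    (hq : q ∈ clUy n c U yb) : xOf n c U yb q ∈ closure U ∧ -gradY n c (xOf n c U yb q) yb = q := by
  obtain ⟨x, hx, rfl⟩ := hq
  have : xOf n c U yb (-gradY n c x yb) = x :=
    (R.b1.1 yb hyb).1.leftInvOn_invFunOn hx
  simp only [this]
  exact ⟨hx, trivial⟩

lemma Reg.x_left (R : Reg n c U V) {yb x : Euc n} (hyb : yb ∈ closure V) (hx : x ∈ closure U) :
    xOf n c U yb (-gradY n c x yb) = x :=
  (R.b1.1 yb hyb).1.leftInvOn_invFunOn hx

lemma Uy_sub (yb : Euc n) : Uyset n c U yb ⊆ clUy n c U yb := image_mono subset_closure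

lemma Reg.Uy_open (R : Reg n c U V) {yb : Euc n} (hyb : yb ∈ closure V) :
    IsOpen (Uyset n c U yb) := diffeo_isOpen R.Uo (R.b1.1 yb hyb)

lemma Reg.Uy_convex (R : Reg n c U V) {yb : Euc n} (hyb : yb ∈ closure V) :
    Convex ℝ (Uyset n c U yb) := R.b2.1 yb hyb

lemma Reg.clUy_eq (R : Reg n c U V) {yb : Euc n} (hyb : yb ∈ closure V) :
    clUy n c U yb = closure (Uyset n c U yb) := diffeo_image_closure R.Ub (R.b1.1 yb hyb)

lemma Reg.clUy_compact (R : Reg n c U V) {yb : Euc n} (hyb : yb ∈ closure V) :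
    IsCompact (clUy n c U yb) :=
  R.Ub.isCompact_closure.image_of_continuousOn (R.b1.1 yb hyb).2.1.continuousOn

lemma Reg.Vc_compact (R : Reg n c U V) : IsCompact (closure V) := R.Vb.isCompact_closure
lemma Reg.Uc_compact (R : Reg n c U V) : IsCompact (closure U) := R.Ub.isCompact_closure

lemma Reg.x_cont (R : Reg n c U V) {yb : Euc n} (hyb : yb ∈ closure V) :
    ContinuousOn (xOf n c U yb) (clUy n c U yb) := (R.b1.1 yb hyb).2.2.continuousOn

lemma Reg.x_deriv (R : Reg n c U V) {yb q : Euc n} (hyb : yb ∈ closure V)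
    (hq : q ∈ Uyset n c U yb) :
    HasFDerivAt (xOf n c U yb) (-NN n c U V (xOf n c U yb q) yb) q := by
  obtain ⟨hx, hxq⟩ := R.x_mem hyb hq
  set x := xOf n c U yb q with hxd
  have hxc := subset_closure hx
  have hdg := R.b1.1 yb hyb
  have hF : HasFDerivWithinAt (fun x => -gradY n c x yb) (-AA n c U V x yb) (closure U) x :=
    (R.dYX x hxc yb hyb).neg
  have hG := ((hdg.2.2.differentiableOn one_ne_zero) _
      (mem_image_of_mem _ hxc)).hasFDerivWithinAt
  have hid := inv_deriv hdg.1 (R.uU x hxc) hxc hF hG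
  simp only [hxq] at hG hid
  have hn : (fun x => -gradY n c x yb) '' closure U ∈ nhds q :=
    Filter.mem_of_superset ((R.Uy_open hyb).mem_nhds hq) (Uy_sub yb)
  have hG' := hG.hasFDerivAt hn
  refine hG'.congr_fderiv ?_
  refine ContinuousLinearMap.ext fun w => ?_
  have := congrArg (fun T : Euc n →L[ℝ] Euc n => T (-NN n c U V x yb w)) hid
  simpa [NN, R.AN x hxc yb hyb] using this

/-- `-c̃` -/
noncomputable def mm (n : ℕ) (c : Euc n → Euc n → ℝ) (U : Set (Euc n)) (yb q y : Euc n) : ℝ :=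
  c (xOf n c U yb q) yb - c (xOf n c U yb q) y

/-- gradient in coordinates -/
noncomputable def Gq (n : ℕ) (c : Euc n → Euc n → ℝ) (U V : Set (Euc n)) (yb q y : Euc n) : Euc n :=
  GG n c U V yb (xOf n c U yb q) y

lemma mm_eq (yb q y : Euc n) : mm n c U yb q y = - modCost n c U yb q y := by
  simp [mm, modCost]

lemma Reg.mm_deriv (R : Reg n c U V) {yb q y : Euc n} (hyb : yb ∈ closure V)
    (hy : y ∈ closure V) (hq : q ∈ Uyset n c U yb) :
    HasFDerivAt (fun q => mm n c U yb q y) (innerSL ℝ (Gq n c U V yb q y)) q := by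
  obtain ⟨hx, hxq⟩ := R.x_mem hyb hq
  have hxd := R.x_deriv hyb hq
  have hxc := subset_closure hx
  have h1 := ((R.dX _ hxc yb hyb).hasFDerivAt (R.nU hx)).comp q hxd
  have h2 := ((R.dX _ hxc y hy).hasFDerivAt (R.nU hx)).comp q hxd
  refine (h1.sub h2).congr_fderiv ?_
  refine ContinuousLinearMap.ext fun w => ?_
  simp only [sub_apply, ContinuousLinearMap.comp_apply, neg_apply, innerSL_apply_apply, Gq, GG, NT,
    ContinuousLinearMap.adjoint_inner_left, NN, inner_neg_right, inner_sub_left]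
  ring

/-- pseudo-convexity in coordinates -/
lemma Reg.pseudo (R : Reg n c U V) {yb q0 q1 y : Euc n} (hyb : yb ∈ closure V)
    (hy : y ∈ closure V) (hq0 : q0 ∈ Uyset n c U yb) (hq1 : q1 ∈ Uyset n c U yb)
    (h : 0 < inner ℝ (Gq n c U V yb q0 y) (q1 - q0)) :
    mm n c U yb q0 y < mm n c U yb q1 y := by
  obtain ⟨hx0, e0⟩ := R.x_mem hyb hq0
  obtain ⟨hx1, e1⟩ := R.x_mem hyb hq1
  have := R.lemX hx0 hx1 hyb hy (by
    have : gradY n c (xOf n c U yb q0) yb - gradY n c (xOf n c U yb q1) yb = q1 - q0 := by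
      conv_rhs => rw [← e0, ← e1]
      abel
    rw [this]; exact h)
  simp only [mm]; linarith

lemma Reg.mm_quasi (R : Reg n c U V) {yb q0 q1 y : Euc n} (hyb : yb ∈ closure V)
    (hy : y ∈ closure V) (hq0 : q0 ∈ Uyset n c U yb) (hq1 : q1 ∈ Uyset n c U yb) {t : ℝ}
    (ht : t ∈ Icc (0:ℝ) 1) :
    mm n c U yb (q0 + t • (q1 - q0)) y ≤ max (mm n c U yb q0 y) (mm n c U yb q1 y) := by
  have hm : ∀ s ∈ Icc (0:ℝ) 1, q0 + s • (q1 - q0) ∈ Uyset n c U yb := fun s hs =>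
    (R.Uy_convex hyb).add_smul_sub_mem hq0 hq1 hs
  have hd : ∀ s ∈ Icc (0:ℝ) 1, HasDerivAt (fun s : ℝ => mm n c U yb (q0 + s • (q1 - q0)) y)
      (inner ℝ (Gq n c U V yb (q0 + s • (q1 - q0)) y) (q1 - q0)) s := by
    intro s hs
    have haff : HasDerivAt (fun τ : ℝ => q0 + τ • (q1 - q0)) (q1 - q0) s := by
      simpa using ((hasDerivAt_id s).smul_const (q1 - q0)).const_add q0
    exact (R.mm_deriv hyb hy (hm s hs)).comp_hasDerivAt s haff
  have := quasi1d (φ := fun s : ℝ => mm n c U yb (q0 + s • (q1 - q0)) y)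
    (fun s hs => (hd s hs).continuousAt.continuousWithinAt)
    (fun s hs => hd s (Ioo_subset_Icc_self hs)) (fun s hs hpos => by
      have h1 := hm s (Ioo_subset_Icc_self hs)
      have h2 := hm 1 (by simp)
      refine R.pseudo hyb hy h1 h2 ?_
      have e : q0 + (1:ℝ) • (q1 - q0) - (q0 + s • (q1 - q0)) = (1 - s) • (q1 - q0) := by
        rw [sub_smul]; abel
      rw [e, inner_smul_right]
      have : 0 < 1 - s := by linarith [hs.2]
      positivity) ht
  simpa using this

/-- Loeper's maximum principle in coordinates -/
lemma Reg.dasm (R : Reg n c U V) {yb q0 q1 y0 y1 y : Euc n} (hyb : yb ∈ closure V)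
    (hq0 : q0 ∈ Uyset n c U yb) (hq1 : q1 ∈ Uyset n c U yb)
    (hy0 : y0 ∈ closure V) (hy1 : y1 ∈ closure V) (hy : y ∈ closure V) {τ : ℝ}
    (hτ : τ ∈ Icc (0:ℝ) 1)
    (h : Gq n c U V yb q0 y = (1 - τ) • Gq n c U V yb q0 y0 + τ • Gq n c U V yb q0 y1) :
    mm n c U yb q1 y - mm n c U yb q0 y ≤
      max (mm n c U yb q1 y0 - mm n c U yb q0 y0) (mm n c U yb q1 y1 - mm n c U yb q0 y1) := by
  obtain ⟨hx0, e0⟩ := R.x_mem hyb hq0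
  obtain ⟨hx1, e1⟩ := R.x_mem hyb hq1
  have hx0c := subset_closure hx0
  have h' := congrArg (AT n c U V (xOf n c U yb q0) yb) h
  simp only [Gq, map_add, map_smul, R.GG_inv hx0c hyb] at h'
  have key := R.DASM hx0 hx1 hy0 hy1 hy hτ (by
    have := congrArg (fun z => z + gradX n c (xOf n c U yb q0) yb) h'
    simp only [sub_add_cancel] at this
    rw [this]
    simp only [sub_smul, one_smul, smul_sub]; abel)
  simp only [mm]
  rcases le_max_iff.1 key with k | k
  · exact le_max_of_le_left (by linarith)
  · exact le_max_of_le_right (by linarith)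

lemma Reg.gXc (R : Reg n c U V) :
    ContinuousOn (fun z : Euc n × Euc n => gradX n c z.1 z.2) (closure U ×ˢ closure V) :=
  R.gX3.continuousOn

/-- joint continuity of `mm` -/
lemma Reg.mm_cont (R : Reg n c U V) {yb : Euc n} (hyb : yb ∈ closure V) :
    ContinuousOn (fun z : Euc n × Euc n => mm n c U yb z.1 z.2) (clUy n c U yb ×ˢ closure V) := by
  have h1 : ContinuousOn (fun z : Euc n × Euc n => xOf n c U yb z.1) (clUy n c U yb ×ˢ closure V) :=
    (R.x_cont hyb).comp continuousOn_fst (fun (z : Euc n × Euc n) hz => hz.1)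
  exact (R.C4.continuousOn.comp (h1.prodMk continuousOn_const)
      (fun z hz => ⟨(R.x_memc hyb hz.1).1, hyb⟩)).sub
    (R.C4.continuousOn.comp (h1.prodMk continuousOn_snd)
      (fun z hz => ⟨(R.x_memc hyb hz.1).1, hz.2⟩))

lemma Reg.Gq_cont (R : Reg n c U V) {yb : Euc n} (hyb : yb ∈ closure V) :
    ContinuousOn (fun z : Euc n × Euc n => Gq n c U V yb z.1 z.2) (clUy n c U yb ×ˢ closure V) := by
  have h1 : ContinuousOn (fun z : Euc n × Euc n => xOf n c U yb z.1) (clUy n c U yb ×ˢ closure V) :=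
    (R.x_cont hyb).comp continuousOn_fst (fun (z : Euc n × Euc n) hz => hz.1)
  have h2 := R.NTc.comp (h1.prodMk (continuousOn_const (c := yb)))
      (fun z hz => ⟨(R.x_memc hyb hz.1).1, hyb⟩)
  have h3 := R.gXc.comp (h1.prodMk (continuousOn_const (c := yb)))
      (fun z hz => ⟨(R.x_memc hyb hz.1).1, hyb⟩)
  have h4 := R.gXc.comp (h1.prodMk continuousOn_snd)
      (fun z hz => ⟨(R.x_memc hyb hz.1).1, hz.2⟩)
  exact h2.clm_apply (h4.sub h3)

end D4b



section D4c
variable {n : ℕ} {c : Euc n → Euc n → ℝ} {U V : Set (Euc n)}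

lemma Reg.segq (R : Reg n c U V) {yb q y0 y1 : Euc n} (hyb : yb ∈ closure V)
    (hq : q ∈ clUy n c U yb) (hy0 : y0 ∈ closure V) (hy1 : y1 ∈ closure V) :
    ∃ Y : ℝ → Euc n, Y 0 = y0 ∧ Y 1 = y1 ∧ ContinuousOn Y (Icc 0 1) ∧
      ∀ τ ∈ Icc (0:ℝ) 1, Y τ ∈ closure V ∧
      Gq n c U V yb q (Y τ) = (1 - τ) • Gq n c U V yb q y0 + τ • Gq n c U V yb q y1 := by
  obtain ⟨hx, e⟩ := R.x_memc hyb hq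
  obtain ⟨Y, h0, h1, hY⟩ := R.cseg hx hy0 hy1
  refine ⟨Y, h0, h1, fun τ hτ => (hY τ hτ).2.2.continuousWithinAt, fun τ hτ => ⟨(hY τ hτ).1, ?_⟩⟩
  simp only [Gq, GG, (hY τ hτ).2.1, map_sub, map_add, map_smul, smul_sub, sub_smul, one_smul]
  abel

lemma Reg.bnd (R : Reg n c U V) : ∃ β : ℝ, 0 < β ∧ ∀ x ∈ closure U, ∀ y ∈ closure V,
    ‖AT n c U V x y‖ ≤ β ∧ ‖NT n c U V x y‖ ≤ β := by
  have hK := R.Uc_compact.prod R.Vc_compact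
  obtain ⟨a, ha⟩ := hK.exists_bound_of_continuousOn R.ATc
  obtain ⟨b, hb⟩ := hK.exists_bound_of_continuousOn R.NTc
  refine ⟨max 1 (max a b), by positivity, fun x hx y hy => ⟨?_, ?_⟩⟩
  · exact (ha (x, y) ⟨hx, hy⟩).trans (by simp)
  · exact (hb (x, y) ⟨hx, hy⟩).trans (by simp)

lemma Reg.invunif (R : Reg n c U V) {δ : ℝ} (hδ : 0 < δ) : ∃ ε > 0, ∀ yb ∈ closure V,
    ∀ x ∈ closure U, ∀ x' ∈ closure U, ‖gradY n c x yb - gradY n c x' yb‖ ≤ ε → dist x x' < δ := by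
  set S := (closure U ×ˢ closure U ×ˢ closure V) ∩ {z : Euc n × Euc n × Euc n | δ ≤ dist z.1 z.2.1}
    with hS
  have hSc : IsCompact S := (R.Uc_compact.prod (R.Uc_compact.prod R.Vc_compact)).inter_right
    (isClosed_le continuous_const (by fun_prop))
  have h1 : ContinuousOn (fun z : Euc n × Euc n × Euc n => gradY n c z.1 z.2.2) S :=
    R.gY3.continuousOn.comp (f := fun z : Euc n × Euc n × Euc n => (z.1, z.2.2))
      (by fun_prop) (fun z hz => ⟨hz.1.1, hz.1.2.2⟩)
  have h2 : ContinuousOn (fun z : Euc n × Euc n × Euc n => gradY n c z.2.1 z.2.2) S :=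
    R.gY3.continuousOn.comp (f := fun z : Euc n × Euc n × Euc n => (z.2.1, z.2.2))
      (by fun_prop) (fun z hz => ⟨hz.1.2.1, hz.1.2.2⟩)
  have h3 : ContinuousOn (fun z : Euc n × Euc n × Euc n =>
    ‖gradY n c z.1 z.2.2 - gradY n c z.2.1 z.2.2‖) S := (h1.sub h2).norm
  by_cases hne : S.Nonempty
  · obtain ⟨z, hz, hmin⟩ := hSc.exists_isMinOn hne h3
    have hpos : 0 < ‖gradY n c z.1 z.2.2 - gradY n c z.2.1 z.2.2‖ := by
      rw [norm_pos_iff, sub_ne_zero]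
      intro he
      have := (R.b1.1 z.2.2 hz.1.2.2).1 hz.1.1 hz.1.2.1 (by simp [he])
      have h4 : δ ≤ dist z.1 z.2.1 := hz.2
      rw [this, dist_self] at h4
      linarith
    refine ⟨‖gradY n c z.1 z.2.2 - gradY n c z.2.1 z.2.2‖ / 2, by positivity, ?_⟩
    intro yb hyb x hx x' hx' hle
    by_contra hcon
    push Not at hcon
    have hmem : ((x, x', yb) : Euc n × Euc n × Euc n) ∈ S := ⟨⟨hx, hx', hyb⟩, hcon⟩
    have := isMinOn_iff.1 hmin _ hmem
    dsimp only at this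
    linarith
  · refine ⟨1, one_pos, fun yb hyb x hx x' hx' _ => ?_⟩
    by_contra hcon
    push Not at hcon
    exact hne ⟨(x, x', yb), ⟨⟨hx, hx', hyb⟩, hcon⟩⟩

lemma Reg.F3 (R : Reg n c U V) {η : ℝ} (hη : 0 < η) : ∃ ε > 0, ∀ yb ∈ closure V, ∀ y ∈ closure V,
    ∀ q ∈ clUy n c U yb, ∀ q' ∈ clUy n c U yb, ‖q - q'‖ ≤ ε →
      ‖Gq n c U V yb q y - Gq n c U V yb q' y‖ ≤ η * ‖Gq n c U V yb q' y‖ := by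
  obtain ⟨β, hβ, hb⟩ := R.bnd
  have hK := R.Uc_compact.prod R.Vc_compact
  obtain ⟨ω, hω, hω2⟩ : ∃ ω > 0, (β * (ω * β) + ω) * β ≤ η := by
    refine ⟨η / ((β * β + 1) * β), by positivity, le_of_eq ?_⟩
    field_simp
  obtain ⟨δ1, hδ1, h1⟩ := Metric.uniformContinuousOn_iff.1
    (hK.uniformContinuousOn_of_continuous R.ATc) ω hω
  obtain ⟨δ2, hδ2, h2⟩ := Metric.uniformContinuousOn_iff.1
    (hK.uniformContinuousOn_of_continuous R.NTc) ω hω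
  obtain ⟨ε, hε, h3⟩ := R.invunif (lt_min hδ1 hδ2)
  refine ⟨ε, hε, fun yb hyb y hy q hq q' hq' hqq => ?_⟩
  obtain ⟨hx, e⟩ := R.x_memc hyb hq
  obtain ⟨hx', e'⟩ := R.x_memc hyb hq'
  have hd := h3 yb hyb _ hx _ hx' (by
    have e0 : gradY n c (xOf n c U yb q) yb - gradY n c (xOf n c U yb q') yb = -(q - q') := by
      conv_rhs => rw [← e, ← e']
      abel
    rw [e0, norm_neg]; exact hqq)
  simp only [Gq]
  set x := xOf n c U yb q
  set x' := xOf n c U yb q'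
  have hA : ∀ z ∈ closure V, ‖AT n c U V x z - AT n c U V x' z‖ ≤ ω := fun z hz => by
    have := h1 (x, z) ⟨hx, hz⟩ (x', z) ⟨hx', hz⟩ (by
      rw [Prod.dist_eq]; simp [hd.trans_le (min_le_left _ _)])
    rw [dist_eq_norm] at this; exact this.le
  have hN : ∀ z ∈ closure V, ‖NT n c U V x z - NT n c U V x' z‖ ≤ ω := fun z hz => by
    have := h2 (x, z) ⟨hx, hz⟩ (x', z) ⟨hx', hz⟩ (by
      rw [Prod.dist_eq]; simp [hd.trans_le (min_le_right _ _)])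
    rw [dist_eq_norm] at this; exact this.le
  obtain ⟨Y, Y0, Y1, hY⟩ := R.cseg hx' hyb hy
  set p' := gradX n c x' y - gradX n c x' yb with hp'
  set p := gradX n c x y - gradX n c x yb with hp
  have hpp : ‖p - p'‖ ≤ ω * (β * ‖p'‖) := by
    have hder : ∀ w ∈ closure U, ∀ τ ∈ Icc (0:ℝ) 1, HasDerivWithinAt (fun τ => gradX n c w (Y τ))
        (AT n c U V w (Y τ) (NT n c U V x' (Y τ) p')) (Icc 0 1) τ := fun w hw τ hτ =>
      (R.dXY w hw (Y τ) (hY τ hτ).1).comp_hasDerivWithinAt τ (hY τ hτ).2.2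
        (fun τ hτ => (hY τ hτ).1)
    have := norm_image_sub_le_of_norm_deriv_le_segment_01'
      (f := fun τ => gradX n c x (Y τ) - gradX n c x' (Y τ)) (C := ω * (β * ‖p'‖))
      (fun τ hτ => (hder x hx τ hτ).sub (hder x' hx' τ hτ)) (fun τ hτ => ?_)
    · simp only [Y0, Y1] at this
      have e : p - p' = gradX n c x y - gradX n c x' y - (gradX n c x yb - gradX n c x' yb) := by
        rw [hp, hp']; abel
      rw [e]; exact this
    · have hτ' := Ico_subset_Icc_self hτ
      rw [← sub_apply]
      refine (ContinuousLinearMap.le_opNorm _ _).trans ?_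
      have a1 := hA _ (hY τ hτ').1
      have a2 : ‖NT n c U V x' (Y τ) p'‖ ≤ β * ‖p'‖ :=
        (ContinuousLinearMap.le_opNorm _ _).trans (by
          gcongr; exact (hb x' hx' _ (hY τ hτ').1).2)
      gcongr
  have hp'b : ‖p'‖ ≤ β * ‖GG n c U V yb x' y‖ := by
    rw [hp', ← R.GG_inv hx' hyb y]
    refine (ContinuousLinearMap.le_opNorm _ _).trans ?_
    gcongr; exact (hb x' hx' _ hyb).1
  have e1 : GG n c U V yb x y - GG n c U V yb x' y =
      NT n c U V x yb (p - p') + (NT n c U V x yb - NT n c U V x' yb) p' := by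
    simp only [GG, map_sub, sub_apply, ← hp, ← hp']; abel
  rw [e1]
  calc _ ≤ ‖NT n c U V x yb (p - p')‖ + ‖(NT n c U V x yb - NT n c U V x' yb) p'‖ := norm_add_le _ _
    _ ≤ β * (ω * (β * ‖p'‖)) + ω * ‖p'‖ := by
        gcongr
        · refine (ContinuousLinearMap.le_opNorm _ _).trans ?_
          gcongr; exact (hb x hx _ hyb).2
        · refine (ContinuousLinearMap.le_opNorm _ _).trans ?_
          gcongr; exact hN _ hyb
    _ = (β * (ω * β) + ω) * ‖p'‖ := by ring
    _ ≤ (β * (ω * β) + ω) * (β * ‖GG n c U V yb x' y‖) := by gcongr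
    _ = ((β * (ω * β) + ω) * β) * ‖GG n c U V yb x' y‖ := by ring
    _ ≤ _ := by gcongr

end D4c



section D4d

lemma precon_frontier {X : Type*} [TopologicalSpace X] {S t : Set X} (hS : IsPreconnected S)
    (h1 : (S ∩ t).Nonempty) (h2 : (S ∩ tᶜ).Nonempty) : (S ∩ frontier t).Nonempty := by
  by_contra hcon
  have hd : ∀ x ∈ S, x ∉ frontier t := fun x hx hf => hcon ⟨x, hx, hf⟩
  have hin : ∀ x ∈ S, x ∈ t → x ∈ interior t := fun x hx ht => by
    by_contra hi; exact hd x hx ⟨subset_closure ht, hi⟩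
  have hin' : ∀ x ∈ S, x ∈ tᶜ → x ∈ interior tᶜ := fun x hx ht => by
    by_contra hi
    have : x ∈ frontier tᶜ := ⟨subset_closure ht, hi⟩
    rw [frontier_compl] at this
    exact hd x hx this
  obtain ⟨a, ha, hat⟩ := h1
  obtain ⟨b, hb, hbt⟩ := h2
  obtain ⟨x, _, hx1, hx2⟩ := hS (interior t) (interior tᶜ) isOpen_interior isOpen_interior
    (fun x hx => by
      by_cases ht : x ∈ t
      · exact Or.inl (hin x hx ht)
      · exact Or.inr (hin' x hx ht)) ⟨a, ha, hin a ha hat⟩ ⟨b, hb, hin' b hb hbt⟩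
  exact (interior_subset hx2) (interior_subset hx1)

/-- continuity of sup-transforms -/
lemma sup_cont {X Y : Type*} [PseudoMetricSpace X] [PseudoMetricSpace Y] {A : Set X} {B : Set Y}
    (hA : IsCompact A) (hAn : A.Nonempty) (hB : IsCompact B) {k : X → Y → ℝ}
    (hk : ContinuousOn (fun z : X × Y => k z.1 z.2) (A ×ˢ B)) {f : X → ℝ} {b : ℝ}
    (hf : ∀ x ∈ A, b ≤ f x) :
    (∀ y ∈ B, BddAbove ((fun x => k x y - f x) '' A)) ∧
    ContinuousOn (fun y => sSup ((fun x => k x y - f x) '' A)) B := by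
  obtain ⟨M, hM⟩ := (hA.prod hB).exists_bound_of_continuousOn hk
  have hbd : ∀ y ∈ B, BddAbove ((fun x => k x y - f x) '' A) := by
    intro y hy
    refine ⟨M - b, ?_⟩
    rintro _ ⟨x, hx, rfl⟩
    have := (le_abs_self _).trans (hM (x, y) ⟨hx, hy⟩)
    have := hf x hx
    simp only at *; linarith
  refine ⟨hbd, ?_⟩
  have huc := Metric.uniformContinuousOn_iff.1 ((hA.prod hB).uniformContinuousOn_of_continuous hk)
  rw [Metric.continuousOn_iff]
  intro y hy ε hε
  obtain ⟨δ, hδ, h⟩ := huc (ε / 2) (by positivity)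
  have key : ∀ y ∈ B, ∀ y' ∈ B, dist y y' < δ → sSup ((fun x => k x y - f x) '' A) ≤
      sSup ((fun x => k x y' - f x) '' A) + ε / 2 := by
    intro y hy y' hy' hd
    apply csSup_le (hAn.image _)
    rintro _ ⟨x, hx, rfl⟩
    have h1 := h (x, y) ⟨hx, hy⟩ (x, y') ⟨hx, hy'⟩ (by simpa [Prod.dist_eq] using hd)
    rw [Real.dist_eq] at h1
    have h2 := (abs_lt.1 h1).2
    have h3 := le_csSup (hbd y' hy') (mem_image_of_mem (fun x => k x y' - f x) hx)
    simp only at *; linarith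
  refine ⟨δ, hδ, fun y' hy' hd => ?_⟩
  have a := key y' hy' y hy hd
  have b := key y hy y' hy' (by rwa [dist_comm])
  rw [Real.dist_eq, abs_lt]; constructor <;> linarith

variable {n : ℕ} {c : Euc n → Euc n → ℝ} {U V : Set (Euc n)}

lemma Reg.pot (R : Reg n c U V) {u : Euc n → ℝ} (hu : CConvexOn n c (closure U) (closure V) u) :
    ContinuousOn (cStarT n c (closure U) u) (closure V) ∧
    (∀ x ∈ closure U, ∀ y ∈ closure V, -c x y ≤ u x + cStarT n c (closure U) u y) ∧
    (∀ x ∈ closure U, ∃ y ∈ closure V, u x + cStarT n c (closure U) u y = - c x y) ∧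
    ContinuousOn u (closure U) ∧
    (∀ y ∈ closure V, ∃ x ∈ closure U, u x + cStarT n c (closure U) u y = - c x y) := by
  have hUn := R.Une.closure
  have hVn := R.Vne.closure
  have hk : ContinuousOn (fun z : Euc n × Euc n => -c z.1 z.2) (closure U ×ˢ closure V) :=
    R.C4.continuousOn.neg
  have hk' : ContinuousOn (fun z : Euc n × Euc n => -c z.2 z.1) (closure V ×ˢ closure U) :=
    hk.comp (f := fun z : Euc n × Euc n => (z.2, z.1)) (by fun_prop) (fun z hz => ⟨hz.2, hz.1⟩)
  obtain ⟨M, hM⟩ := (R.Uc_compact.prod R.Vc_compact).exists_bound_of_continuousOn hk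
  have hM' : ∀ x ∈ closure U, ∀ y ∈ closure V, |c x y| ≤ M := fun x hx y hy => by
    simpa using hM (x, y) ⟨hx, hy⟩
  set ψ := cStarT n c (closure U) u with hψ
  -- u bounded below
  have hub : ∃ b, ∀ x ∈ closure U, b ≤ u x := by
    by_contra hcon
    push Not at hcon
    have hunb : ∀ y ∈ closure V, ψ y = 0 := by
      intro y hy
      refine Real.sSup_of_not_bddAbove ?_
      rintro ⟨b, hb⟩
      obtain ⟨x, hx, hlt⟩ := hcon (-M - b)
      have := hb (mem_image_of_mem _ hx)
      have h2 := abs_le.1 (hM' x hx y hy)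
      linarith
    obtain ⟨x, hx, hlt⟩ := hcon (-M)
    obtain ⟨y, hy⟩ := hVn
    have h1 := hu x hx
    have h2 : -c x y - ψ y ≤ u x := by
      rw [h1]
      refine le_csSup ⟨M, ?_⟩ (mem_image_of_mem (fun y => -c x y - ψ y) hy)
      rintro _ ⟨y', hy', rfl⟩
      have h2 := abs_le.1 (hM' x hx y' hy')
      have h5 := hunb y' hy'
      rw [hψ] at h5
      simp only [h5]; linarith
    rw [hunb y hy] at h2
    have h3 := abs_le.1 (hM' x hx y hy)
    linarith
  obtain ⟨b, hb⟩ := hub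
  obtain ⟨h1, h2⟩ := sup_cont R.Uc_compact hUn R.Vc_compact (k := fun x y => -c x y) hk hb
  have h2' : ContinuousOn ψ (closure V) := h2
  have hle : ∀ x ∈ closure U, ∀ y ∈ closure V, -c x y ≤ u x + ψ y := by
    intro x hx y hy
    have := le_csSup (h1 y hy) (mem_image_of_mem _ hx)
    have h3 : -c x y - u x ≤ ψ y := this
    linarith
  have hatt : ∀ x ∈ closure U, ∃ y ∈ closure V, u x + ψ y = -c x y := by
    intro x hx
    have hc : ContinuousOn (fun y => -c x y - ψ y) (closure V) :=
      ContinuousOn.sub (hk.comp (f := fun y => (x, y)) (by fun_prop) (fun y hy => ⟨hx, hy⟩)) h2'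
    obtain ⟨y, hy, hmax⟩ := R.Vc_compact.exists_sSup_image_eq hVn hc
    refine ⟨y, hy, ?_⟩
    have := hu x hx
    rw [← hψ, hmax] at this
    linarith
  have hψb : ∃ b', ∀ y ∈ closure V, b' ≤ ψ y := by
    obtain ⟨b', hb'⟩ := R.Vc_compact.exists_bound_of_continuousOn h2'
    exact ⟨-b', fun y hy => (abs_le.1 (hb' y hy)).1⟩
  obtain ⟨b', hb'⟩ := hψb
  obtain ⟨h3, h4⟩ := sup_cont R.Vc_compact hVn R.Uc_compact (k := fun y x => -c x y) hk' hb'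
  have huc : ContinuousOn u (closure U) := h4.congr hu
  refine ⟨h2', hle, hatt, huc, ?_⟩
  intro y hy
  have hc : ContinuousOn (fun x => -c x y - u x) (closure U) :=
    ContinuousOn.sub (hk.comp (f := fun x => (x, y)) (by fun_prop) (fun x hx => ⟨hx, hy⟩)) huc
  obtain ⟨x, hx, hmax⟩ := R.Uc_compact.exists_sSup_image_eq hUn hc
  refine ⟨x, hx, ?_⟩
  have : ψ y = -c x y - u x := hmax
  linarith

/-- potential in coordinates -/
structure Pot (n : ℕ) (c : Euc n → Euc n → ℝ) (U V : Set (Euc n)) (yb : Euc n)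
    (w ψ : Euc n → ℝ) : Prop where
  hyb : yb ∈ closure V
  ψc : ContinuousOn ψ (closure V)
  wc : ContinuousOn w (clUy n c U yb)
  le : ∀ q ∈ clUy n c U yb, ∀ y ∈ closure V, mm n c U yb q y ≤ w q + ψ y
  att : ∀ q ∈ clUy n c U yb, ∃ y ∈ closure V, w q + ψ y = mm n c U yb q y
  att' : ∀ y ∈ closure V, ∃ q ∈ clUy n c U yb, w q + ψ y = mm n c U yb q y
  conn : ∀ y ∈ closure V, ∀ M : ℝ,
    IsPreconnected {q ∈ Uyset n c U yb | w q - mm n c U yb q y < M}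

lemma Reg.cstar (R : Reg n c U V) {yb : Euc n} (hyb : yb ∈ closure V) (u : Euc n → ℝ) (y : Euc n) :
    cStarT n (modCost n c U yb) (clUy n c U yb) (modPot n c U yb u) y
      = cStarT n c (closure U) u y := by
  unfold cStarT
  congr 1
  ext r; constructor
  · rintro ⟨q, hq, rfl⟩
    refine ⟨xOf n c U yb q, (R.x_memc hyb hq).1, ?_⟩
    simp only [modCost, modPot]; ring
  · rintro ⟨x, hx, rfl⟩
    refine ⟨_, mem_image_of_mem _ hx, ?_⟩
    simp only [modCost, modPot, R.x_left hyb hx]; ring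

lemma Reg.mkPot (R : Reg n c U V) {yb : Euc n} (hyb : yb ∈ closure V) {u : Euc n → ℝ}
    (hu : CConvexOn n c (closure U) (closure V) u) :
    Pot n c U V yb (modPot n c U yb u)
      (cStarT n (modCost n c U yb) (clUy n c U yb) (modPot n c U yb u)) := by
  have e : cStarT n (modCost n c U yb) (clUy n c U yb) (modPot n c U yb u)
      = cStarT n c (closure U) u := funext fun y => R.cstar hyb u y
  rw [e]
  obtain ⟨h1, h2, h3, h4, h5⟩ := R.pot hu
  have hx : ∀ q ∈ clUy n c U yb, xOf n c U yb q ∈ closure U := fun q hq => (R.x_memc hyb hq).1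
  refine ⟨hyb, h1, ?_, ?_, ?_, ?_, ?_⟩
  · exact (h4.comp (R.x_cont hyb) hx).add (R.C4.continuousOn.comp
      ((R.x_cont hyb).prodMk continuousOn_const) (fun q hq => ⟨hx q hq, hyb⟩))
  · intro q hq y hy
    have := h2 _ (hx q hq) y hy
    simp only [mm, modPot]; linarith
  · intro q hq
    obtain ⟨y, hy, e⟩ := h3 _ (hx q hq)
    refine ⟨y, hy, ?_⟩
    simp only [mm, modPot]; linarith
  · intro y hy
    obtain ⟨x, hx, e⟩ := h5 y hy
    refine ⟨_, mem_image_of_mem _ hx, ?_⟩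
    simp only [mm, modPot, R.x_left hyb hx]; linarith
  · intro y hy M
    -- convex set in base y coordinates
    set W := {p ∈ Uyset n c U y | u (xOf n c U y p) + c (xOf n c U y p) y < M} with hW
    have hconv : Convex ℝ W := by
      rw [convex_iff_segment_subset]
      rintro p0 ⟨hp0, h0⟩ p1 ⟨hp1, h1'⟩ p hp
      rw [segment_eq_image'] at hp
      obtain ⟨t, ht, rfl⟩ := hp
      have hm := (R.Uy_convex hy).add_smul_sub_mem hp0 hp1 ht
      refine ⟨hm, ?_⟩
      obtain ⟨y', hy', e'⟩ := h3 _ (subset_closure (R.x_mem hy hm).1)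
      have hq := R.mm_quasi hy hy' hp0 hp1 ht
      have a0 := h2 _ (subset_closure (R.x_mem hy hp0).1) y' hy'
      have a1 := h2 _ (subset_closure (R.x_mem hy hp1).1) y' hy'
      simp only [mm] at hq
      dsimp only
      rcases le_max_iff.1 hq with k | k <;> linarith
    have hpre := hconv.isPreconnected.image
      (fun p => -gradY n c (xOf n c U y p) yb) (by
        have h1 : ContinuousOn (xOf n c U y) W := (R.x_cont hy).mono (fun p hp => Uy_sub y hp.1)
        exact (R.gY3.continuousOn.comp (h1.prodMk continuousOn_const)
          (fun p hp => ⟨subset_closure (R.x_mem hy hp.1).1, hyb⟩)).neg)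
    convert hpre using 1
    ext q; constructor
    · rintro ⟨hq, hlt⟩
      obtain ⟨hxU, e⟩ := R.x_mem hyb hq
      refine ⟨-gradY n c (xOf n c U yb q) y, ⟨⟨_, hxU, rfl⟩, ?_⟩, ?_⟩
      · rw [R.x_left hy (subset_closure hxU)]
        simp only [mm, modPot] at hlt; linarith
      · simp only [R.x_left hy (subset_closure hxU)]; exact e
    · rintro ⟨p, ⟨hp, hlt⟩, rfl⟩
      obtain ⟨hxU, e⟩ := R.x_mem hy hp
      refine ⟨⟨_, hxU, rfl⟩, ?_⟩
      simp only [mm, modPot, R.x_left hyb (subset_closure hxU)]; linarith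

variable {yb : Euc n} {w ψ : Euc n → ℝ}

lemma Pot.closedQ (R : Reg n c U V) (P : Pot n c U V yb w ψ) {Q : Set (Euc n)}
    (hQ : Q = {q ∈ clUy n c U yb | w q ≤ 0}) : IsCompact Q := by
  refine (R.clUy_compact P.hyb).of_isClosed_subset ?_ (hQ ▸ sep_subset _ _)
  rw [hQ]
  exact P.wc.preimage_isClosed_of_isClosed (R.clUy_compact P.hyb).isClosed isClosed_Iic

lemma Pot.w_quasi (R : Reg n c U V) (P : Pot n c U V yb w ψ) {q0 q1 : Euc n}
    (hq0 : q0 ∈ Uyset n c U yb) (hq1 : q1 ∈ Uyset n c U yb) {t : ℝ} (ht : t ∈ Icc (0:ℝ) 1) :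
    w (q0 + t • (q1 - q0)) ≤ max (w q0) (w q1) := by
  have hm := (R.Uy_convex P.hyb).add_smul_sub_mem hq0 hq1 ht
  obtain ⟨y, hy, e⟩ := P.att _ (Uy_sub _ hm)
  have h := R.mm_quasi P.hyb hy hq0 hq1 ht
  have a0 := P.le _ (Uy_sub _ hq0) y hy
  have a1 := P.le _ (Uy_sub _ hq1) y hy
  rcases le_max_iff.1 h with k | k
  · exact le_max_of_le_left (by linarith)
  · exact le_max_of_le_right (by linarith)

lemma Pot.convexQ (R : Reg n c U V) (P : Pot n c U V yb w ψ) {Q : Set (Euc n)}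
    (hQ : Q = {q ∈ clUy n c U yb | w q ≤ 0}) (hQU : Q ⊆ Uyset n c U yb) : Convex ℝ Q := by
  rw [convex_iff_segment_subset]
  intro p0 hp0 p1 hp1 p hp
  rw [segment_eq_image'] at hp
  obtain ⟨t, ht, rfl⟩ := hp
  have hm := (R.Uy_convex P.hyb).add_smul_sub_mem (hQU hp0) (hQU hp1) ht
  have h := P.w_quasi R (hQU hp0) (hQU hp1) ht
  rw [hQ] at hp0 hp1 ⊢
  exact ⟨Uy_sub _ hm, h.trans (max_le hp0.2 hp1.2)⟩

lemma Pot.P7 (R : Reg n c U V) (P : Pot n c U V yb w ψ) {Q : Set (Euc n)}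
    (hQ : Q = {q ∈ clUy n c U yb | w q ≤ 0}) (hQU : Q ⊆ Uyset n c U yb)
    (hfr : ∀ q ∈ frontier Q, w q = 0) {q0 y : Euc n} (hq0 : q0 ∈ Q) (h0 : w q0 < 0)
    (hy : y ∈ closure V) (hb : ∀ q ∈ Q, mm n c U yb q y - mm n c U yb q0 y ≤ -(w q0) / 2) :
    ∃ q ∈ Q, w q + ψ y = mm n c U yb q y := by
  obtain ⟨qs, hqs, es⟩ := P.att' y hy
  by_cases hqQ : qs ∈ Q
  · exact ⟨qs, hqQ, es⟩
  have hpos : 0 < w qs := by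
    by_contra hc; push Not at hc
    exact hqQ (hQ ▸ ⟨hqs, hc⟩)
  have hle := P.le q0 (Uy_sub _ (hQU hq0)) y hy
  rcases hle.eq_or_lt with heq | hlt
  · exact ⟨q0, hq0, heq.symm⟩
  exfalso
  set M := w q0 / 2 - mm n c U yb q0 y with hM
  have hmc : ContinuousOn (fun q => mm n c U yb q y) (clUy n c U yb) :=
    (R.mm_cont P.hyb).comp (f := fun q => (q, y)) (by fun_prop) (fun q hq => ⟨hq, hy⟩)
  have hM0 : w q0 - mm n c U yb q0 y < M := by rw [hM]; linarith
  have hMs : w qs - mm n c U yb qs y < M := by linarith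
  have hev1 : ∀ᶠ q in nhdsWithin qs (clUy n c U yb), 0 < w q :=
    (P.wc qs hqs).eventually_const_lt hpos
  have hev2 : ∀ᶠ q in nhdsWithin qs (clUy n c U yb), w q - mm n c U yb q y < M :=
    ((P.wc.sub hmc) qs hqs).eventually_lt_const hMs
  have hcl : qs ∈ closure (Uyset n c U yb) := by rw [← R.clUy_eq P.hyb]; exact hqs
  have := mem_closure_iff_nhdsWithin_neBot.1 hcl
  have hmono := nhdsWithin_mono qs (Uy_sub (n := n) (c := c) (U := U) yb)
  obtain ⟨q1, ⟨h1, h2⟩, h3⟩ := (((hev1.and hev2).filter_mono hmono).and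
    self_mem_nhdsWithin).exists
  obtain ⟨p, ⟨_, hp⟩, hpf⟩ := precon_frontier (P.conn y hy M) (t := Q)
    ⟨q0, ⟨hQU hq0, hM0⟩, hq0⟩ ⟨q1, ⟨h3, h2⟩, fun hh => by
      rw [hQ] at hh; exact absurd hh.2 (not_le.2 h1)⟩
  have hpQ : p ∈ Q := (P.closedQ R hQ).isClosed.frontier_subset hpf
  have := hb p hpQ
  rw [hfr p hpf] at hp
  linarith

end D4d



section D4e
variable {n : ℕ} {c : Euc n → Euc n → ℝ} {U V : Set (Euc n)} {yb : Euc n} {w ψ : Euc n → ℝ}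

lemma Reg.Gq_zero (R : Reg n c U V) {q y : Euc n} (hyb : yb ∈ closure V)
    (hq : q ∈ clUy n c U yb) (hy : y ∈ closure V) (h : Gq n c U V yb q y = 0) : y = yb := by
  obtain ⟨hx, _⟩ := R.x_memc hyb hq
  have h1 := R.GG_inv hx hyb y
  rw [show GG n c U V yb (xOf n c U yb q) y = 0 from h, map_zero] at h1
  refine (R.b1.2 _ hx).1 hy hyb ?_
  simp only [neg_inj]
  exact (sub_eq_zero.1 h1.symm)

lemma mm_self (q : Euc n) : mm n c U yb q yb = 0 := by simp [mm]

lemma Reg.mm_contq (R : Reg n c U V) (hyb : yb ∈ closure V) {y : Euc n} (hy : y ∈ closure V) :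
    ContinuousOn (fun q => mm n c U yb q y) (clUy n c U yb) :=
  (R.mm_cont hyb).comp (f := fun q => (q, y)) (by fun_prop) (fun _ hq => ⟨hq, hy⟩)

lemma Reg.mm_conty (R : Reg n c U V) (hyb : yb ∈ closure V) {q : Euc n} (hq : q ∈ clUy n c U yb) :
    ContinuousOn (fun y => mm n c U yb q y) (closure V) :=
  (R.mm_cont hyb).comp (f := fun y => (q, y)) (by fun_prop) (fun _ hy => ⟨hq, hy⟩)

lemma Reg.Gq_conty (R : Reg n c U V) (hyb : yb ∈ closure V) {q : Euc n} (hq : q ∈ clUy n c U yb) :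
    ContinuousOn (fun y => Gq n c U V yb q y) (closure V) :=
  (R.Gq_cont hyb).comp (f := fun y => (q, y)) (by fun_prop) (fun _ hy => ⟨hq, hy⟩)

/-- contact set -/
def Zset (n : ℕ) (c : Euc n → Euc n → ℝ) (U V : Set (Euc n)) (yb : Euc n) (w ψ : Euc n → ℝ)
    (q : Euc n) : Set (Euc n) := {y ∈ closure V | w q + ψ y = mm n c U yb q y}

lemma Pot.Z_compact (R : Reg n c U V) (P : Pot n c U V yb w ψ) {q : Euc n}
    (hq : q ∈ clUy n c U yb) : IsCompact (Zset n c U V yb w ψ q) := by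
  refine R.Vc_compact.of_isClosed_subset ?_ (sep_subset _ _)
  have h : ContinuousOn (fun y => w q + ψ y - mm n c U yb q y) (closure V) :=
    (continuousOn_const.add P.ψc).sub (R.mm_conty P.hyb hq)
  have := h.preimage_isClosed_of_isClosed isClosed_closure (isClosed_singleton (x := (0:ℝ)))
  convert this using 1
  ext y; simp [Zset, sub_eq_zero]

lemma Pot.Z_convex (R : Reg n c U V) (P : Pot n c U V yb w ψ) {q : Euc n}
    (hq : q ∈ Uyset n c U yb) : Convex ℝ ((fun y => Gq n c U V yb q y) '' Zset n c U V yb w ψ q) := by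
  have hqc := Uy_sub _ hq
  rw [convex_iff_segment_subset]
  rintro _ ⟨y0, ⟨hy0, e0⟩, rfl⟩ _ ⟨y1, ⟨hy1, e1⟩, rfl⟩ p hp
  rw [segment_eq_image] at hp
  obtain ⟨τ, hτ, rfl⟩ := hp
  obtain ⟨Y, _, _, _, hY⟩ := R.segq P.hyb hqc hy0 hy1
  obtain ⟨hYV, hYe⟩ := hY τ hτ
  refine ⟨Y τ, ⟨hYV, ?_⟩, hYe⟩
  have key : ∀ q' ∈ closure (Uyset n c U yb),
      mm n c U yb q' (Y τ) - w q' ≤ mm n c U yb q (Y τ) - w q := by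
    intro q' hq'
    refine le_on_closure (f := fun q' => mm n c U yb q' (Y τ) - w q')
      (g := fun _ => mm n c U yb q (Y τ) - w q) (s := Uyset n c U yb) ?_ ?_ continuousOn_const hq'
    · intro q' hq'
      have h := R.dasm P.hyb hq hq' hy0 hy1 hYV hτ hYe
      have a0 := P.le q' (Uy_sub _ hq') y0 hy0
      have a1 := P.le q' (Uy_sub _ hq') y1 hy1
      rcases le_max_iff.1 h with k | k <;> linarith
    · rw [← R.clUy_eq P.hyb]
      exact (R.mm_contq P.hyb hYV).sub P.wc
  obtain ⟨q', hq', e⟩ := P.att' _ hYV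
  have h1 := key q' (by rwa [← R.clUy_eq P.hyb])
  have h2 := P.le q hqc _ hYV
  linarith

/-- Danskin-type: if all contact directions have negative slope, the potential does not exceed -/
lemma Pot.danskin (R : Reg n c U V) (P : Pot n c U V yb w ψ) {q v : Euc n}
    (hq : q ∈ Uyset n c U yb) (hv : ∀ y ∈ Zset n c U V yb w ψ q, inner ℝ (Gq n c U V yb q y) v < 0) :
    ∃ s > (0:ℝ), q + s • v ∈ Uyset n c U yb ∧ w (q + s • v) ≤ w q := by
  by_contra hcon
  push Not at hcon
  obtain ⟨s0, hs0, hball⟩ : ∃ s0 > (0:ℝ), ∀ s ∈ Icc 0 s0, q + s • v ∈ Uyset n c U yb := by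
    have hc : ContinuousAt (fun s : ℝ => q + s • v) 0 := by fun_prop
    have : ∀ᶠ s in nhds (0:ℝ), q + s • v ∈ Uyset n c U yb :=
      hc.eventually_mem ((R.Uy_open P.hyb).mem_nhds (by simpa using hq))
    obtain ⟨δ, hδ, h⟩ := Metric.eventually_nhds_iff.1 this
    refine ⟨δ / 2, by positivity, fun s hs => h ?_⟩
    rw [Real.dist_eq, sub_zero, abs_of_nonneg hs.1]; linarith [hs.2]
  set D := Icc (0:ℝ) s0 ×ˢ closure V with hD
  have hmap : ContinuousOn (fun z : ℝ × Euc n => (q + z.1 • v, z.2)) D := by fun_prop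
  have hmaps : MapsTo (fun z : ℝ × Euc n => (q + z.1 • v, z.2)) D (clUy n c U yb ×ˢ closure V) :=
    fun z hz => ⟨Uy_sub _ (hball _ hz.1), hz.2⟩
  have c1 : ContinuousOn (fun z : ℝ × Euc n => w (q + z.1 • v) + ψ z.2 - mm n c U yb (q + z.1 • v) z.2) D :=
    ((P.wc.comp hmap.fst (fun z hz => (hmaps hz).1)).add
      (P.ψc.comp continuousOn_snd (fun z hz => hz.2))).sub ((R.mm_cont P.hyb).comp hmap hmaps)
  have c2 : ContinuousOn (fun z : ℝ × Euc n => inner ℝ (Gq n c U V yb (q + z.1 • v) z.2) v) D :=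
    ((R.Gq_cont P.hyb).comp hmap hmaps).inner continuousOn_const
  have hDc : IsCompact D := isCompact_Icc.prod R.Vc_compact
  have t1 := c1.preimage_isClosed_of_isClosed hDc.isClosed (isClosed_singleton (x := (0:ℝ)))
  have t2 := c2.preimage_isClosed_of_isClosed hDc.isClosed (isClosed_Ici (a := (0:ℝ)))
  have hT := (hDc.of_isClosed_subset (t1.inter t2) (fun z hz => hz.1.1)).image continuous_fst
  have hsub : Ioc 0 s0 ⊆ Prod.fst '' ((D ∩ (fun z : ℝ × Euc n =>
      w (q + z.1 • v) + ψ z.2 - mm n c U yb (q + z.1 • v) z.2) ⁻¹' {0}) ∩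
      (D ∩ (fun z : ℝ × Euc n => inner ℝ (Gq n c U V yb (q + z.1 • v) z.2) v) ⁻¹' Ici 0)) := by
    intro s hs
    have hs' : s ∈ Icc 0 s0 := Ioc_subset_Icc_self hs
    have hqs := hball s hs'
    obtain ⟨y, hy, e⟩ := P.att _ (Uy_sub _ hqs)
    have hgt := hcon s hs.1 hqs
    have hle := P.le q (Uy_sub _ hq) y hy
    refine ⟨(s, y), ⟨⟨⟨hs', hy⟩, ?_⟩, ⟨⟨hs', hy⟩, ?_⟩⟩, rfl⟩
    · simp [e]
    · change (0:ℝ) ≤ inner ℝ (Gq n c U V yb (q + s • v) y) v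
      by_contra hneg
      push Not at hneg
      have := R.pseudo P.hyb hy hqs hq (by
        rw [show q - (q + s • v) = (-s) • v by rw [neg_smul]; abel, inner_smul_right]
        exact mul_pos_of_neg_of_neg (by linarith [hs.1]) hneg)
      linarith
  have h0 : (0:ℝ) ∈ closure (Ioc 0 s0) := by
    rw [closure_Ioc hs0.ne]; exact ⟨le_rfl, hs0.le⟩
  have := closure_minimal hsub hT.isClosed h0
  obtain ⟨⟨s, y⟩, ⟨⟨hz, h1⟩, ⟨_, h2⟩⟩, hs⟩ := this
  simp only at hs
  subst hs
  have h1' : w (q + (0:ℝ) • v) + ψ y - mm n c U yb (q + (0:ℝ) • v) y = 0 := h1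
  have h2' : (0:ℝ) ≤ inner ℝ (Gq n c U V yb (q + (0:ℝ) • v) y) v := h2
  simp only [zero_smul, add_zero] at h1' h2'
  exact absurd (hv y ⟨hz.2, by linarith⟩) (not_lt.2 h2')

lemma Pot.P2 (R : Reg n c U V) (P : Pot n c U V yb w ψ) {Q : Set (Euc n)}
    (hQ : Q = {q ∈ clUy n c U yb | w q ≤ 0}) (hQU : Q ⊆ Uyset n c U yb) {q0 qp ν : Euc n}
    (hq0 : q0 ∈ Q) (h0 : w q0 < 0) (hν : ‖ν‖ = 1) (hqp : qp ∈ Q) (hwp : w qp = 0)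
    (hmax : ∀ q ∈ Q, inner ℝ ν q ≤ inner ℝ ν qp) :
    ∃ y ∈ closure V, w qp + ψ y = mm n c U yb qp y ∧ ∃ l : ℝ, Gq n c U V yb qp y = l • ν ∧ 0 < l := by
  have hqpD := hQU hqp
  have hqpc := Uy_sub _ hqpD
  set Z := Zset n c U V yb w ψ qp with hZ
  set K := (fun y => Gq n c U V yb qp y) '' Z with hK
  have hKc : IsCompact K := (P.Z_compact R hqpc).image_of_continuousOn
    ((R.Gq_conty P.hyb hqpc).mono (sep_subset _ _))
  have hKv : Convex ℝ K := P.Z_convex R hqpD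
  have h0K : (0 : Euc n) ∉ K := by
    rintro ⟨y, ⟨hy, e⟩, hG⟩
    have hyy := R.Gq_zero P.hyb hqpc hy hG
    subst hyy
    rw [mm_self, hwp] at e
    have := P.le q0 (Uy_sub _ (hQU hq0)) y hy
    rw [mm_self] at this
    linarith
  by_contra hcon
  set ray := (fun l : ℝ => l • ν) '' Ici 0 with hray
  have hdisj : Disjoint K ray := by
    rw [Set.disjoint_left]
    rintro _ ⟨y, hy, rfl⟩ ⟨l, hl, e⟩
    refine hcon ⟨y, hy.1, hy.2, l, e.symm, ?_⟩
    rcases (show (0:ℝ) ≤ l from hl).eq_or_lt with h | h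
    · exfalso; apply h0K
      refine ⟨y, hy, ?_⟩
      rw [← e, ← h]; simp
    · exact h
  have hrc : Convex ℝ ray := (convex_Ici 0).is_linear_image (IsLinearMap.mk (fun a b => add_smul a b ν)
    (fun a b => by simp [mul_smul]))
  have hrcl : IsClosed ray := by
    have : Topology.IsClosedEmbedding (fun l : ℝ => l • ν) := by
      refine Isometry.isClosedEmbedding (Isometry.of_dist_eq fun a b => ?_)
      rw [dist_eq_norm, ← sub_smul, norm_smul, hν, mul_one, dist_eq_norm]
    exact this.isClosedMap _ isClosed_Ici
  obtain ⟨f, a, b, hfa, hab, hfb⟩ := geometric_hahn_banach_compact_closed hKv hKc hrc hrcl hdisj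
  have hb0 : b < 0 := by simpa using hfb 0 ⟨0, by simp, by simp⟩
  have hfν : 0 ≤ f ν := by
    by_contra hneg
    push Not at hneg
    have h := hfb ((b / f ν) • ν) ⟨b / f ν, (by
      exact (div_nonneg_of_nonpos hb0.le hneg.le)), rfl⟩
    rw [map_smul, smul_eq_mul, div_mul_cancel₀ _ hneg.ne] at h
    exact lt_irrefl _ h
  set v0 := (InnerProductSpace.toDual ℝ (Euc n)).symm f with hv0
  have hfv : ∀ x, f x = inner ℝ x v0 := fun x => by
    rw [real_inner_comm, hv0, InnerProductSpace.toDual_symm_apply]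
  obtain ⟨M, hM⟩ := hKc.isBounded.exists_norm_le
  set t := -a / (2 * (|M| + 1)) with ht
  have ha : a < 0 := hab.trans hb0
  have htp : 0 < t := div_pos (by linarith) (by positivity)
  have htM : t * |M| < -a := by
    rw [ht, div_mul_eq_mul_div, div_lt_iff₀ (by positivity)]
    nlinarith [abs_nonneg M]
  obtain ⟨s, hs, hsD, hsw⟩ := P.danskin R (v := v0 + t • ν) hqpD (by
    intro y hy
    rw [inner_add_right, inner_smul_right]
    have h1 := hfa _ (mem_image_of_mem (fun y => Gq n c U V yb qp y) hy)
    rw [hfv] at h1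
    have h2 : inner ℝ (Gq n c U V yb qp y) ν ≤ |M| := by
      refine (real_inner_le_norm _ _).trans ?_
      rw [hν, mul_one]
      exact (hM _ (mem_image_of_mem (fun y => Gq n c U V yb qp y) hy)).trans (le_abs_self _)
    have h3 := mul_le_mul_of_nonneg_left h2 htp.le
    linarith)
  have hmem : qp + s • (v0 + t • ν) ∈ Q := by
    rw [hQ]; exact ⟨Uy_sub _ hsD, by linarith⟩
  have := hmax _ hmem
  rw [inner_add_right, inner_smul_right, inner_add_right, inner_smul_right,
    real_inner_self_eq_norm_sq, hν, ← hfv] at this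
  have : 0 < s * (f ν + t * 1 ^ 2) := by positivity
  linarith

lemma Pot.P4 (R : Reg n c U V) (P : Pot n c U V yb w ψ) {Q : Set (Euc n)}
    (hQ : Q = {q ∈ clUy n c U yb | w q ≤ 0}) (hQU : Q ⊆ Uyset n c U yb)
    (hfr : ∀ q ∈ frontier Q, w q = 0) {z : Euc n} {r : ℝ} (hQB : Q ⊆ ball z r)
    (hB4 : ball z (4 * r) ⊆ Uyset n c U yb) {η εF : ℝ} (hη : 0 < η) (hεF : 0 < εF)
    (hF : ∀ y ∈ closure V, ∀ q ∈ clUy n c U yb, ∀ q' ∈ clUy n c U yb, ‖q - q'‖ ≤ εF →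
      ‖Gq n c U V yb q y - Gq n c U V yb q' y‖ ≤ η * ‖Gq n c U V yb q' y‖)
    (hdiam : Metric.diam Q ≤ εF / 4) {q0 ν : Euc n}
    (hq0 : q0 ∈ Q) (h0 : w q0 < 0) (hν : ‖ν‖ = 1) {d : ℝ} (hd : ∀ q ∈ Q, inner ℝ ν (q - q0) ≤ d) :
    ∃ y ∈ closure V, (∀ q ∈ Q, mm n c U yb q y - mm n c U yb q0 y ≤ -(w q0) / 2) ∧
      ∃ l : ℝ, 0 < l ∧ ‖Gq n c U V yb q0 y - l • ν‖ ≤ η * l ∧ -(w q0) / 2 ≤ d * ((1 + η) * l) := by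
  have hQc := P.closedQ R hQ
  obtain ⟨qp, hqp, hmax⟩ := hQc.exists_isMaxOn ⟨q0, hq0⟩
    (f := fun q => inner ℝ ν q) (by fun_prop)
  have hmax' : ∀ q ∈ Q, inner ℝ ν q ≤ inner ℝ ν qp := fun q hq => hmax hq
  have hqpf : qp ∈ frontier Q := by
    refine ⟨subset_closure hqp, fun hi => ?_⟩
    have hc : ContinuousAt (fun s : ℝ => qp + s • ν) 0 := by fun_prop
    have : ∀ᶠ s in nhds (0:ℝ), qp + s • ν ∈ Q :=
      hc.eventually_mem (by simpa using mem_interior_iff_mem_nhds.1 hi)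
    obtain ⟨δ, hδ, h⟩ := Metric.eventually_nhds_iff.1 this
    have h1 := hmax' _ (h (y := δ / 2) (by rw [Real.dist_eq, sub_zero, abs_of_pos] <;> linarith))
    rw [inner_add_right, inner_smul_right, real_inner_self_eq_norm_sq, hν] at h1
    linarith
  have hwp := hfr qp hqpf
  have hqpc := Uy_sub _ (hQU hqp)
  have hq0c := Uy_sub _ (hQU hq0)
  obtain ⟨yp, hyp, ep, l1, hl1, hl1p⟩ := P.P2 R hQ hQU hq0 h0 hν hqp hwp hmax'
  obtain ⟨Y, Y0, Y1, hYc, hY⟩ := R.segq P.hyb hqpc P.hyb hyp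
  have hφ : ContinuousOn (fun τ => mm n c U yb q0 (Y τ) - mm n c U yb qp (Y τ)) (Icc 0 1) :=
    ((R.mm_conty P.hyb hq0c).comp hYc (fun τ hτ => (hY τ hτ).1)).sub
      ((R.mm_conty P.hyb hqpc).comp hYc (fun τ hτ => (hY τ hτ).1))
  have hle1 := P.le q0 hq0c yp hyp
  obtain ⟨τ, hτ, hτe⟩ := intermediate_value_Icc' zero_le_one hφ
    (show w q0 / 2 ∈ Icc _ _ by
      simp only [Y0, Y1, mm_self]
      constructor <;> linarith)
  obtain ⟨hyV, hyG⟩ := hY τ hτ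
  set y := Y τ with hy
  simp only [← hy] at hτe
  have hG : Gq n c U V yb qp y = (τ * l1) • ν := by
    rw [hyG, hl1, show Gq n c U V yb qp yb = 0 from GG_self _ _, smul_zero, zero_add, smul_smul]
  have hlpos : 0 < τ * l1 := by
    rcases hτ.1.eq_or_lt with h | h
    · exfalso
      rw [hy, ← h, Y0, mm_self, mm_self] at hτe
      linarith
    · positivity
  set l := τ * l1 with hl
  have hGn : ‖Gq n c U V yb qp y‖ = l := by
    rw [hG, norm_smul, hν, mul_one, Real.norm_eq_abs, abs_of_pos hlpos]
  have hdist : ∀ p ∈ Q, ∀ p' ∈ Q, ‖p - p'‖ ≤ εF / 4 := fun p hp p' hp' => by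
    rw [← dist_eq_norm]; exact (dist_le_diam_of_mem hQc.isBounded hp hp').trans hdiam
  refine ⟨y, hyV, ?_, l, hlpos, ?_, ?_⟩
  · intro q hq
    have h := R.dasm P.hyb (hQU hqp) (hQU hq) P.hyb hyp hyV hτ hyG
    have a1 := P.le q (Uy_sub _ (hQU hq)) yp hyp
    have hwq : w q ≤ 0 := by rw [hQ] at hq; exact hq.2
    simp only [mm_self] at h
    rcases le_max_iff.1 h with k | k <;> linarith
  · have := hF y hyV q0 hq0c qp hqpc ((hdist _ hq0 _ hqp).trans (by linarith))
    rw [hGn, hG] at this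
    exact this
  · set d0 : ℝ := inner ℝ ν (qp - q0) with hd0
    have hd0d : d0 ≤ d := hd qp hqp
    have hd0n : 0 ≤ d0 := by
      have := hmax' q0 hq0
      rw [hd0, inner_sub_right]; linarith
    have hd0q : d0 ≤ ‖qp - q0‖ := (real_inner_le_norm _ _).trans (by rw [hν, one_mul])
    have hd0e : d0 ≤ εF / 4 := hd0q.trans (hdist _ hqp _ hq0)
    have hrq0 : ‖q0 - z‖ < r := by simpa [dist_eq_norm] using hQB hq0
    have hrqp : ‖qp - z‖ < r := by simpa [dist_eq_norm] using hQB hqp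
    have hr : 0 < r := (norm_nonneg _).trans_lt hrq0
    have hd0r : d0 < 2 * r := by
      have : ‖qp - q0‖ ≤ ‖qp - z‖ + ‖q0 - z‖ := by
        rw [show qp - q0 = (qp - z) - (q0 - z) by abel]; exact norm_sub_le _ _
      linarith
    have key : ∀ ε > 0, ε ≤ r → ε ≤ εF / 4 → -(w q0) / 2 ≤ (d0 + ε) * ((1 + η) * l) := by
      intro ε hε hεr hεe
      set q2 := q0 + (d0 + ε) • ν with hq2
      have hn2 : ‖q2 - q0‖ = d0 + ε := by
        rw [hq2, add_sub_cancel_left, norm_smul, hν, mul_one, Real.norm_eq_abs,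
          abs_of_nonneg (by linarith)]
      have hq2D : q2 ∈ Uyset n c U yb := hB4 (by
        rw [mem_ball, dist_eq_norm, show q2 - z = (q2 - q0) + (q0 - z) by abel]
        refine (norm_add_le _ _).trans_lt ?_
        linarith)
      have hps := R.pseudo P.hyb hyV (hQU hqp) hq2D (by
        rw [hG, inner_smul_left, hq2, show q0 + (d0 + ε) • ν - qp = (d0 + ε) • ν - (qp - q0) by abel,
          inner_sub_right, inner_smul_right, real_inner_self_eq_norm_sq, hν, ← hd0]
        simp only [conj_trivial]
        nlinarith)
      have hseg : segment ℝ q0 q2 ⊆ Uyset n c U yb := (R.Uy_convex P.hyb).segment_subset (hQU hq0) hq2D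
      have hmv := (convex_segment q0 q2).norm_image_sub_le_of_norm_hasFDerivWithin_le
        (f := fun q => mm n c U yb q y) (C := (1 + η) * l)
        (fun q hq => (R.mm_deriv P.hyb hyV (hseg hq)).hasFDerivWithinAt) (fun q hq => by
          rw [innerSL_apply_norm]
          have hqq : ‖q - qp‖ ≤ εF := by
            have a1 : ‖q - q0‖ ≤ ‖q2 - q0‖ := by
              rw [segment_eq_image'] at hq
              obtain ⟨t, ht, rfl⟩ := hq
              rw [add_sub_cancel_left, norm_smul, Real.norm_eq_abs, abs_of_nonneg ht.1]
              exact mul_le_of_le_one_left (norm_nonneg _) ht.2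
            have a2 := hdist _ hq0 _ hqp
            have a3 : ‖q - qp‖ ≤ ‖q - q0‖ + ‖q0 - qp‖ := by
              rw [show q - qp = (q - q0) + (q0 - qp) by abel]; exact norm_add_le _ _
            linarith
          have := hF y hyV q (Uy_sub _ (hseg hq)) qp hqpc hqq
          rw [hGn] at this
          have h3 : ‖Gq n c U V yb q y‖ ≤ ‖Gq n c U V yb qp y‖ +
              ‖Gq n c U V yb q y - Gq n c U V yb qp y‖ := by
            conv_lhs => rw [show Gq n c U V yb q y = Gq n c U V yb qp y +
              (Gq n c U V yb q y - Gq n c U V yb qp y) by abel]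
            exact norm_add_le _ _
          rw [hGn] at h3
          linarith)
        (left_mem_segment ℝ q0 q2) (right_mem_segment ℝ q0 q2)
      rw [hn2] at hmv
      have h4 := (le_abs_self _).trans hmv
      linarith
    have hX : 0 < (1 + η) * l := by positivity
    have : -(w q0) / 2 ≤ d0 * ((1 + η) * l) := by
      refine le_of_forall_pos_le_add fun ε hε => ?_
      have := key (min (ε / ((1 + η) * l)) (min r (εF / 4))) (by positivity)
        ((min_le_right _ _).trans (min_le_left _ _)) ((min_le_right _ _).trans (min_le_right _ _))
      have h2 : min (ε / ((1 + η) * l)) (min r (εF / 4)) * ((1 + η) * l) ≤ ε := by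
        calc _ ≤ ε / ((1 + η) * l) * ((1 + η) * l) := by gcongr; exact min_le_left _ _
          _ = ε := div_mul_cancel₀ _ hX.ne'
      rw [add_mul] at this
      linarith
    exact this.trans (by gcongr)

end D4e



section D4f
variable {n : ℕ} {c : Euc n → Euc n → ℝ} {U V : Set (Euc n)} {yb : Euc n} {w ψ : Euc n → ℝ}

lemma det_adj (T : Euc n →L[ℝ] Euc n) : (ContinuousLinearMap.adjoint T).det = T.det := by
  have h := LinearMap.toMatrix_adjoint (EuclideanSpace.basisFun (Fin n) ℝ)
    (EuclideanSpace.basisFun (Fin n) ℝ) (T : Euc n →ₗ[ℝ] Euc n)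
  have h2 := congrArg Matrix.det h
  rw [Matrix.det_conjTranspose, LinearMap.det_toMatrix, LinearMap.det_toMatrix] at h2
  exact h2

lemma Reg.DxyC_mod (R : Reg n c U V) (hyb : yb ∈ closure V) {q y : Euc n}
    (hq : q ∈ Uyset n c U yb) (hy : y ∈ closure V) :
    DxyC n (modCost n c U yb) q y =
      (AA n c U V (xOf n c U yb q) y).comp (-NN n c U V (xOf n c U yb q) yb) := by
  obtain ⟨hx, e⟩ := R.x_mem hyb hq
  have h : (fun q' => gradY n (modCost n c U yb) q' y) = fun q' => gradY n c (xOf n c U yb q') y := by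
    funext q'
    simp only [gradY, gradient, modCost]
    rw [fderiv_sub_const]
  rw [DxyC, h]
  exact (((R.dYX _ (subset_closure hx) y hy).hasFDerivAt (R.nU hx)).comp q
    (R.x_deriv hyb hq)).fderiv

lemma Reg.gamma_bdd (R : Reg n c U V) (hyb : yb ∈ closure V) {Q : Set (Euc n)}
    (hQU : Q ⊆ Uyset n c U yb) :
    BddAbove ((fun p : Euc n × Euc n =>
    |LinearMap.det ((DxyC n (modCost n c U yb) p.1 p.2 : Euc n →L[ℝ] Euc n) : Euc n →ₗ[ℝ] Euc n)|) ''
      (Q ×ˢ V)) := by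
  have hK := R.Uc_compact.prod R.Vc_compact
  obtain ⟨a, ha⟩ := hK.exists_bound_of_continuousOn
    (ContinuousLinearMap.continuous_det.comp_continuousOn R.Ac)
  obtain ⟨b, hb⟩ := hK.exists_bound_of_continuousOn
    (ContinuousLinearMap.continuous_det.comp_continuousOn R.Nc)
  refine ⟨a * b, ?_⟩
  rintro _ ⟨⟨q, y⟩, ⟨hq, hy⟩, rfl⟩
  simp only
  rw [R.DxyC_mod hyb (hQU hq) (subset_closure hy)]
  obtain ⟨hx, e⟩ := R.x_mem hyb (hQU hq)
  have h1 := ha (_, y) ⟨subset_closure hx, subset_closure hy⟩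
  have h2 := hb (_, yb) ⟨subset_closure hx, hyb⟩
  rw [ContinuousLinearMap.toLinearMap_comp, LinearMap.det_comp, abs_mul]
  rw [show (((-NN n c U V (xOf n c U yb q) yb : Euc n →L[ℝ] Euc n)) : Euc n →ₗ[ℝ] Euc n) =
    (-1 : ℝ) • ((NN n c U V (xOf n c U yb q) yb : Euc n →L[ℝ] Euc n) : Euc n →ₗ[ℝ] Euc n) by
      ext; simp, LinearMap.det_smul, abs_mul, abs_pow, abs_neg, abs_one, one_pow, one_mul]
  exact mul_le_mul h1 h2 (abs_nonneg _) ((norm_nonneg _).trans h1)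

lemma Reg.Gq_deriv (R : Reg n c U V) (hyb : yb ∈ closure V) {q y : Euc n}
    (hq : q ∈ Uyset n c U yb) (hy : y ∈ V) :
    HasFDerivAt (fun y => Gq n c U V yb q y)
      ((NT n c U V (xOf n c U yb q) yb).comp (AT n c U V (xOf n c U yb q) y)) y := by
  obtain ⟨hx, e⟩ := R.x_mem hyb hq
  have h := ((R.dXY _ (subset_closure hx) y (subset_closure hy)).hasFDerivAt (R.nV hy))
  exact (NT n c U V (xOf n c U yb q) yb).hasFDerivAt.comp y (h.sub_const _)

lemma Reg.Gq_det (R : Reg n c U V) (hyb : yb ∈ closure V) {q y : Euc n} {Q : Set (Euc n)}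
    (hQU : Q ⊆ Uyset n c U yb)
    (hq : q ∈ Q) (hy : y ∈ V) :
    |((NT n c U V (xOf n c U yb q) yb).comp (AT n c U V (xOf n c U yb q) y)).det| ≤
      gammaPlus n (modCost n c U yb) Q V := by
  refine le_csSup_of_le (R.gamma_bdd hyb hQU) (mem_image_of_mem _ (show (q, y) ∈ Q ×ˢ V from ⟨hq, hy⟩)) ?_
  simp only
  rw [R.DxyC_mod hyb (hQU hq) (subset_closure hy)]
  have : (NT n c U V (xOf n c U yb q) yb).comp (AT n c U V (xOf n c U yb q) y) =
    ContinuousLinearMap.adjoint ((AA n c U V (xOf n c U yb q) y).comp (NN n c U V (xOf n c U yb q) yb)) := by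
    rw [ContinuousLinearMap.adjoint_comp]; rfl
  rw [this, det_adj]
  rw [show (((AA n c U V (xOf n c U yb q) y).comp (-NN n c U V (xOf n c U yb q) yb) : Euc n →L[ℝ] Euc n) : Euc n →ₗ[ℝ] Euc n) =
    (-1 : ℝ) • (((AA n c U V (xOf n c U yb q) y).comp (NN n c U V (xOf n c U yb q) yb) : Euc n →L[ℝ] Euc n) : Euc n →ₗ[ℝ] Euc n) by
      ext; simp, LinearMap.det_smul, abs_mul, abs_pow, abs_neg, abs_one, one_pow, one_mul]

lemma Reg.bdry_null (R : Reg n c U V) (hyb : yb ∈ closure V) {q : Euc n}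
    (hq : q ∈ Uyset n c U yb) :
    volume ((fun y => Gq n c U V yb q y) '' (closure V \ V)) = 0 := by
  obtain ⟨hx, e⟩ := R.x_mem hyb hq
  set x := xOf n c U yb q with hxd
  have hxc := subset_closure hx
  have hdf := R.b1.2 x hxc
  have hsub : (fun y => -gradX n c x y) '' (closure V \ V) ⊆ frontier (Vxset n c V x) := by
    have hop : IsOpen (Vxset n c V x) := diffeo_isOpen R.Vo hdf
    rw [hop.frontier_eq]
    rintro _ ⟨y, ⟨hy, hyV⟩, rfl⟩
    refine ⟨?_, ?_⟩
    · rw [Vxset, ← diffeo_image_closure R.Vb hdf]; exact mem_image_of_mem _ hy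
    · rintro ⟨y', hy', e'⟩
      exact hyV (hdf.1 (subset_closure hy') hy e' ▸ hy')
  have hnull : volume ((fun y => -gradX n c x y) '' (closure V \ V)) = 0 :=
    measure_mono_null hsub ((R.b2.2 x hxc).addHaar_frontier volume)
  have hdiff : DifferentiableOn ℝ (fun p => NT n c U V x yb (-p - gradX n c x yb))
      ((fun y => -gradX n c x y) '' (closure V \ V)) := by
    have : Differentiable ℝ (fun p => NT n c U V x yb (-p - gradX n c x yb)) := by fun_prop
    exact this.differentiableOn
  have := addHaar_image_eq_zero_of_differentiableOn_of_addHaar_eq_zero volume hdiff hnull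
  rw [image_image] at this
  simpa [Gq, GG] using this

/-- half-height set -/
def Y12 (n : ℕ) (c : Euc n → Euc n → ℝ) (U V : Set (Euc n)) (yb : Euc n) (Q : Set (Euc n))
    (q0 : Euc n) (h : ℝ) : Set (Euc n) :=
  {y ∈ closure V | ∀ q ∈ Q, mm n c U yb q y - mm n c U yb q0 y ≤ h}

lemma Reg.Y12_closed (R : Reg n c U V) (hyb : yb ∈ closure V) {Q : Set (Euc n)}
    (hQU : Q ⊆ Uyset n c U yb) {q0 : Euc n} (hq0 : q0 ∈ Q) (h : ℝ) :
    IsClosed (Y12 n c U V yb Q q0 h) := by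
  have : Y12 n c U V yb Q q0 h = closure V ∩ ⋂ q ∈ Q,
      (closure V ∩ (fun y => mm n c U yb q y - mm n c U yb q0 y) ⁻¹' Iic h) := by
    ext y; simp only [Y12, mem_inter_iff, mem_iInter, mem_preimage, mem_Iic]
    constructor
    · rintro ⟨h1, h2⟩; exact ⟨h1, fun q hq => ⟨h1, h2 q hq⟩⟩
    · rintro ⟨h1, h2⟩; exact ⟨h1, fun q hq => (h2 q hq).2⟩
  rw [this]
  refine isClosed_closure.inter (isClosed_biInter fun q hq => ?_)
  exact ((R.mm_conty hyb (Uy_sub _ (hQU hq))).sub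
    (R.mm_conty hyb (Uy_sub _ (hQU hq0)))).preimage_isClosed_of_isClosed isClosed_closure isClosed_Iic

lemma Reg.P6 (R : Reg n c U V) (hyb : yb ∈ closure V) {Q : Set (Euc n)}
    (hQU : Q ⊆ Uyset n c U yb) {q0 : Euc n} (hq0 : q0 ∈ Q) (h : ℝ) :
    volume ((fun y => Gq n c U V yb q0 y) '' Y12 n c U V yb Q q0 h) ≤
      ENNReal.ofReal (gammaPlus n (modCost n c U yb) Q V) * volume (Y12 n c U V yb Q q0 h) := by
  set Y := Y12 n c U V yb Q q0 h with hY
  have hcl := R.Y12_closed hyb hQU hq0 h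
  have hsub : Y ⊆ (Y ∩ V) ∪ (closure V \ V) := fun y hy => by
    by_cases hv : y ∈ V
    · exact Or.inl ⟨hy, hv⟩
    · exact Or.inr ⟨hy.1, hv⟩
  have hms : MeasurableSet (Y ∩ V) := hcl.measurableSet.inter R.Vo.measurableSet
  calc _ ≤ volume ((fun y => Gq n c U V yb q0 y) '' ((Y ∩ V) ∪ (closure V \ V))) :=
        measure_mono (image_mono hsub)
    _ ≤ volume ((fun y => Gq n c U V yb q0 y) '' (Y ∩ V)) + 0 := by
        rw [image_union, ← R.bdry_null hyb (hQU hq0)]; exact measure_union_le _ _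
    _ ≤ ∫⁻ y in Y ∩ V, ENNReal.ofReal
          |((NT n c U V (xOf n c U yb q0) yb).comp (AT n c U V (xOf n c U yb q0) y)).det| := by
        rw [add_zero]
        exact addHaar_image_le_lintegral_abs_det_fderiv volume hms
          (fun y hy => (R.Gq_deriv hyb (hQU hq0) hy.2).hasFDerivWithinAt)
    _ ≤ ∫⁻ y in Y ∩ V, ENNReal.ofReal (gammaPlus n (modCost n c U yb) Q V) :=
        setLIntegral_mono' hms (fun y hy => ENNReal.ofReal_le_ofReal (R.Gq_det hyb hQU hq0 hy.2))
    _ = ENNReal.ofReal (gammaPlus n (modCost n c U yb) Q V) * volume (Y ∩ V) := by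
        rw [setLIntegral_const]
    _ ≤ _ := by gcongr; exact inter_subset_left

lemma Reg.P5 (R : Reg n c U V) (hyb : yb ∈ closure V) {Q : Set (Euc n)}
    (hQU : Q ⊆ Uyset n c U yb) {q0 : Euc n} (hq0 : q0 ∈ Q) {h : ℝ} (hh : 0 ≤ h) :
    Convex ℝ ((fun y => Gq n c U V yb q0 y) '' Y12 n c U V yb Q q0 h) ∧
    (0 : Euc n) ∈ ((fun y => Gq n c U V yb q0 y) '' Y12 n c U V yb Q q0 h) := by
  constructor
  · rw [convex_iff_segment_subset]
    rintro _ ⟨y0, ⟨hy0, e0⟩, rfl⟩ _ ⟨y1, ⟨hy1, e1⟩, rfl⟩ p hp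
    rw [segment_eq_image] at hp
    obtain ⟨τ, hτ, rfl⟩ := hp
    obtain ⟨Y, _, _, _, hY⟩ := R.segq hyb (Uy_sub _ (hQU hq0)) hy0 hy1
    obtain ⟨hYV, hYe⟩ := hY τ hτ
    refine ⟨Y τ, ⟨hYV, fun q hq => ?_⟩, hYe⟩
    have := R.dasm hyb (hQU hq0) (hQU hq) hy0 hy1 hYV hτ hYe
    exact this.trans (max_le (e0 q hq) (e1 q hq))
  · refine ⟨yb, ⟨hyb, fun q hq => ?_⟩, GG_self _ _⟩
    rw [mm_self, mm_self]; simpa using hh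

/-- volume of a convex set containing `0` and given points -/
lemma vol_parallel (hn : 0 < n) {S : Set (Euc n)} (hS : Convex ℝ S) (h0 : (0 : Euc n) ∈ S)
    {p : Fin n → Euc n} (hp : ∀ i, p i ∈ S) :
    ENNReal.ofReal (|(EuclideanSpace.basisFun (Fin n) ℝ).toBasis.det p| / n ^ n) ≤ volume S := by
  have hn' : (0:ℝ) < n := by exact_mod_cast hn
  have hsub : parallelepiped (fun i => (1 / n : ℝ) • p i) ⊆ S := by
    intro x hx
    rw [mem_parallelepiped_iff] at hx
    obtain ⟨t, ht, rfl⟩ := hx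
    have ht' : ∀ i, 0 ≤ t i ∧ t i ≤ 1 := fun i => ⟨ht.1 i, ht.2 i⟩
    have hsum : ∑ i, t i / n ≤ 1 := by
      calc ∑ i, t i / n ≤ ∑ i : Fin n, (1 / n : ℝ) :=
            Finset.sum_le_sum fun i _ => by gcongr; exact (ht' i).2
        _ = 1 := by simp [hn'.ne']
    have hmem := hS.sum_mem (t := Finset.univ) (w := fun o : Option (Fin n) =>
        o.elim (1 - ∑ i, t i / n) (fun i => t i / n)) (z := fun o => o.elim 0 p) (by
          rintro (_ | i) _
          · simpa using hsum
          · simpa using div_nonneg (ht' i).1 hn'.le) (by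
          rw [Fintype.sum_option]; simp) (by
          rintro (_ | i) _
          · simpa using h0
          · simpa using hp i)
    rw [Fintype.sum_option] at hmem
    simp only [Option.elim, smul_zero, zero_add] at hmem
    convert hmem using 2 with i
    rw [smul_smul]; congr 1; ring
  refine le_trans (le_of_eq ?_) (measure_mono hsub)
  rw [← (EuclideanSpace.basisFun (Fin n) ℝ).addHaar_eq_volume, Measure.addHaar_parallelepiped,
    (EuclideanSpace.basisFun (Fin n) ℝ).toBasis.det.map_smul_univ (fun _ => (1 / n : ℝ)) p]
  congr 1
  simp [abs_mul, abs_of_pos, hn', div_eq_inv_mul]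

lemma det_pert (hn : 0 < n) : ∃ η : ℝ, 0 < η ∧ η ≤ 1 ∧ ∀ ν e : Fin n → Euc n, (∀ i, ‖ν i‖ = 1) →
    (∀ i, ‖e i‖ ≤ η) → 1 / √n ≤ |(EuclideanSpace.basisFun (Fin n) ℝ).toBasis.det ν| →
    1 / (2 * √n) ≤ |(EuclideanSpace.basisFun (Fin n) ℝ).toBasis.det (fun i => ν i + e i)| := by
  set f : (Fin n → Euc n) → ℝ := fun v => (EuclideanSpace.basisFun (Fin n) ℝ).toBasis.det v with hf
  have hfc : Continuous f := by
    have : f = fun v => Matrix.det (Matrix.of fun i j => v j i) := by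
      funext v
      rw [hf]; simp only [Module.Basis.det_apply]
      congr 1
    rw [this]
    refine Continuous.matrix_det ?_
    refine continuous_pi fun i => continuous_pi fun j => ?_
    simp only [Matrix.of_apply]
    fun_prop
  have hn' : (0:ℝ) < n := by exact_mod_cast hn
  have hK : IsCompact (closedBall (0 : Fin n → Euc n) 2) := isCompact_closedBall _ _
  obtain ⟨δ, hδ, h⟩ := Metric.uniformContinuousOn_iff.1
    (hK.uniformContinuousOn_of_continuous hfc.continuousOn) (1 / (2 * √n)) (by positivity)
  refine ⟨min 1 (δ / 2), by positivity, min_le_left _ _, fun ν e hν he hdet => ?_⟩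
  have hν0 : ν ∈ closedBall (0 : Fin n → Euc n) 2 := by
    rw [mem_closedBall_zero_iff, pi_norm_le_iff_of_nonneg (by norm_num)]
    intro i; rw [hν i]; norm_num
  have hν1 : (fun i => ν i + e i) ∈ closedBall (0 : Fin n → Euc n) 2 := by
    rw [mem_closedBall_zero_iff, pi_norm_le_iff_of_nonneg (by norm_num)]
    intro i
    have := (he i).trans (min_le_left _ _)
    have := norm_add_le (ν i) (e i)
    have := hν i
    linarith
  have hd : dist (fun i => ν i + e i) ν < δ := by
    rw [dist_pi_lt_iff hδ]
    intro i
    rw [dist_eq_norm, add_sub_cancel_left]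
    have := (he i).trans (min_le_right _ _)
    linarith
  have := h _ hν1 _ hν0 hd
  rw [Real.dist_eq] at this
  have h2 := abs_sub_abs_le_abs_sub (f ν) (f fun i => ν i + e i)
  rw [abs_sub_comm] at h2
  have h3 : 1 / √n = 1 / (2 * √n) + 1 / (2 * √n) := by field_simp; norm_num
  have h4 : 1 / √n ≤ |f ν| := hdet
  change _ ≤ |f fun i => ν i + e i|
  linarith

end D4f



section D4g

/-- core estimate -/
theorem core_est {n : ℕ} (hn : 0 < n) : ∃ C0 : ℝ, 0 < C0 ∧ ∀ (c : Euc n → Euc n → ℝ) (U V : Set (Euc n)),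
    Reg n c U V → ∃ ε > (0:ℝ), ∀ (yb : Euc n) (w : Euc n → ℝ) (lam : ℝ) (Q : Set (Euc n))
      (_ : Pot n c U V yb w (cStarT n (modCost n c U yb) (clUy n c U yb) w))
      (_ : 0 < lam) (_ : Q = {q ∈ clUy n c U yb | w q ≤ 0}) (_ : Q ⊆ Uyset n c U yb)
      (_ : MAle n (modCost n c U yb) (clUy n c U yb) (closure V) w (1 / lam) Q)
      (_ : ∀ q ∈ frontier Q, w q = 0)
      (_ : ∃ z r, 0 < r ∧ Q ⊆ Metric.ball z r ∧ Metric.ball z (4 * r) ⊆ Uyset n c U yb)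
      (_ : Metric.diam Q ≤ ε) (q0 : Euc n) (_ : q0 ∈ Q) (_ : w q0 < 0)
      (ν : Fin n → Euc n) (_ : ∀ i, ‖ν i‖ = 1)
      (_ : 1 / √n ≤ |(EuclideanSpace.basisFun (Fin n) ℝ).toBasis.det ν|)
      (d : Fin n → ℝ) (_ : ∀ i, ∀ q ∈ Q, inner ℝ (ν i) (q - q0) ≤ d i),
      0 < gammaPlus n (modCost n c U yb) Q V ∧ (∀ i, 0 < d i) ∧
      (-w q0) ^ n ≤ C0 * (gammaPlus n (modCost n c U yb) Q V / lam) * (∏ i, d i) *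
        (volume Q).toReal := by
  obtain ⟨η, hη, hη1, hdet⟩ := det_pert hn
  have hn' : (0:ℝ) < n := by exact_mod_cast hn
  refine ⟨(4 * n) ^ n * (2 * √n), by positivity, fun c U V R => ?_⟩
  obtain ⟨εF, hεF, hF⟩ := R.F3 hη
  refine ⟨εF / 4, by positivity, ?_⟩
  intro yb w lam Q P hlam hQ hQU hMA hfr ⟨z, r, hr, hQB, hB4⟩ hdiam q0 hq0 h0 ν hν hνd d hd
  have hP4 := fun i => P.P4 R hQ hQU hfr hQB hB4 hη hεF (hF yb P.hyb) hdiam hq0 h0 (hν i) (hd i)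
  choose y hy hyQ l hl hGl hdl using hP4
  set h : ℝ := -w q0 with hh
  have hhp : 0 < h := by rw [hh]; linarith
  have hdpos : ∀ i, 0 < d i := fun i => by
    have h1 : 0 < d i * ((1 + η) * l i) := lt_of_lt_of_le (by positivity) (hdl i)
    have := hl i
    exact pos_of_mul_pos_left h1 (by positivity)
  have hlow : ∀ i, h / (4 * d i) ≤ l i := fun i => by
    rw [div_le_iff₀ (by have := hdpos i; positivity)]
    have h1 := hdl i
    have h2 : d i * ((1 + η) * l i) ≤ d i * (2 * l i) := by
      have := hdpos i; have := hl i
      gcongr; linarith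
    linarith
  set Y := Y12 n c U V yb Q q0 (h / 2) with hY
  obtain ⟨hconv, hzero⟩ := R.P5 P.hyb hQU hq0 (h := h / 2) (by positivity)
  have hvol1 := vol_parallel hn hconv hzero (p := fun i => Gq n c U V yb q0 (y i))
    (fun i => ⟨y i, ⟨hy i, hyQ i⟩, rfl⟩)
  have hvol2 := R.P6 P.hyb hQU hq0 (h / 2)
  have hQc := P.closedQ R hQ
  have hvol3 : volume Y ≤ ENNReal.ofReal (1 / lam) * volume Q := by
    refine (measure_mono ?_).trans (hMA Q Subset.rfl hQc.measurableSet)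
    intro y' hy'
    obtain ⟨q, hq, e⟩ := P.P7 R hQ hQU hfr hq0 h0 hy'.1 hy'.2
    refine mem_iUnion₂.2 ⟨q, hq, ?_⟩
    refine ⟨Uy_sub _ (hQU hq), hy'.1, ?_⟩
    rw [mm_eq] at e
    simp only; linarith
  -- determinant
  set B := (EuclideanSpace.basisFun (Fin n) ℝ).toBasis with hB
  have hD : |B.det (fun i => Gq n c U V yb q0 (y i))| =
      (∏ i, l i) * |B.det (fun i => ν i + (l i)⁻¹ • (Gq n c U V yb q0 (y i) - l i • ν i))| := by
    have e : (fun i => Gq n c U V yb q0 (y i)) =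
        fun i => l i • (ν i + (l i)⁻¹ • (Gq n c U V yb q0 (y i) - l i • ν i)) := by
      funext i
      rw [smul_add, smul_smul, mul_inv_cancel₀ (hl i).ne', one_smul]; abel
    conv_lhs => rw [e]
    rw [B.det.map_smul_univ l (fun i => ν i + (l i)⁻¹ • (Gq n c U V yb q0 (y i) - l i • ν i)),
      smul_eq_mul, abs_mul, abs_of_pos (Finset.prod_pos fun i _ => hl i)]
  have hD2 := hdet ν (fun i => (l i)⁻¹ • (Gq n c U V yb q0 (y i) - l i • ν i)) hν (fun i => by
    rw [norm_smul, norm_inv, Real.norm_eq_abs, abs_of_pos (hl i), inv_mul_le_iff₀ (hl i), mul_comm]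
    exact hGl i) hνd
  have hprod : h ^ n / (4 ^ n * ∏ i, d i) ≤ ∏ i, l i := by
    calc h ^ n / (4 ^ n * ∏ i, d i) = ∏ i, (h / (4 * d i)) := by
          rw [Finset.prod_div_distrib, Finset.prod_mul_distrib]; simp
      _ ≤ _ := Finset.prod_le_prod (fun i _ => by have := hdpos i; positivity) (fun i _ => hlow i)
  have hPd : 0 < ∏ i, d i := Finset.prod_pos fun i _ => hdpos i
  have hlb : h ^ n / (4 ^ n * ∏ i, d i) * (1 / (2 * √n)) / n ^ n ≤
      |B.det (fun i => Gq n c U V yb q0 (y i))| / n ^ n := by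
    rw [hD]
    gcongr
    exact Finset.prod_nonneg fun i _ => (hl i).le
  set γ := gammaPlus n (modCost n c U yb) Q V with hγ
  have hchain : ENNReal.ofReal (h ^ n / (4 ^ n * ∏ i, d i) * (1 / (2 * √n)) / n ^ n) ≤
      ENNReal.ofReal γ * (ENNReal.ofReal (1 / lam) * volume Q) :=
    (ENNReal.ofReal_le_ofReal hlb).trans (hvol1.trans (hvol2.trans (by gcongr)))
  have hLpos : 0 < h ^ n / (4 ^ n * ∏ i, d i) * (1 / (2 * √n)) / n ^ n := by positivity
  have hγpos : 0 < γ := by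
    by_contra hc
    push Not at hc
    rw [ENNReal.ofReal_of_nonpos hc, zero_mul, nonpos_iff_eq_zero, ENNReal.ofReal_eq_zero] at hchain
    linarith
  refine ⟨hγpos, hdpos, ?_⟩
  have hfin : volume Q ≠ ∞ := hQc.measure_lt_top.ne
  rw [← ENNReal.ofReal_toReal hfin, ← ENNReal.ofReal_mul (by positivity),
    ← ENNReal.ofReal_mul hγpos.le, ENNReal.ofReal_le_ofReal_iff (by positivity)] at hchain
  have e1 : h ^ n = (h ^ n / (4 ^ n * ∏ i, d i) * (1 / (2 * √n)) / n ^ n) *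
      ((4 * n) ^ n * (2 * √n) * ∏ i, d i) := by
    rw [mul_pow]; field_simp
  rw [e1]
  calc _ ≤ γ * (1 / lam * (volume Q).toReal) * ((4 * n) ^ n * (2 * √n) * ∏ i, d i) := by gcongr
    _ = _ := by ring

end D4g



section D5a

/-- singular value data -/
theorem svd_data {n : ℕ} (A : Euc n →L[ℝ] Euc n) :
    ∃ (e : OrthonormalBasis (Fin n) ℝ (Euc n)) (a : Fin n → ℝ), (∀ i, 0 ≤ a i) ∧
      ∏ i, a i = |A.det| ∧
      ∀ v, ‖ContinuousLinearMap.adjoint A v‖ ^ 2 = ∑ i, (a i * inner ℝ (e i) v) ^ 2 := by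
  set T : Euc n →ₗ[ℝ] Euc n := (A.comp (ContinuousLinearMap.adjoint A) : Euc n →L[ℝ] Euc n).toLinearMap with hTd
  have hin : ∀ v w, inner ℝ (T v) w =
      inner ℝ (ContinuousLinearMap.adjoint A v) (ContinuousLinearMap.adjoint A w) := fun v w => by
    rw [ContinuousLinearMap.adjoint_inner_right]; rfl
  have hT : T.IsSymmetric := fun v w => by
    rw [hin, real_inner_comm w (T w) |>.symm.trans rfl |> fun h => (real_inner_comm (T w) v), hin,
      real_inner_comm]
  have hf : Module.finrank ℝ (Euc n) = n := by simp [Euc]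
  set e := hT.eigenvectorBasis hf with he
  have hTe : ∀ i, T (e i) = hT.eigenvalues hf i • e i := fun i => hT.apply_eigenvectorBasis hf i
  have hsq : ∀ i, ‖ContinuousLinearMap.adjoint A (e i)‖ ^ 2 = hT.eigenvalues hf i := fun i => by
    rw [← real_inner_self_eq_norm_sq, ← hin, hTe, inner_smul_left, real_inner_self_eq_norm_sq,
      e.norm_eq_one]; simp
  refine ⟨e, fun i => ‖ContinuousLinearMap.adjoint A (e i)‖, fun i => norm_nonneg _, ?_, ?_⟩
  · have h1 : (∏ i, ‖ContinuousLinearMap.adjoint A (e i)‖) ^ 2 = A.det ^ 2 := by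
      rw [← Finset.prod_pow, Finset.prod_congr rfl (fun i _ => hsq i)]
      have := hT.det_eq_prod_eigenvalues hf
      simp only [RCLike.ofReal_real_eq_id, id] at this
      rw [← this, hTd]
      have h2 : LinearMap.det (ContinuousLinearMap.adjoint A).toLinearMap = A.det := by
        exact det_adj A
      rw [show (A.comp (ContinuousLinearMap.adjoint A) : Euc n →L[ℝ] Euc n).toLinearMap =
        A.toLinearMap.comp (ContinuousLinearMap.adjoint A).toLinearMap from rfl,
        LinearMap.det_comp, h2, sq]
    rw [← abs_of_nonneg (Finset.prod_nonneg fun i _ => norm_nonneg _)]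
    exact (sq_eq_sq_iff_abs_eq_abs _ _).1 h1
  · intro v
    rw [← real_inner_self_eq_norm_sq, ← hin]
    rw [← e.sum_inner_mul_inner]
    refine Finset.sum_congr rfl fun i _ => ?_
    rw [hT v, hTe, inner_smul_right, mul_pow, hsq, real_inner_comm v]; ring

theorem det_update {n : ℕ} (e : OrthonormalBasis (Fin n) ℝ (Euc n)) (k : Fin n) (v : Euc n) :
    |(EuclideanSpace.basisFun (Fin n) ℝ).toBasis.det (Function.update e k v)| =
      |inner ℝ (e k) v| := by
  rw [(EuclideanSpace.basisFun (Fin n) ℝ).toBasis.det.eq_smul_basis_det e.toBasis]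
  have h1 : |(EuclideanSpace.basisFun (Fin n) ℝ).toBasis.det e| = 1 := by
    rw [← Real.norm_eq_abs]
    exact OrthonormalBasis.det_to_matrix_orthonormalBasis _ _
  have h2 : e.toBasis.det (Function.update e k v) = inner ℝ (e k) v := by
    have : (e.toBasis.det.toMultilinearMap.toLinearMap e k : Euc n →ₗ[ℝ] ℝ) =
        (innerSL ℝ (e k)).toLinearMap := by
      refine e.toBasis.ext fun i => ?_
      simp only [OrthonormalBasis.coe_toBasis, MultilinearMap.toLinearMap_apply]
      by_cases hik : i = k
      · subst hik
        rw [Function.update_eq_self]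
        have := e.toBasis.det_self
        simp only [OrthonormalBasis.coe_toBasis] at this
        simp [this]
      · have h3 : e.toBasis.det (Function.update e k (e i)) = 0 := by
          refine AlternatingMap.map_eq_zero_of_eq _ _ (i := i) (j := k) ?_ hik
          simp [Function.update_of_ne hik]
        simp [h3, e.inner_eq_ite, Ne.symm hik]
    exact LinearMap.congr_fun this v
  simp [h1, h2, abs_mul]

theorem pigeon {n : ℕ} (b : Fin n → ℝ) (i0 : Fin n) (h0 : 0 ≤ b i0)
    {r : ℝ} (hr : 0 < r) (hr1 : r ≤ 1) :
    ∃ j : ℕ, j < n ∧ ∀ i, b i ≤ r ^ (j + 1) * b i0 ∨ r ^ j * b i0 ≤ b i := by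
  by_contra hc
  push Not at hc
  choose f hf1 hf2 using fun j : Fin n => hc j j.2
  have hinj : Function.Injective f := by
    have key : ∀ j j' : Fin n, j < j' → f j ≠ f j' := fun j j' hjj he => by
      have h1 := hf1 j
      have h2 := hf2 j'
      rw [← he] at h2
      have : r ^ (j':ℕ) ≤ r ^ ((j:ℕ) + 1) := pow_le_pow_of_le_one hr.le hr1 hjj
      nlinarith
    intro j j' he
    rcases lt_trichotomy j j' with h | h | h
    · exact absurd he (key _ _ h)
    · exact h
    · exact absurd he.symm (key _ _ h)
  obtain ⟨j, hj⟩ := (Finite.injective_iff_surjective.1 hinj) i0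
  have h2 := hf2 j
  rw [hj] at h2
  have : r ^ (j:ℕ) ≤ 1 := pow_le_one₀ hr.le hr1
  nlinarith

end D5a



section D5b

/-- direction selection -/
theorem sel_dir {n : ℕ} (hn : 0 < n) (e : OrthonormalBasis (Fin n) ℝ (Euc n)) (a : Fin n → ℝ)
    (ha : ∀ i, 0 < a i) (ν : Euc n) (hν : ν ≠ 0) {r : ℝ} (hr : 0 < r) (hr1 : r ≤ 1) :
    ∃ (k : Fin n) (μ : Euc n), ‖μ‖ = 1 ∧ 1 / √n ≤ |inner ℝ (e k) μ| ∧
      ∀ x : Euc n, inner ℝ ν x ≤ r ^ n * (n * √(∑ i, (a i * inner ℝ (e i) ν) ^ 2)) →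
        (∀ v, - inner ℝ v x ≤ 2 * n * √(∑ i, (a i * inner ℝ (e i) v) ^ 2)) →
        inner ℝ μ x ≤ 3 * n * √n * (r * a k) := by
  have hn' : (0:ℝ) < n := by exact_mod_cast hn
  have : Nonempty (Fin n) := ⟨⟨0, hn⟩⟩
  set b : Fin n → ℝ := fun i => a i * |inner ℝ (e i) ν| with hb
  have hbsq : ∀ i, (a i * inner ℝ (e i) ν) ^ 2 = b i ^ 2 := fun i => by
    simp only [hb, mul_pow, sq_abs]
  have hb0 : ∀ i, 0 ≤ b i := fun i => mul_nonneg (ha i).le (abs_nonneg _)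
  obtain ⟨i0, hi0⟩ := Finite.exists_max b
  have hbpos : 0 < b i0 := by
    by_contra hc
    apply hν
    have h0 : ∀ i, inner ℝ (e i) ν = 0 := fun i => by
      have h1 : b i = 0 := le_antisymm ((hi0 i).trans (not_lt.1 hc)) (hb0 i)
      simpa [hb, (ha i).ne'] using h1
    rw [← e.sum_repr' ν]
    simp [h0]
  obtain ⟨j, hjn, hj⟩ := pigeon b i0 hbpos.le hr hr1
  set S : Finset (Fin n) := Finset.univ.filter fun i => r ^ j * b i0 ≤ b i with hS
  have hi0S : i0 ∈ S := by
    simp only [hS, Finset.mem_filter, Finset.mem_univ, true_and]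
    have : r ^ j ≤ 1 := pow_le_one₀ hr.le hr1
    nlinarith
  obtain ⟨k, hkS, hk⟩ := S.exists_max_image (fun i => |inner ℝ (e i) ν|) ⟨i0, hi0S⟩
  have hbk : r ^ j * b i0 ≤ b k := by
    simpa [hS] using hkS
  set m : Euc n := ∑ i ∈ S, inner ℝ (e i) ν • e i with hm
  have hem : ∀ i, inner ℝ (e i) m = if i ∈ S then inner ℝ (e i) ν else 0 := fun i => by
    rw [hm, inner_sum]
    simp [inner_smul_right, e.inner_eq_ite]
  have hνk : 0 < |inner ℝ (e k) ν| := by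
    have h1 : 0 < b k := lt_of_lt_of_le (by positivity) hbk
    exact pos_of_mul_pos_right h1 (ha k).le
  have hkm : |inner ℝ (e k) ν| ≤ ‖m‖ := by
    have h1 := abs_real_inner_le_norm (e k) m
    rw [hem, if_pos hkS, e.norm_eq_one, one_mul] at h1
    exact h1
  have hmpos : 0 < ‖m‖ := hνk.trans_le hkm
  have hmk : ‖m‖ ≤ √n * |inner ℝ (e k) ν| := by
    have h1 : ‖m‖ ^ 2 ≤ n * |inner ℝ (e k) ν| ^ 2 := by
      rw [← e.sum_sq_norm_inner_right m]
      calc _ ≤ ∑ i : Fin n, |inner ℝ (e k) ν| ^ 2 := by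
            refine Finset.sum_le_sum fun i _ => ?_
            rw [hem, Real.norm_eq_abs]
            split_ifs with h
            · exact pow_le_pow_left₀ (abs_nonneg _) (hk i h) 2
            · simp; positivity
        _ = _ := by simp
    rw [← Real.sqrt_sq (norm_nonneg m), ← Real.sqrt_sq (abs_nonneg (inner ℝ (e k) ν)),
      ← Real.sqrt_mul hn'.le]
    exact Real.sqrt_le_sqrt h1
  refine ⟨k, ‖m‖⁻¹ • m, ?_, ?_, ?_⟩
  · rw [norm_smul, norm_inv, norm_norm, inv_mul_cancel₀ hmpos.ne']
  · rw [inner_smul_right, hem, if_pos hkS, abs_mul, abs_inv, abs_norm, div_le_iff₀ (by positivity),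
      mul_assoc, le_inv_mul_iff₀ hmpos, mul_comm _ (√(n:ℝ)), mul_one]
    exact hmk
  · intro x hx1 hx2
    rw [inner_smul_left, conj_trivial, inv_mul_le_iff₀ hmpos]
    have e1 : inner ℝ m x = inner ℝ ν x + - inner ℝ (ν - m) x := by rw [inner_sub_left]; ring
    have h1 : √(∑ i, (a i * inner ℝ (e i) ν) ^ 2) ≤ √n * b i0 := by
      rw [← Real.sqrt_sq hbpos.le, ← Real.sqrt_mul hn'.le]
      refine Real.sqrt_le_sqrt ?_
      calc _ ≤ ∑ i : Fin n, b i0 ^ 2 := Finset.sum_le_sum fun i _ => by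
            rw [hbsq]; have := hb0 i; have := hi0 i; gcongr
        _ = _ := by simp
    have h2 : √(∑ i, (a i * inner ℝ (e i) (ν - m)) ^ 2) ≤ √n * (r ^ (j+1) * b i0) := by
      have h0 : 0 ≤ r ^ (j+1) * b i0 := by positivity
      rw [← Real.sqrt_sq h0, ← Real.sqrt_mul hn'.le]
      refine Real.sqrt_le_sqrt ?_
      calc _ ≤ ∑ i : Fin n, (r ^ (j+1) * b i0) ^ 2 := Finset.sum_le_sum fun i _ => by
            rw [inner_sub_right, hem]
            split_ifs with h
            · simp; positivity
            · rw [sub_zero, hbsq]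
              have h3 := (hj i).resolve_right (by simpa [hS] using h)
              have := hb0 i; gcongr
        _ = _ := by simp
    have h3 : r ^ n ≤ r ^ (j + 1) := pow_le_pow_of_le_one hr.le hr1 hjn
    have h4 := hx2 (ν - m)
    have h5 : r ^ n * (n * √(∑ i, (a i * inner ℝ (e i) ν) ^ 2)) ≤ r ^ (j+1) * (n * (√n * b i0)) := by
      gcongr
    have h6 : 2 * n * √(∑ i, (a i * inner ℝ (e i) (ν - m)) ^ 2) ≤ 2 * n * (√n * (r ^ (j+1) * b i0)) := by
      gcongr
    have h7 : r ^ (j+1) * b i0 ≤ r * (a k * ‖m‖) := by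
      calc _ = r * (r ^ j * b i0) := by ring
        _ ≤ r * b k := by gcongr
        _ ≤ _ := by
          simp only [hb]
          have := (ha k).le
          gcongr
    have h8 : 3 * n * √n * (r ^ (j+1) * b i0) ≤ 3 * n * √n * (r * (a k * ‖m‖)) := by gcongr
    rw [e1]
    linarith

end D5b



section D5c

theorem gammaPlus_nonneg' {n : ℕ} (c : Euc n → Euc n → ℝ) (U V : Set (Euc n)) :
    0 ≤ gammaPlus n c U V := by
  refine Real.sSup_nonneg ?_
  rintro _ ⟨p, _, rfl⟩
  exact abs_nonneg _

theorem supp_normal {n : ℕ} {Q : Set (Euc n)} (hQ : Convex ℝ Q) (hi : (interior Q).Nonempty)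
    {z : Euc n} (hz : z ∈ frontier Q) :
    ∃ ν : Euc n, ν ≠ 0 ∧ ∀ q ∈ Q, inner ℝ ν q ≤ inner ℝ ν z := by
  obtain ⟨f, hf⟩ := geometric_hahn_banach_open_point hQ.interior isOpen_interior hz.2
  set ν := (InnerProductSpace.toDual ℝ (Euc n)).symm f with hν
  have hfν : ∀ x, f x = inner ℝ ν x := fun x => by
    rw [hν, InnerProductSpace.toDual_symm_apply]
  refine ⟨ν, ?_, ?_⟩
  · intro h0
    obtain ⟨p, hp⟩ := hi
    have := hf p hp
    simp [hfν, h0] at this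
  · intro q hq
    have h1 : q ∈ closure (interior Q) := by
      rw [hQ.closure_interior_eq_closure_of_nonempty_interior hi]; exact subset_closure hq
    have h2 : closure (interior Q) ⊆ {x | inner ℝ ν x ≤ inner ℝ ν z} := by
      refine closure_minimal (fun p hp => ?_) ?_
      · have := hf p hp
        rw [hfν, hfν] at this
        exact this.le
      · exact isClosed_le (by fun_prop) (by fun_prop)
    exact h2 h1

theorem main_pos {n : ℕ} (hn : 0 < n) : ∃ C : ℝ, 0 < C ∧
    ∀ (c : Euc n → Euc n → ℝ) (U V : Set (Euc n)), Reg n c U V →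
    ∃ ε > (0:ℝ), ∀ (yb : Euc n) (w : Euc n → ℝ) (lam : ℝ) (L : Euc n →ᵃ[ℝ] Euc n) (Q : Set (Euc n))
      (_ : Pot n c U V yb w (cStarT n (modCost n c U yb) (clUy n c U yb) w))
      (_ : 0 < lam) (_ : Q = {q ∈ clUy n c U yb | w q ≤ 0}) (_ : Q ⊆ Uyset n c U yb)
      (_ : MAle n (modCost n c U yb) (clUy n c U yb) (closure V) w (1 / lam) Q)
      (_ : ∀ q ∈ frontier Q, w q = 0)
      (_ : ∃ z r, 0 < r ∧ Q ⊆ Metric.ball z r ∧ Metric.ball z (4 * r) ⊆ Uyset n c U yb)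
      (_ : Metric.diam Q ≤ ε)
      (_ : L '' Metric.closedBall 0 1 ⊆ Q) (_ : Q ⊆ L '' Metric.closedBall 0 (n : ℝ)),
      (∀ t : ℝ, ∀ qt : Euc n, 1 / (2 * n) < t → t ≤ 1 →
        qt ∈ (fun z => L 0 + t • (z - L 0)) '' frontier Q →
        |w qt| ^ n ≤ C * (gammaPlus n (modCost n c U yb) Q V / lam) *
          (1 - t) ^ ((1 : ℝ) / 2 ^ (n - 1)) * (volume Q).toReal ^ 2) ∧
      |sInf (w '' Q)| ^ n ≤ C * (gammaPlus n (modCost n c U yb) Q V / lam) *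
          (volume Q).toReal ^ 2 := by
  obtain ⟨C0, hC0, hcore⟩ := core_est hn
  have hn' : (1:ℝ) ≤ n := by exact_mod_cast hn
  have hsn : 1 ≤ √(n:ℝ) := Real.one_le_sqrt.2 hn'
  set κ := (volume (closedBall (0 : Euc n) 1)).toReal with hκ
  have hκ0 : 0 < κ := ENNReal.toReal_pos (measure_closedBall_pos _ _ one_pos).ne'
    measure_closedBall_lt_top.ne
  obtain ⟨K, hK⟩ : ∃ K : ℝ, K = 3 * n * √n := ⟨_, rfl⟩
  have hK2 : 2 * (n:ℝ) ≤ K := by rw [hK]; nlinarith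
  have hK0 : 0 < K := by linarith
  refine ⟨C0 * K ^ n / κ, by positivity, fun c U V R => ?_⟩
  obtain ⟨ε, hε, hc⟩ := hcore c U V R
  refine ⟨ε, hε, ?_⟩
  intro yb w lam L Q P hlam hQ hQU hMA hfr hball hdiam hL1 hL2
  have hQc := P.closedQ R hQ
  have hQcv := P.convexQ R hQ hQU
  set γ := gammaPlus n (modCost n c U yb) Q V with hγ
  have hγ0 : 0 ≤ γ := gammaPlus_nonneg' _ _ _
  have hL0 : L 0 ∈ Q := hL1 ⟨0, by simp, rfl⟩
  have hwle : ∀ q ∈ Q, w q ≤ 0 := fun q hq => by rw [hQ] at hq; exact hq.2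
  set A : Euc n →L[ℝ] Euc n := LinearMap.toContinuousLinearMap L.linear with hA
  have hLA : ∀ x, L x = A x + L 0 := fun x => by
    have := congrFun L.decomp x
    simpa [hA] using this
  obtain ⟨e, a, ha0, hadet, hasq⟩ := svd_data A
  have hvol : (∏ i, a i) * κ ≤ (volume Q).toReal := by
    have h1 : L '' closedBall 0 1 = (fun x => x + L 0) '' (A '' closedBall 0 1) := by
      rw [image_image]; exact image_congr fun x _ => hLA x
    have h2 : volume (L '' closedBall (0 : Euc n) 1) = ENNReal.ofReal |A.det| * volume (closedBall (0 : Euc n) 1) := by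
      rw [h1, image_add_right, measure_preimage_add_right]
      exact Measure.addHaar_image_continuousLinearMap volume A _
    have h3 := ENNReal.toReal_mono hQc.measure_lt_top.ne (measure_mono (μ := volume) hL1)
    rw [h2, ENNReal.toReal_mul, ENNReal.toReal_ofReal (abs_nonneg _), ← hadet] at h3
    exact h3
  -- support bounds
  have hnorm : ∀ v, ‖ContinuousLinearMap.adjoint A v‖ = √(∑ i, (a i * inner ℝ (e i) v) ^ 2) :=
    fun v => by rw [← hasq, Real.sqrt_sq (norm_nonneg _)]
  have hnorme : ∀ i, √(∑ j, (a j * inner ℝ (e j) (e i)) ^ 2) = a i := fun i => by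
    rw [← Real.sqrt_sq (ha0 i)]
    congr 1
    simp [e.inner_eq_ite]
  have hsup : ∀ v, ∀ q ∈ Q, |inner ℝ v (q - L 0)| ≤ n * √(∑ i, (a i * inner ℝ (e i) v) ^ 2) := by
    intro v q hq
    obtain ⟨x, hx, rfl⟩ := hL2 hq
    rw [hLA x, add_sub_cancel_right, ← ContinuousLinearMap.adjoint_inner_left, ← hnorm, mul_comm]
    refine (abs_real_inner_le_norm _ _).trans ?_
    gcongr
    simpa using hx
  have hsup2 : ∀ v, ∀ q ∈ Q, ∀ p ∈ Q, |inner ℝ v (q - p)| ≤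
      2 * n * √(∑ i, (a i * inner ℝ (e i) v) ^ 2) := by
    intro v q hq p hp
    have h1 := hsup v q hq
    have h2 := hsup v p hp
    rw [show q - p = (q - L 0) - (p - L 0) by abel, inner_sub_right]
    refine (abs_sub _ _).trans ?_
    linarith
  have hdetE : 1 / √(n:ℝ) ≤ |(EuclideanSpace.basisFun (Fin n) ℝ).toBasis.det e| := by
    have h1 : |(EuclideanSpace.basisFun (Fin n) ℝ).toBasis.det e| = 1 := by
      rw [← Real.norm_eq_abs]
      exact OrthonormalBasis.det_to_matrix_orthonormalBasis _ _
    rw [h1, div_le_one (by positivity)]; exact hsn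
  have hbasic : ∀ q0 ∈ Q, w q0 < 0 → (∀ i, 0 < K * a i) ∧
      (-w q0) ^ n ≤ C0 * (γ / lam) * (∏ i, K * a i) * (volume Q).toReal := by
    intro q0 hq0 hw0
    have := hc yb w lam Q P hlam hQ hQU hMA hfr hball hdiam q0 hq0 hw0 e e.norm_eq_one hdetE
      (fun i => K * a i) (fun i q hq => by
        have h1 := (le_abs_self _).trans (hsup2 (e i) q hq q0 hq0)
        rw [hnorme] at h1
        exact h1.trans (mul_le_mul_of_nonneg_right hK2 (ha0 i)))
    exact this.2
  have hvq0 : 0 ≤ (volume Q).toReal := ENNReal.toReal_nonneg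
  have hconst : ∀ ρ : ℝ, 0 ≤ ρ → C0 * (γ / lam) * (K ^ n * ρ * ∏ i, a i) * (volume Q).toReal ≤
      C0 * K ^ n / κ * (γ / lam) * ρ * (volume Q).toReal ^ 2 := by
    intro ρ hρ
    have h1 : ∏ i, a i ≤ (volume Q).toReal / κ := by rwa [le_div_iff₀ hκ0]
    calc _ ≤ C0 * (γ / lam) * (K ^ n * ρ * ((volume Q).toReal / κ)) * (volume Q).toReal := by gcongr
      _ = _ := by field_simp
  constructor
  · rintro t _ ht ht1 ⟨z, hz, rfl⟩
    beta_reduce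
    have ht0 : 0 < t := lt_trans (by positivity) ht
    set qt := L 0 + t • (z - L 0) with hqt
    have hzQ : z ∈ Q := hQc.isClosed.frontier_subset hz
    have hqtQ : qt ∈ Q := by
      have := hQcv hL0 hzQ (sub_nonneg.2 ht1) ht0.le (by ring)
      rw [hqt, show L 0 + t • (z - L 0) = (1 - t) • L 0 + t • z by module]
      exact this
    have hs0 : 0 ≤ 1 - t := sub_nonneg.2 ht1
    have hsp : 0 ≤ (1 - t) ^ ((1 : ℝ) / 2 ^ (n - 1)) := Real.rpow_nonneg hs0 _
    rcases (hwle qt hqtQ).lt_or_eq with hw | hw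
    swap
    · rw [hw, abs_zero, zero_pow hn.ne']; positivity
    have hs : 0 < 1 - t := by
      refine lt_of_le_of_ne hs0 fun h0 => ?_
      have h1 : t = 1 := by linarith
      rw [h1, one_smul, add_sub_cancel] at hqt
      rw [hqt] at hw
      exact absurd (hfr z hz) hw.ne
    obtain ⟨hapos, -⟩ := hbasic qt hqtQ hw
    have hap : ∀ i, 0 < a i := fun i => pos_of_mul_pos_right (hapos i) hK0.le
    have hint : (interior Q).Nonempty := by
      by_contra hne
      rw [not_nonempty_iff_eq_empty] at hne
      have h1 := hQcv.addHaar_frontier volume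
      rw [hQc.isClosed.frontier_eq, hne, sdiff_empty] at h1
      rw [h1, ENNReal.toReal_zero] at hvol
      have : 0 < (∏ i, a i) * κ := mul_pos (Finset.prod_pos fun i _ => hap i) hκ0
      linarith
    obtain ⟨ν, hν, hsν⟩ := supp_normal hQcv hint hz
    set r : ℝ := (1 - t) ^ ((1:ℝ) / n) with hr
    have hr0 : 0 < r := Real.rpow_pos_of_pos hs _
    have hr1 : r ≤ 1 := Real.rpow_le_one hs0 (by linarith) (by positivity)
    have hrn : r ^ n = 1 - t := by
      rw [hr, ← Real.rpow_natCast, ← Real.rpow_mul hs0, one_div, inv_mul_cancel₀ (by positivity),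
        Real.rpow_one]
    obtain ⟨k, μ, hμ1, hμ2, hμ3⟩ := sel_dir hn e a hap ν hν hr0 hr1
    have hcr := hc yb w lam Q P hlam hQ hQU hMA hfr hball hdiam qt hqtQ hw (Function.update e k μ)
      (fun i => by
        by_cases h : i = k
        · subst h; simpa using hμ1
        · rw [Function.update_of_ne h]; exact e.norm_eq_one i)
      (by rw [det_update]; exact hμ2)
      (fun i => K * ((if i = k then r else 1) * a i)) (fun i q hq => by
        by_cases h : i = k
        · subst h
          rw [Function.update_self, if_pos rfl, hK]
          refine hμ3 (q - qt) ?_ (fun v => (neg_le_abs _).trans (hsup2 v q hq qt hqtQ))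
          have h1 := hsν q hq
          have h2 := (le_abs_self _).trans (hsup ν z hzQ)
          have h3 : inner ℝ ν (q - qt) = (inner ℝ ν q - inner ℝ ν z) + (1 - t) * inner ℝ ν (z - L 0) := by
            rw [hqt]; simp only [inner_sub_right, inner_add_right, inner_smul_right]; ring
          rw [h3, hrn]
          nlinarith [mul_le_mul_of_nonneg_left h2 hs0]
        · rw [Function.update_of_ne h, if_neg h, one_mul]
          have h1 := (le_abs_self _).trans (hsup2 (e i) q hq qt hqtQ)
          rw [hnorme] at h1
          exact h1.trans (mul_le_mul_of_nonneg_right hK2 (ha0 i)))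
    have h1 := hcr.2.2
    rw [Finset.prod_mul_distrib, Finset.prod_mul_distrib, Finset.prod_ite_eq' , if_pos (Finset.mem_univ k),
      Finset.prod_const, Finset.card_univ, Fintype.card_fin, ← mul_assoc (K ^ n)] at h1
    rw [abs_of_neg hw]
    refine h1.trans ((hconst r hr0.le).trans ?_)
    have hrle : r ≤ (1 - t) ^ ((1 : ℝ) / 2 ^ (n - 1)) := by
      refine Real.rpow_le_rpow_of_exponent_ge hs (by linarith) ?_
      refine one_div_le_one_div_of_le (by positivity) ?_
      have : n ≤ 2 ^ (n - 1) := by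
        have := Nat.lt_two_pow_self (n := n - 1)
        omega
      exact_mod_cast this
    gcongr
  · obtain ⟨q0, hq0, hmin⟩ := hQc.exists_isMinOn ⟨_, hL0⟩ (f := w) (P.wc.mono (by
      rw [hQ]; exact fun q hq => hq.1))
    have hinf : sInf (w '' Q) = w q0 :=
      IsLeast.csInf_eq ⟨⟨q0, hq0, rfl⟩, by rintro _ ⟨q, hq, rfl⟩; exact hmin hq⟩
    rw [hinf]
    rcases (hwle q0 hq0).lt_or_eq with hw | hw
    · obtain ⟨-, h1⟩ := hbasic q0 hq0 hw
      rw [abs_of_neg hw]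
      have h2 := hconst 1 zero_le_one
      rw [Finset.prod_mul_distrib, Finset.prod_const, Finset.card_univ, Fintype.card_fin] at h1
      simp only [mul_one] at h2
      exact h1.trans h2
    · rw [hw, abs_zero, zero_pow hn.ne']; positivity

end D5c



section D6

theorem vol_univ_zero : volume (univ : Set (Euc 0)) = 1 := by
  have h := (EuclideanSpace.basisFun (Fin 0) ℝ).volume_parallelepiped
  rwa [Subsingleton.eq_univ_of_nonempty (s := parallelepiped (EuclideanSpace.basisFun (Fin 0) ℝ))
    ⟨_, mem_image_of_mem _ (left_mem_Icc.2 zero_le_one)⟩] at h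

theorem zero_case (c : Euc 0 → Euc 0 → ℝ) (V A Q : Set (Euc 0)) (w : Euc 0 → ℝ) (lam : ℝ)
    (hV : V.Nonempty) (hlam : 0 < lam) (hQ : Q.Nonempty) (hQA : Q ⊆ A)
    (hMA : MAle 0 c A (closure V) w (1 / lam) Q) :
    1 ≤ (gammaPlus 0 c Q V / lam) * (volume Q).toReal ^ 2 := by
  have hu : ∀ s : Set (Euc 0), s.Nonempty → volume s = 1 := fun s hs => by
    rw [Subsingleton.eq_univ_of_nonempty hs, vol_univ_zero]
  obtain ⟨q, hq⟩ := hQ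
  obtain ⟨y, hy⟩ := hV
  have hγ : gammaPlus 0 c Q V = 1 := by
    unfold gammaPlus
    rw [show (fun p : Euc 0 × Euc 0 => |LinearMap.det
      ((DxyC 0 c p.1 p.2 : Euc 0 →L[ℝ] Euc 0) : Euc 0 →ₗ[ℝ] Euc 0)|) = fun _ => (1:ℝ) from
      funext fun p => by rw [LinearMap.det_eq_one_of_subsingleton, abs_one],
      Set.Nonempty.image_const (s := Q ×ˢ V) ⟨(q, y), hq, hy⟩, csSup_singleton]
  have hst : cStarT 0 c A w y = - c q y - w q := by
    unfold cStarT
    rw [show (fun x => -c x y - w x) '' A = {- c q y - w q} from ?_, csSup_singleton]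
    ext r
    constructor
    · rintro ⟨x, -, rfl⟩
      simp only [Subsingleton.elim x q]; rfl
    · rintro rfl
      exact ⟨q, hQA hq, rfl⟩
  have h1 := hMA Q Subset.rfl (by
    rw [Subsingleton.eq_univ_of_nonempty ⟨q, hq⟩]; exact MeasurableSet.univ)
  have h2 : (cSubdiffImg 0 c A (closure V) w Q).Nonempty :=
    ⟨y, mem_iUnion₂.2 ⟨q, hq, hQA hq, subset_closure hy, by simp only [hst]; ring⟩⟩
  rw [hu Q ⟨q, hq⟩, hu _ h2, mul_one, ENNReal.one_le_ofReal] at h1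
  rw [hγ, hu Q ⟨q, hq⟩]; simpa using h1

end D6


/-- Theorem 6.11: Alexandrov type upper bound. The constant `C`
depends only on the dimension, and `ε_c'` only on the dimension and the cost. -/
theorem alexandrov_upper_bound (n : ℕ) :
    ∃ C : ℝ, 0 < C ∧
      ∀ (c : Euc n → Euc n → ℝ) (U V : Set (Euc n)),
        B0cond n c U V → B1cond n c U V → B2cond n c U V → B3cond n c U V →
        ∃ εc' : ℝ, 0 < εc' ∧
          ∀ (u : Euc n → ℝ) (ybar : Euc n) (lam : ℝ) (L : Euc n →ᵃ[ℝ] Euc n)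
            (Q : Set (Euc n)),
            ybar ∈ closure V →
            CConvexOn n c (closure U) (closure V) u →
            0 < lam →
            Q = {q ∈ clUy n c U ybar | modPot n c U ybar u q ≤ 0} →
            Q ⊆ Uyset n c U ybar →
            -- `|∂^{c̃}ũ| ≤ 1/λ` in `Q` and `ũ = 0` on `∂Q`
            MAle n (modCost n c U ybar) (clUy n c U ybar) (closure V)
              (modPot n c U ybar u) (1 / lam) Q →
            (∀ q ∈ frontier Q, modPot n c U ybar u q = 0) →
            -- `Q ⊂ B ⊂ 4·B ⊂ U_ȳ` and `diam Q ≤ ε_c'`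
            (∃ z r, 0 < r ∧ Q ⊆ Metric.ball z r ∧
              Metric.ball z (4 * r) ⊆ Uyset n c U ybar) →
            Metric.diam Q ≤ εc' →
            -- John ellipsoid `E = L(B₁)` of `Q`
            L '' Metric.closedBall 0 1 ⊆ Q →
            Q ⊆ L '' Metric.closedBall 0 (n : ℝ) →
            (∀ t : ℝ, ∀ qt : Euc n, 1 / (2 * n) < t → t ≤ 1 →
              qt ∈ (fun z => L 0 + t • (z - L 0)) '' frontier Q →
              |modPot n c U ybar u qt| ^ n ≤
                C * (gammaPlus n (modCost n c U ybar) Q V / lam) *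
                  (1 - t) ^ ((1 : ℝ) / 2 ^ (n - 1)) * (volume Q).toReal ^ 2) ∧
            |sInf (modPot n c U ybar u '' Q)| ^ n ≤
              C * (gammaPlus n (modCost n c U ybar) Q V / lam) *
                (volume Q).toReal ^ 2 := by
  rcases Nat.eq_zero_or_pos n with rfl | hn
  · refine ⟨1, one_pos, fun c U V _ _ _ _ => ⟨1, one_pos, ?_⟩⟩
    intro u yb lam L Q hyb hu hlam hQ hQU hMA hfr hball hdiam hL1 hL2
    have hL0 : L 0 ∈ Q := hL1 ⟨0, by simp, rfl⟩
    have hV : V.Nonempty := closure_nonempty_iff.1 ⟨yb, hyb⟩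
    constructor
    · rintro t _ ht ht1 ⟨z, hz, rfl⟩
      rw [Subsingleton.eq_univ_of_nonempty ⟨_, hL0⟩, frontier_univ] at hz
      exact absurd hz (notMem_empty _)
    · rw [pow_zero, one_mul]
      exact zero_case _ V (clUy 0 c U yb) Q _ lam hV hlam ⟨_, hL0⟩
        (by rw [hQ]; exact fun q hq => hq.1) hMA
  · obtain ⟨C, hC, hmain⟩ := main_pos hn
    refine ⟨C, hC, fun c U V b0 b1 b2 b3 => ?_⟩
    by_cases hne : U.Nonempty ∧ V.Nonempty
    · have R := mk_Reg hn hne.1 hne.2 b0 b1 b2 b3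
      obtain ⟨ε, hε, h⟩ := hmain c U V R
      refine ⟨ε, hε, ?_⟩
      intro u yb lam L Q hyb hu hlam hQ hQU hMA hfr hball hdiam hL1 hL2
      exact h yb (modPot n c U yb u) lam L Q (R.mkPot hyb hu) hlam hQ hQU hMA hfr hball hdiam hL1 hL2
    · refine ⟨1, one_pos, ?_⟩
      intro u yb lam L Q hyb hu hlam hQ hQU hMA hfr hball hdiam hL1 hL2
      exfalso
      have hL0 : L 0 ∈ Q := hL1 ⟨0, by simp, rfl⟩
      obtain ⟨x, hx, -⟩ := hQU hL0
      exact hne ⟨⟨x, hx⟩, closure_nonempty_iff.1 ⟨yb, hyb⟩⟩
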